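/- Let ⟨S | R⟩ be a classical C'(1/6) presentation with S finite and group G. Then every infinite-order element x ∈ G satisfies τ(x) ≥ 1/3; equivalently, |xⁿ|_S ≥ n/3 for all n ≥ 1. In particular, translation lengths of infinite-order elements are bounded away from zero. -/

import Mathlib

/- Common definitions: words, classical C'(1/6) presentations, word metrics,
   contraction, Morse property, etc. -/

namespace GSC

open Filter

/-- A word over the alphabet `S`: a list of letters with an exponent `±1`
(`true` = the letter, `false` = its formal inverse). -/
abbrev Word (S : Type) := List (S × Bool)

/-- The formal inverse of a word. -/
def wordInv {S : Type} (w : Word S) : Word S := (w.map fun l => (l.1, !l.2)).reverse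

/-- A word is (freely) reduced if no letter is followed by its formal inverse. -/
def Reduced {S : Type} (w : Word S) : Prop :=
  List.Chain' (fun a b => a.1 ≠ b.1 ∨ a.2 = b.2) w

/-- A word is cyclically reduced if its square is reduced. -/
def CyclicallyReduced {S : Type} (w : Word S) : Prop := Reduced (w ++ w)

/-- A piece with respect to a set of relators `R`: a word occurring as a prefix of
two distinct elements of `R`. -/
def IsPiece {S : Type} (R : Set (Word S)) (p : Word S) : Prop :=
  ∃ r₁ ∈ R, ∃ r₂ ∈ R, r₁ ≠ r₂ ∧ p <+: r₁ ∧ p <+: r₂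

/-- Closure of a set of words under inversion and cyclic permutation. -/
def symmClosure {S : Type} (R : Set (Word S)) : Set (Word S) :=
  {w | ∃ r ∈ R, ∃ n : ℕ, w = r.rotate n ∨ w = wordInv (r.rotate n)}

/-- A classical `C'(1/den)` collection of cyclically reduced words: after closing under
inversion and cyclic permutation, every piece `p` contained in a relator `r` satisfies
`den * |p| < |r|`. -/
def CprimeCollection {S : Type} (den : ℕ) (R : Set (Word S)) : Prop :=
  (∀ r ∈ R, CyclicallyReduced r) ∧
  ∀ r ∈ symmClosure R, ∀ p : Word S, p <+: r → IsPiece (symmClosure R) p →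
    den * p.length < r.length

/-- A classical `C'(1/6)` presentation: a set of cyclically reduced relators, closed under
inversion and cyclic permutation, in which every piece contained in a relator `r` has
length `< |r|/6`. -/
structure C6Presentation (S : Type) where
  rels : Set (Word S)
  cyclically_reduced : ∀ r ∈ rels, CyclicallyReduced r
  inv_mem : ∀ r ∈ rels, wordInv r ∈ rels
  rotate_mem : ∀ r ∈ rels, ∀ n : ℕ, r.rotate n ∈ rels
  small_cancellation : ∀ r ∈ rels, ∀ p : Word S, p <+: r → IsPiece rels p →
    6 * p.length < r.length

/-- The element of the free group represented by a word. -/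
def wordVal {S : Type} (w : Word S) : FreeGroup S :=
  (w.map fun l => (FreeGroup.of l.1) ^ (if l.2 then (1 : ℤ) else -1)).prod

/-- The group defined by a `C'(1/6)` presentation. -/
abbrev C6Presentation.Grp {S : Type} (P : C6Presentation S) : Type :=
  PresentedGroup (wordVal '' P.rels)

/-- The generating set of the presented group (the images of the letters of `S`). -/
def C6Presentation.gens {S : Type} (P : C6Presentation S) : Set P.Grp :=
  Set.range fun a : S => (PresentedGroup.of a : P.Grp)

/-- The element of the presented group represented by a word. -/
def C6Presentation.elt {S : Type} (P : C6Presentation S) (w : Word S) : P.Grp :=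
  (w.map fun l => (PresentedGroup.of l.1 : P.Grp) ^ (if l.2 then (1 : ℤ) else -1)).prod

/-- The word length of `g` with respect to a generating set `S ⊆ G`: the least `n`
such that `g` is a product of `n` elements of `S ∪ S⁻¹`. -/
noncomputable def wordLength {G : Type*} [Group G] (S : Set G) (g : G) : ℕ :=
  sInf {n : ℕ | ∃ l : List G, l.length = n ∧ (∀ x ∈ l, x ∈ S ∨ x⁻¹ ∈ S) ∧ l.prod = g}

/-- The word metric on `G` with respect to `S`, as a real-valued function. -/
noncomputable def wdist {G : Type*} [Group G] (S : Set G) (g h : G) : ℝ :=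
  (wordLength S (g⁻¹ * h) : ℝ)

/-- Distance from a point to a subset, in the word metric. -/
noncomputable def setDist {G : Type*} [Group G] (S : Set G) (x : G) (Y : Set G) : ℝ :=
  sInf (wdist S x '' Y)

/-- Closest point projection to a subset `Y`, in the word metric. -/
def proj {G : Type*} [Group G] (S : Set G) (Y : Set G) (x : G) : Set G :=
  {y ∈ Y | wdist S x y = setDist S x Y}

/-- Diameter of a subset, in the word metric. -/
noncomputable def setDiam {G : Type*} [Group G] (S : Set G) (A : Set G) : ℝ :=
  sSup {d : ℝ | ∃ x ∈ A, ∃ y ∈ A, d = wdist S x y}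

/-- Admissibility of a pair of contraction gauges `(ρ₁, ρ₂)`: both non-decreasing and
eventually non-negative, `ρ₁ r ≤ r`, `ρ₁` unbounded, and `ρ₂/ρ₁ → 0` at infinity. -/
def Admissible (ρ₁ ρ₂ : ℝ → ℝ) : Prop :=
  Monotone ρ₁ ∧ Monotone ρ₂ ∧
  (∀ᶠ r in atTop, 0 ≤ ρ₁ r) ∧ (∀ᶠ r in atTop, 0 ≤ ρ₂ r) ∧
  (∀ r : ℝ, ρ₁ r ≤ r) ∧ (∀ M : ℝ, ∃ r : ℝ, M ≤ ρ₁ r) ∧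
  Tendsto (fun r => ρ₂ r / ρ₁ r) atTop (nhds 0)

/-- `Y` is `(ρ₁,ρ₂)`-contracting inside the subspace `X` (with the metric induced by the
word metric of `S`): whenever `x, x' ∈ X` satisfy `d(x,x') ≤ ρ₁(d(x,Y))`, the projections
`π(x) ∪ π(x')` have diameter at most `ρ₂(d(x,Y))`. -/
def ContractingIn {G : Type*} [Group G] (S : Set G) (X Y : Set G) (ρ₁ ρ₂ : ℝ → ℝ) : Prop :=
  Admissible ρ₁ ρ₂ ∧
  ∀ x ∈ X, ∀ x' ∈ X, wdist S x x' ≤ ρ₁ (setDist S x Y) →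
    ∀ y ∈ proj S Y x ∪ proj S Y x', ∀ y' ∈ proj S Y x ∪ proj S Y x',
      wdist S y y' ≤ ρ₂ (setDist S x Y)

/-- `Y` is `(ρ₁,ρ₂)`-contracting in `Cay(G,S)`. -/
def ContractingWith {G : Type*} [Group G] (S : Set G) (ρ₁ ρ₂ : ℝ → ℝ) (Y : Set G) : Prop :=
  ContractingIn S Set.univ Y ρ₁ ρ₂

/-- `Y` is strongly contracting: `(r, C)`-contracting for some constant `C`. -/
def StronglyContracting {G : Type*} [Group G] (S : Set G) (Y : Set G) : Prop :=
  ∃ C : ℝ, ContractingWith S (fun r => r) (fun _ => C) Y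

/-- A sublinear function: non-decreasing, eventually non-negative, `f(r)/r → 0`. -/
def Sublinear (f : ℝ → ℝ) : Prop :=
  Monotone f ∧ (∀ᶠ r in atTop, 0 ≤ f r) ∧ Tendsto (fun r => f r / r) atTop (nhds 0)

/-- `f ⪯ g`: there are constants `C₁, C₂ > 0` and `C₃, C₄ ≥ 0` with
`f(x) ≤ C₁ g(C₂ x + C₃) + C₄` for all `x`. -/
def Preceq (f g : ℝ → ℝ) : Prop :=
  ∃ C₁ C₂ C₃ C₄ : ℝ, 0 < C₁ ∧ 0 < C₂ ∧ 0 ≤ C₃ ∧ 0 ≤ C₄ ∧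
    ∀ x : ℝ, f x ≤ C₁ * g (C₂ * x + C₃) + C₄

/-- `f ≍ g`: `f ⪯ g` and `g ⪯ f`. -/
def Asymp (f g : ℝ → ℝ) : Prop := Preceq f g ∧ Preceq g f

/-- `α ⊆ G` is a geodesic of `Cay(G,S)`: the image of an isometric embedding of a
subinterval of `ℤ` into `(G, d_S)`. -/
def IsGeodesic {G : Type*} [Group G] (S : Set G) (α : Set G) : Prop :=
  ∃ (I : Set ℤ) (γ : ℤ → G), I.OrdConnected ∧
    (∀ m ∈ I, ∀ n ∈ I, wdist S (γ m) (γ n) = |(m : ℝ) - (n : ℝ)|) ∧ α = γ '' I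

/-- `α ⊆ G` is a bi-infinite geodesic of `Cay(G,S)`. -/
def IsBiInfGeodesic {G : Type*} [Group G] (S : Set G) (α : Set G) : Prop :=
  ∃ γ : ℤ → G, (∀ m n : ℤ, wdist S (γ m) (γ n) = |(m : ℝ) - (n : ℝ)|) ∧ α = Set.range γ

/-- `Y` is Morse: there is `μ` such that every `(L,A)`-quasi-geodesic with endpoints on
`Y` stays in the `μ(L,A)`-neighborhood of `Y`. -/
def IsMorse {G : Type*} [Group G] (S : Set G) (Y : Set G) : Prop :=
  ∃ μ : ℝ → ℝ → ℝ, ∀ L A : ℝ, 1 ≤ L → 0 ≤ A →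
    ∀ (q : ℤ → G) (m n : ℤ), m ≤ n → q m ∈ Y → q n ∈ Y →
    (∀ i j : ℤ, m ≤ i → i ≤ n → m ≤ j → j ≤ n →
      L⁻¹ * |(i : ℝ) - (j : ℝ)| - A ≤ wdist S (q i) (q j) ∧
      wdist S (q i) (q j) ≤ L * |(i : ℝ) - (j : ℝ)| + A) →
    ∀ i : ℤ, m ≤ i → i ≤ n → setDist S (q i) Y ≤ μ L A

/-- Two subsets are at finite Hausdorff distance in the word metric. -/
def FinHausdorffDist {G : Type*} [Group G] (S : Set G) (A B : Set G) : Prop :=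
  ∃ ε : ℝ, (∀ a ∈ A, ∃ b ∈ B, wdist S a b ≤ ε) ∧ ∀ b ∈ B, ∃ a ∈ A, wdist S a b ≤ ε

/-- The embedded relator cycle determined by `g ∈ G(Γ)` and a relator `r`:
the set `{g ⋅ p̄ : p a prefix of r}`. -/
def relatorCycle {S : Type} (P : C6Presentation S) (g : P.Grp) (r : Word S) :
    Set P.Grp :=
  {x | ∃ p : Word S, p <+: r ∧ x = g * P.elt p}

/-- A geodesic `α` is locally `(ρ₁,ρ₂)`-contracting: for every embedded relator cycle
`Γ₀` meeting `α`, the set `Γ₀ ∩ α` is `(ρ₁,ρ₂)`-contracting as a subspace of `Γ₀`. -/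
def LocallyContracting {S : Type} (P : C6Presentation S) (α : Set P.Grp)
    (ρ₁ ρ₂ : ℝ → ℝ) : Prop :=
  ∀ (g : P.Grp) (r : Word S), r ∈ P.rels → (relatorCycle P g r ∩ α).Nonempty →
    ContractingIn P.gens (relatorCycle P g r) (relatorCycle P g r ∩ α) ρ₁ ρ₂

/-- The generating set `S ∪ W` of the coned-off space: `W` is the set of elements
represented by subwords of cyclic permutations of relators (equivalently, by prefixes
of relators, since the relator set is closed under cyclic permutation). -/
def conedGens {S : Type} (P : C6Presentation S) : Set P.Grp :=
  P.gens ∪ {x | ∃ r ∈ P.rels, ∃ p : Word S, p <+: r ∧ x = P.elt p}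

/-- The exponential growth rate of `(G,S)`. -/
noncomputable def growthRate {G : Type*} [Group G] (S : Set G) : ℝ :=
  limsup (fun n : ℕ => Real.log (Nat.card {g : G // wordLength S g ≤ n}) / (n : ℝ)) atTop

/-- Quasi-isometry of marked groups `(G,S)` and `(H,T)` via word metrics. -/
def QIsom {G H : Type*} [Group G] [Group H] (S : Set G) (T : Set H) : Prop :=
  ∃ (f : G → H) (L A : ℝ), 1 ≤ L ∧ 0 ≤ A ∧
    (∀ x y : G, L⁻¹ * wdist S x y - A ≤ wdist T (f x) (f y) ∧
      wdist T (f x) (f y) ≤ L * wdist S x y + A) ∧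
    ∀ h : H, ∃ x : G, wdist T (f x) h ≤ A

/-- A subgroup is virtually cyclic if it contains a cyclic subgroup of finite index. -/
def VirtuallyCyclic {G : Type*} [Group G] (E : Subgroup G) : Prop :=
  ∃ g : G, Subgroup.zpowers g ≤ E ∧ ((Subgroup.zpowers g).subgroupOf E).index ≠ 0

end GSC

namespace GSC

section Diagrams

variable {S : Type}

/-- The formal inverse of a letter. -/
def linv (a : S × Bool) : S × Bool := (a.1, !a.2)

@[simp] theorem linv_linv (a : S × Bool) : linv (linv a) = a := by simp [linv]

theorem linv_ne (a : S × Bool) : linv a ≠ a := by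
  intro h
  have := congrArg Prod.snd h
  simp [linv] at this

theorem linv_inj {a b : S × Bool} : linv a = linv b ↔ a = b :=
  ⟨fun h => by simpa using congrArg linv h, fun h => h ▸ rfl⟩

theorem linv_eq_iff {a b : S × Bool} : linv a = b ↔ a = linv b :=
  ⟨fun h => by simp [← h], fun h => by simp [h]⟩

theorem ne_linv_iff (a b : S × Bool) : b ≠ linv a ↔ (a.1 ≠ b.1 ∨ a.2 = b.2) := by
  obtain ⟨a, x⟩ := a
  obtain ⟨b, y⟩ := b
  cases x <;> cases y <;> simp [linv, eq_comm]

@[simp] theorem wordInv_nil : wordInv ([] : Word S) = [] := rfl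

@[simp] theorem wordInv_cons (a : S × Bool) (w : Word S) :
    wordInv (a :: w) = wordInv w ++ [linv a] := by
  simp [wordInv, linv]

@[simp] theorem wordInv_append (u v : Word S) : wordInv (u ++ v) = wordInv v ++ wordInv u := by
  simp [wordInv]

@[simp] theorem wordInv_wordInv (w : Word S) : wordInv (wordInv w) = w := by
  induction w with
  | nil => rfl
  | cons a w ih => simp [ih]

@[simp] theorem length_wordInv (w : Word S) : (wordInv w).length = w.length := by
  simp [wordInv]

@[simp] theorem wordInv_eq_nil {w : Word S} : wordInv w = [] ↔ w = [] := by
  simp [wordInv]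

theorem mk_wordInv (w : Word S) : FreeGroup.mk (wordInv w) = (FreeGroup.mk w)⁻¹ := by
  rw [FreeGroup.inv_mk]; rfl

theorem mk_append (u v : Word S) : FreeGroup.mk (u ++ v) = FreeGroup.mk u * FreeGroup.mk v := by
  rw [FreeGroup.mul_mk]

theorem mk_cons (a : S × Bool) (v : Word S) :
    FreeGroup.mk (a :: v) = FreeGroup.mk [a] * FreeGroup.mk v := by
  rw [FreeGroup.mul_mk]; rfl

theorem mk_linv (a : S × Bool) : FreeGroup.mk [linv a] = (FreeGroup.mk [a])⁻¹ := by
  rw [FreeGroup.inv_mk]; rfl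

/-- A set of nonempty words closed under inversion and cyclic permutation. -/
structure Symmetrized (R : Set (Word S)) : Prop where
  inv : ∀ r ∈ R, wordInv r ∈ R
  rot : ∀ x y, x ++ y ∈ R → y ++ x ∈ R
  ne_nil : ∀ r ∈ R, r ≠ []

/-- `Area R n g`: the element `g` of the free group is a product of at most `n` conjugates of
elements of `R`. -/
inductive Area (R : Set (Word S)) : ℕ → FreeGroup S → Prop
  | one (n : ℕ) : Area R n 1
  | mul {n : ℕ} {g : FreeGroup S} (u : FreeGroup S) {r : Word S} (hr : r ∈ R) (h : Area R n g) :
      Area R (n + 1) (u * FreeGroup.mk r * u⁻¹ * g)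

namespace Area

variable {R : Set (Word S)} {m n : ℕ} {g h : FreeGroup S}

theorem mono (hg : Area R n g) : ∀ {m}, n ≤ m → Area R m g := by
  induction hg with
  | one n => intro m _; exact .one m
  | mul u hr _ ih =>
    intro m hm
    obtain ⟨m, rfl⟩ : ∃ k, m = k + 1 := ⟨m - 1, by omega⟩
    exact .mul u hr (ih (by omega))

theorem mul' (hg : Area R m g) (hh : Area R n h) : Area R (m + n) (g * h) := by
  induction hg with
  | one k => simpa using hh.mono (by omega)
  | mul u hr _ ih =>
    rw [mul_assoc, Nat.add_right_comm]
    exact .mul u hr ih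

theorem conj (u : FreeGroup S) (hg : Area R n g) : Area R n (u * g * u⁻¹) := by
  induction hg with
  | one k => simpa using Area.one k
  | @mul n g v r hr _ ih =>
    have := Area.mul (u * v) hr ih
    convert this using 1
    group

theorem of_rel {r : Word S} (hr : r ∈ R) : Area R 1 (FreeGroup.mk r) := by
  simpa using Area.mul 1 hr (Area.one 0)

theorem inv (hR : Symmetrized R) (hg : Area R n g) : Area R n g⁻¹ := by
  induction hg with
  | one k => simpa using Area.one k
  | @mul n g v r hr _ ih =>
    have := ih.mul' ((of_rel (hR.inv r hr)).conj v)
    rw [mk_wordInv] at this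
    convert this using 1
    group

theorem conj_iff (u : FreeGroup S) : Area R n (u * g * u⁻¹) ↔ Area R n g :=
  ⟨fun h => by simpa [mul_assoc] using h.conj u⁻¹, conj u⟩

end Area

/-- Combinatorial null-homotopies: `Der R n w` says that `w` bounds a diagram with at most `n`
faces. -/
inductive Der (R : Set (Word S)) : ℕ → Word S → Prop
  | nil (n : ℕ) : Der R n []
  | edge {m n : ℕ} {a : S × Bool} {u v : Word S} (hu : Der R m u) (hv : Der R n v) :
      Der R (m + n) (a :: (u ++ linv a :: v))
  | face {n : ℕ} {a : S × Bool} {s v : Word S} (hr : a :: s ∈ R) (h : Der R n (wordInv s ++ v)) :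
      Der R (n + 1) (a :: v)
  | pinch {n : ℕ} {r y : Word S} (hr : r ∈ R) (h : Der R n (r ++ y)) : Der R (n + 1) y
  | rot {n : ℕ} {x y : Word S} (h : Der R n (x ++ y)) : Der R n (y ++ x)

/-- The two ways in which a letter `a` of the cyclic word `a z` can be incident to the
diagram. -/
def Peels (R : Set (Word S)) (n : ℕ) (a : S × Bool) (z : Word S) : Prop :=
  (∃ u v i j, z = u ++ linv a :: v ∧ Der R i u ∧ Der R j v ∧ i + j = n) ∨
    ∃ s m, a :: s ∈ R ∧ n = m + 1 ∧ Der R m (wordInv s ++ z)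

namespace Der

variable {R : Set (Word S)} {m n : ℕ} {u v : Word S}

theorem mono (h : Der R n u) : ∀ {m}, n ≤ m → Der R m u := by
  induction h with
  | nil n => intro m _; exact .nil m
  | @edge m n a u v _ _ ihu ihv =>
    intro k hk
    obtain ⟨k, rfl⟩ : ∃ l, k = m + l := ⟨k - m, by omega⟩
    exact .edge (ihu le_rfl) (ihv (by omega))
  | face hr _ ih =>
    intro m hm
    obtain ⟨m, rfl⟩ : ∃ k, m = k + 1 := ⟨m - 1, by omega⟩
    exact .face hr (ih (by omega))
  | pinch hr _ ih =>
    intro m hm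
    obtain ⟨m, rfl⟩ : ∃ k, m = k + 1 := ⟨m - 1, by omega⟩
    exact .pinch hr (ih (by omega))
  | rot _ ih => intro m hm; exact .rot (ih hm)

theorem insert_mid (hv : Der R n v) (hu : Der R m u) :
    ∀ x y, u = x ++ y → Der R (m + n) (x ++ (v ++ y)) := by
  induction hu with
  | nil k =>
    intro x y h
    obtain ⟨rfl, rfl⟩ := List.append_eq_nil_iff.1 h.symm
    simpa using hv.mono (by omega)
  | @edge k l a u' v' h1 h2 ih1 ih2 =>
    intro x y h
    rcases x with _ | ⟨b, x⟩
    · simp only [List.nil_append] at h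
      subst h
      have := Der.edge (a := a) h1 (ih2 v' [] (by simp))
      apply Der.rot (x := a :: (u' ++ linv a :: v'))
      simpa [add_assoc] using this
    · simp only [List.cons_append, List.cons.injEq] at h
      obtain ⟨rfl, h⟩ := h
      rcases List.append_eq_append_iff.1 h with ⟨as, rfl, h'⟩ | ⟨bs, rfl, rfl⟩
      · rcases as with _ | ⟨c, as⟩
        · simp only [List.nil_append] at h'
          subst h'
          have := Der.edge (a := a) (ih1 u' [] (by simp)) h2
          simpa [add_right_comm] using this
        · simp only [List.cons_append, List.cons.injEq] at h'
          obtain ⟨rfl, rfl⟩ := h'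
          simpa [add_assoc] using Der.edge (a := a) h1 (ih2 as y rfl)
      · simpa [add_right_comm] using Der.edge (a := a) (ih1 x bs rfl) h2
  | @face k a s v' hr h1 ih =>
    intro x y h
    rcases x with _ | ⟨b, x⟩
    · simp only [List.nil_append] at h
      subst h
      have := Der.face hr (by simpa using ih (wordInv s ++ v') [] (by simp))
      apply Der.rot (x := a :: v')
      simpa [add_right_comm] using this
    · simp only [List.cons_append, List.cons.injEq] at h
      obtain ⟨rfl, rfl⟩ := h
      have := Der.face hr (by simpa using ih (wordInv s ++ x) y (by simp))
      simpa [add_right_comm] using this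
  | @pinch k r z hr h1 ih =>
    rintro x y rfl
    have := ih (r ++ x) y (by simp)
    simp only [List.append_assoc] at this
    simpa [add_right_comm] using Der.pinch hr this
  | @rot k x' y' h1 ih =>
    intro x y h
    rcases List.append_eq_append_iff.1 h with ⟨as, rfl, rfl⟩ | ⟨bs, rfl, rfl⟩
    · have := ih as (y ++ y') (by simp)
      have := Der.rot (x := as ++ (v ++ y)) (y := y') (by simpa using this)
      simpa using this
    · have := ih (x' ++ x) bs (by simp)
      have := Der.rot (x := x') (y := x ++ (v ++ bs)) (by simpa using this)
      simpa using this

theorem cat (hu : Der R m u) (hv : Der R n v) : Der R (m + n) (u ++ v) := by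
  simpa using insert_mid hv hu u [] (by simp)

theorem conj (l : Word S) (hu : Der R m u) : Der R m (l ++ u ++ wordInv l) := by
  induction l with
  | nil => simpa using hu
  | cons a l ih => simpa using Der.edge (a := a) ih (Der.nil 0)

/-- A letter or empty word completing `wordInv k` to a relator may replace `k`. -/
theorem replace {k l x y : Word S} (hl : l.length ≤ 1) (hR : Symmetrized R)
    (hr : l ++ wordInv k ∈ R) (h : Der R n (y ++ (k ++ x))) : Der R (n + 1) (y ++ (l ++ x)) := by
  rcases l with _ | ⟨a, _ | ⟨b, l⟩⟩
  · have hk := hR.inv _ hr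
    simp only [List.nil_append, wordInv_wordInv] at hk
    have := Der.pinch (y := x ++ y) hk (by simpa using h.rot)
    simpa using this.rot
  · have := Der.face (v := x ++ y) (by simpa using hr) (by simpa using h.rot)
    have := Der.rot (x := a :: x) (y := y) (by simpa using this)
    simpa using this
  · simp at hl

end Der

namespace Peels

variable {R : Set (Word S)} {m n : ℕ} {a : S × Bool}

theorem insert {k x y : Word S} (hk : Der R n k) (h : Peels R m a (y ++ x)) :
    Peels R (m + n) a (y ++ (k ++ x)) := by
  rcases h with ⟨u, v, i, j, h, hu, hv, rfl⟩ | ⟨s, m, hr, rfl, h⟩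
  · left
    rcases List.append_eq_append_iff.1 h with ⟨as, rfl, rfl⟩ | ⟨bs, rfl, h'⟩
    · exact ⟨_, _, _, _, by simp, hk.insert_mid hu _ _ rfl, hv, by omega⟩
    · rcases bs with _ | ⟨c, bs⟩
      · simp only [List.nil_append] at h'
        subst h'
        refine ⟨_, _, _, _, ?_, hu.cat hk, hv, ?_⟩
        · simp
        · omega
      · simp only [List.cons_append, List.cons.injEq] at h'
        obtain ⟨rfl, rfl⟩ := h'
        exact ⟨_, _, _, _, by simp, hu, hk.insert_mid hv _ _ rfl, by omega⟩
  · right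
    refine ⟨s, m + n, hr, by omega, ?_⟩
    simpa using hk.insert_mid h (wordInv s ++ y) x (by simp)

theorem replace {k l x y : Word S} (hl : l.length ≤ 1) (hR : Symmetrized R)
    (hr : l ++ wordInv k ∈ R) (h : Peels R n a (y ++ (k ++ x))) :
    Peels R (n + 1) a (y ++ (l ++ x)) := by
  rcases h with ⟨u, v, i, j, h, hu, hv, rfl⟩ | ⟨s, m, hs, rfl, h⟩
  · rcases List.append_eq_append_iff.1 h with ⟨as, rfl, h'⟩ | ⟨bs, rfl, h'⟩
    · rcases List.append_eq_append_iff.1 h' with ⟨as', rfl, rfl⟩ | ⟨bs', rfl, h''⟩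
      · exact .inl ⟨_, _, _, _, by simp, hu.replace hl hR hr, hv, by omega⟩
      · rcases bs' with _ | ⟨c, bs'⟩
        · simp only [List.nil_append, List.append_nil] at h'' hr hu
          subst h''
          refine .inl ⟨_, _, _, _, ?_, Der.replace (x := []) hl hR hr (by simpa using hu), hv, ?_⟩
          · simp
          · omega
        · simp only [List.cons_append, List.cons.injEq] at h''
          obtain ⟨rfl, rfl⟩ := h''
          refine .inr ⟨wordInv as ++ (l ++ wordInv bs'), i + j, ?_, rfl, ?_⟩
          · apply hR.rot (l ++ wordInv bs') (a :: wordInv as)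
            simpa using hr
          · have h1 : Der R i (as ++ y) := hu.rot
            have h2 := (h1.conj (wordInv l)).cat (hv.rot (x := bs'))
            have h3 := Der.rot (x := wordInv l ++ as ++ y ++ l ++ x) (y := bs')
              (by simpa using h2)
            simpa using h3
    · rcases bs with _ | ⟨c, bs⟩
      · simp only [List.nil_append] at h'
        rcases k with _ | ⟨c, k⟩
        · simp only [List.nil_append] at h'
          subst h'
          simp only [wordInv_nil, List.append_nil] at hr
          refine .inl ⟨_, _, _, _, ?_, Der.replace (k := []) (x := []) hl hR (by simpa using hr)
            (by simpa using hu), hv, ?_⟩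
          · simp
          · omega
        · simp only [List.cons_append, List.cons.injEq] at h'
          obtain ⟨rfl, rfl⟩ := h'
          refine .inr ⟨l ++ wordInv k, i + j, ?_, rfl, ?_⟩
          · apply hR.rot (l ++ wordInv k) [a]
            simpa using hr
          · have h2 := (hu.conj (wordInv l)).cat (hv.rot (x := k))
            have h3 := Der.rot (x := wordInv l ++ u ++ l ++ x) (y := k)
              (by simpa using h2)
            simpa using h3
      · simp only [List.cons_append, List.cons.injEq] at h'
        obtain ⟨rfl, rfl⟩ := h'
        exact .inl ⟨_, _, _, _, by simp, hu, hv.replace hl hR hr, by omega⟩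
  · refine .inr ⟨s, m + 1, hs, rfl, ?_⟩
    have := Der.replace (y := wordInv s ++ y) hl hR hr (by simpa using h)
    simpa using this

end Peels

namespace Der

variable {R : Set (Word S)} {m n : ℕ} {u v : Word S}

theorem peel (hR : Symmetrized R) {w : Word S} (h : Der R n w) :
    ∀ x a y, w = x ++ a :: y → Peels R n a (y ++ x) := by
  induction h with
  | nil k => intro x a y h; simp at h
  | @edge k l b u v h1 h2 ih1 ih2 =>
    intro x a y h
    rcases x with _ | ⟨c, x⟩
    · simp only [List.nil_append, List.cons.injEq] at h
      obtain ⟨rfl, rfl⟩ := h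
      exact .inl ⟨u, v, k, l, by simp, h1, h2, rfl⟩
    · simp only [List.cons_append, List.cons.injEq] at h
      obtain ⟨rfl, h⟩ := h
      rcases List.append_eq_append_iff.1 h with ⟨as, rfl, h'⟩ | ⟨bs, rfl, h'⟩
      · rcases as with _ | ⟨c, as⟩
        · simp only [List.nil_append, List.cons.injEq] at h'
          obtain ⟨rfl, rfl⟩ := h'
          refine .inl ⟨v, u, l, k, by simp, h2, h1, by omega⟩
        · simp only [List.cons_append, List.cons.injEq] at h'
          obtain ⟨rfl, rfl⟩ := h'
          have := Peels.insert (h1.conj [b]) (ih2 as a y rfl)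
          rw [add_comm]
          simpa using this
      · rcases bs with _ | ⟨c, bs⟩
        · simp only [List.nil_append, List.cons.injEq] at h'
          obtain ⟨rfl, rfl⟩ := h'
          refine .inl ⟨_, x, l, k, by simp, h2, by simpa using h1, by omega⟩
        · simp only [List.cons_append, List.cons.injEq] at h'
          obtain ⟨rfl, rfl⟩ := h'
          have h3 : Der R l ([linv b] ++ v ++ [b]) := by simpa using h2.conj [linv b]
          have := Peels.insert h3 (ih1 x a bs rfl)
          simpa using this
  | @face k b s v hr h1 ih =>
    intro x a y h
    rcases x with _ | ⟨c, x⟩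
    · simp only [List.nil_append, List.cons.injEq] at h
      obtain ⟨rfl, rfl⟩ := h
      exact .inr ⟨s, k, hr, rfl, by simpa using h1⟩
    · simp only [List.cons_append, List.cons.injEq] at h
      obtain ⟨rfl, rfl⟩ := h
      have := ih (wordInv s ++ x) a y (by simp)
      exact Peels.replace (l := [b]) (by simp) hR (by simpa using hr) this
  | @pinch k r z hr h1 ih =>
    rintro x a y rfl
    have := ih (r ++ x) a y (by simp)
    exact Peels.replace (l := []) (by simp) hR (by simpa using hR.inv _ hr) this
  | @rot k x' y' h1 ih =>
    intro x a y h
    rcases List.append_eq_append_iff.1 h with ⟨as, rfl, rfl⟩ | ⟨bs, rfl, h'⟩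
    · simpa using ih as a (y ++ y') (by simp)
    · rcases bs with _ | ⟨c, bs⟩
      · simp only [List.nil_append] at h'
        subst h'
        simpa using ih [] a (y ++ x) (by simp)
      · simp only [List.cons_append, List.cons.injEq] at h'
        obtain ⟨rfl, rfl⟩ := h'
        simpa using ih (x' ++ x) a bs (by simp)

theorem fold (hR : Symmetrized R) {a : S × Bool} {v : Word S} (h : Der R n (a :: linv a :: v)) :
    Der R n v := by
  rcases h.peel hR [] a (linv a :: v) rfl with ⟨u, v', i, j, hz, hu, hv, rfl⟩ | ⟨s, m, hr, rfl, h'⟩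
  · simp only [List.append_nil] at hz
    rcases u with _ | ⟨b, u⟩
    · simp only [List.nil_append, List.cons.injEq, true_and] at hz
      subst hz
      exact hv.mono (by omega)
    · simp only [List.cons_append, List.cons.injEq] at hz
      obtain ⟨rfl, rfl⟩ := hz
      have := (hu.rot (x := [linv a])).cat hv
      simpa using this
  · refine Der.pinch (hR.inv _ hr) ?_
    simpa using h'

theorem of_step (hR : Symmetrized R) {w w' : Word S} (h : Der R n w) (hs : FreeGroup.Red.Step w w') :
    Der R n w' := by
  cases hs with
  | @not L₁ L₂ x b =>
    have h1 : Der R n ((x, b) :: linv (x, b) :: (L₂ ++ L₁)) := by simpa [linv] using h.rot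
    exact (h1.fold hR).rot

theorem of_step' {w w' : Word S} (h : Der R n w') (hs : FreeGroup.Red.Step w w') :
    Der R n w := by
  cases hs with
  | @not L₁ L₂ x b =>
    have h1 : Der R 0 [(x, b), linv (x, b)] := by simpa using (Der.nil 0).edge (Der.nil 0)
    simpa [linv] using h1.insert_mid h L₁ L₂ rfl

theorem of_mk_eq (hR : Symmetrized R) {w w' : Word S} (h : Der R n w)
    (he : FreeGroup.mk w = FreeGroup.mk w') : Der R n w' := by
  obtain ⟨z, h1, h2⟩ := FreeGroup.Red.exact.1 he
  have hz : Der R n z := by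
    clear h2 he
    induction h1 with
    | refl => exact h
    | tail _ hs ih => exact ih.of_step hR hs
  clear h1 he h
  induction h2 using Relation.ReflTransGen.head_induction_on with
  | refl => exact hz
  | head hs _ ih => exact ih.of_step' hs

theorem of_area (hR : Symmetrized R) {g : FreeGroup S} (h : Area R n g) :
    ∀ w, FreeGroup.mk w = g → Der R n w := by
  induction h with
  | one k =>
    intro w hw
    exact (Der.nil k).of_mk_eq hR (by rw [hw]; rfl)
  | @mul k g u r hr _ ih =>
    intro w hw
    obtain ⟨U, rfl⟩ := Quot.exists_rep u
    obtain ⟨V, rfl⟩ := Quot.exists_rep g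
    have h1 : Der R 1 r := by
      have h0 : Der R 0 (wordInv r ++ r) := by simpa using (Der.nil 0).conj (wordInv r)
      exact Der.pinch (hR.inv r hr) h0
    have h2 := (h1.conj U).cat (ih V rfl)
    rw [add_comm] at h2
    refine h2.of_mk_eq hR ?_
    rw [hw]
    simp only [mk_append, mk_wordInv]
    rfl

end Der

end Diagrams
end GSC

namespace GSC

section DiagramConstruction

variable {S : Type}

/-- `IsPath org e p l q`: the list of darts `l` is an edge path from `p` to `q`. -/
def IsPath {V D : Type} (org : D → V) (e : D → D) : V → List D → V → Prop
  | p, [], q => p = q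
  | p, d :: l, q => org d = p ∧ IsPath org e (org (e d)) l q

section IsPath

variable {V D V' D' : Type} {org : D → V} {e : D → D} {org' : D' → V'} {e' : D' → D'}

@[simp] theorem isPath_nil {p q : V} : IsPath org e p [] q ↔ p = q := Iff.rfl

@[simp] theorem isPath_cons {p q : V} {d : D} {l : List D} :
    IsPath org e p (d :: l) q ↔ org d = p ∧ IsPath org e (org (e d)) l q := Iff.rfl

theorem isPath_append {p q : V} {l₁ l₂ : List D} :
    IsPath org e p (l₁ ++ l₂) q ↔ ∃ m, IsPath org e p l₁ m ∧ IsPath org e m l₂ q := by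
  induction l₁ generalizing p with
  | nil => simp
  | cons d l ih => simp [ih, and_assoc]

theorem isPath_map (f : D → D') (g : V → V') (ho : ∀ d, org' (f d) = g (org d))
    (he : ∀ d, e' (f d) = f (e d)) (hg : g.Injective) {p : V} {q : V'} {l : List D} :
    IsPath org' e' (g p) (l.map f) q ↔ ∃ q', g q' = q ∧ IsPath org e p l q' := by
  induction l generalizing p with
  | nil => simp [eq_comm]
  | cons d l ih =>
    simp only [List.map_cons, isPath_cons, ho, he, ih, hg.eq_iff]
    tauto

end IsPath

/-- The element of the free group read along a list of darts. -/
def val {D : Type} (lab : D → S × Bool) (l : List D) : FreeGroup S := FreeGroup.mk (l.map lab)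

/-- The element of the free group given by a letter. -/
def letter (a : S × Bool) : FreeGroup S := FreeGroup.mk [a]

@[simp] theorem letter_linv (a : S × Bool) : letter (linv a) = (letter a)⁻¹ := mk_linv a

section Val

variable {D E : Type} (lab : D → S × Bool)

@[simp] theorem val_nil : val lab [] = 1 := rfl

@[simp] theorem val_cons (d : D) (l : List D) : val lab (d :: l) = letter (lab d) * val lab l :=
  mk_cons _ _

@[simp] theorem val_append (k l : List D) : val lab (k ++ l) = val lab k * val lab l := by
  rw [val, List.map_append, mk_append]; rfl

@[simp] theorem val_inl (o : E → S × Bool) (l : List D) :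
    val (Sum.elim lab o) (l.map Sum.inl) = val lab l := by
  simp [val]

end Val

/-- A planar diagram over `R` with boundary word `w`, given by its darts. The last three fields
record the areas of the words obtained by cutting the diagram at a boundary vertex visited twice
and by removing an edge. -/
structure Dia (R : Set (Word S)) (w : Word S) where
  V : Type
  D : Type
  [fintypeV : Fintype V]
  [fintypeD : Fintype D]
  e : D → D
  lab : D → S × Bool
  org : D → V
  base : V
  outer : List D
  faces : List (List D)
  e_e : ∀ d, e (e d) = d
  lab_e : ∀ d, lab (e d) = linv (lab d)
  isPath_outer : IsPath org e base outer base
  lab_outer : outer.map lab = w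
  face_mem : ∀ f ∈ faces, f.map lab ∈ R
  face_path : ∀ f ∈ faces, ∃ v, IsPath org e v f v
  nodup : (outer ++ faces.flatten).Nodup
  complete : ∀ d, d ∈ outer ++ faces.flatten
  surj : ∀ v, v = base ∨ ∃ d, org d = v
  euler : 2 * Fintype.card V + 2 * faces.length = Fintype.card D + 2
  area : Area R faces.length (val lab outer)
  split : ∀ O₁ O₂ O₃ v, outer = O₁ ++ (O₂ ++ O₃) → IsPath org e base O₁ v → IsPath org e v O₂ v →
    ∃ i j, i + j = faces.length ∧ Area R i (val lab O₂) ∧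
      Area R j (val lab O₁ * val lab O₃)
  merge_out : ∀ O₁ o O₂ f₁ f₂, outer = O₁ ++ o :: O₂ → f₁ ++ e o :: f₂ ∈ faces →
    Area R (faces.length - 1) (val lab f₂ * val lab f₁ * val lab O₂ * val lab O₁)
  merge_in : ∀ d f₁ f₂ g₁ g₂, f₁ ++ d :: f₂ ∈ faces → g₁ ++ e d :: g₂ ∈ faces →
    f₁ ++ d :: f₂ ≠ g₁ ++ e d :: g₂ →
    ∃ u, Area R (faces.length - 2) (u * (val lab f₂ * val lab f₁ * val lab g₂ * val lab g₁) * u⁻¹ *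
      val lab outer)

theorem Area.insert {R : Set (Word S)} {m n k : ℕ} {x y c : FreeGroup S} (h : Area R m (x * y))
    (hc : Area R n c) (hk : m + n ≤ k) : Area R k (x * c * y) := by
  have := ((hc.conj x).mul' h).mono (m := k) (by omega)
  convert this using 1
  group

theorem Area.replace {R : Set (Word S)} {m k : ℕ} {x y c d g : FreeGroup S}
    (hc : Area R 1 (c * d⁻¹)) (h : Area R m (x * d * y)) (hk : m + 1 ≤ k)
    (hg : g = x * c * y) : Area R k g := by
  rw [mul_assoc] at h
  have := h.insert hc hk
  rw [hg]
  convert this using 1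
  group

theorem Area.conj_eq {R : Set (Word S)} {m k : ℕ} {g h : FreeGroup S} (u : FreeGroup S)
    (hg : Area R m g) (hk : m ≤ k) (hh : h = u * g * u⁻¹) : Area R k h :=
  hh ▸ (hg.conj u).mono hk

/-- The one-vertex diagram. -/
def Dia.nil (R : Set (Word S)) : Dia R [] where
  V := Unit
  D := Empty
  e := id
  lab := Empty.elim
  org := Empty.elim
  base := ()
  outer := []
  faces := []
  e_e := fun d => d.elim
  lab_e := fun d => d.elim
  isPath_outer := rfl
  lab_outer := rfl
  face_mem := by simp
  face_path := by simp
  nodup := by simp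
  complete := fun d => d.elim
  surj := by simp
  euler := by simp
  area := Area.one 0
  split := by
    intro O₁ O₂ O₃ v h _ _
    simp only [List.nil_eq, List.append_eq_nil_iff] at h
    obtain ⟨rfl, rfl, rfl⟩ := h
    exact ⟨0, 0, rfl, Area.one 0, Area.one 0⟩
  merge_out := by simp
  merge_in := by simp

namespace Dia

variable {R : Set (Word S)}

section Face

theorem isPath_inl {V D : Type} {org : D → V} {e : D → D} {o : Bool → V} {p q : V} {l : List D} :
    IsPath (Sum.elim org o) (Sum.map e not) p (l.map Sum.inl) q ↔ IsPath org e p l q := by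
  have := isPath_map (org := org) (e := e) (org' := Sum.elim org o) (e' := Sum.map e not) (p := p)
    (q := q) (l := l) Sum.inl id (fun _ => rfl) (fun _ => rfl) Function.injective_id
  simpa using this

theorem _root_.List.one_lt_length_of_mem_ne {A : Type*} {l : List A} {a b : A} (ha : a ∈ l)
    (hb : b ∈ l) (h : a ≠ b) : 1 < l.length := by
  rcases l with _ | ⟨c, _ | ⟨d, l⟩⟩ <;> simp_all

theorem cases_map_inl {A B : Type} {l : List A} {f₁ f₂ : List (A ⊕ B)} {d : A ⊕ B}
    (h : l.map Sum.inl = f₁ ++ d :: f₂) :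
    ∃ g₁ c g₂, l = g₁ ++ c :: g₂ ∧ f₁ = g₁.map .inl ∧ d = .inl c ∧ f₂ = g₂.map .inl := by
  obtain ⟨g₁, g', rfl, rfl, h'⟩ := List.map_eq_append_iff.1 h
  obtain ⟨c, g₂, rfl, rfl, rfl⟩ := List.map_eq_cons_iff.1 h'
  exact ⟨_, _, _, rfl, rfl, rfl, rfl⟩

theorem cases_map_inl_concat {A B : Type} {l : List A} {f₁ f₂ : List (A ⊕ B)} {d : A ⊕ B} {b : B}
    (h : f₁ ++ d :: f₂ = l.map Sum.inl ++ [.inr b]) :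
    (f₁ = l.map Sum.inl ∧ d = .inr b ∧ f₂ = []) ∨
    ∃ g₁ c g₂, l = g₁ ++ c :: g₂ ∧ f₁ = g₁.map .inl ∧ d = .inl c ∧
      f₂ = g₂.map .inl ++ [.inr b] := by
  rcases List.append_eq_append_iff.1 h with ⟨as, h₁, h'⟩ | ⟨bs, rfl, h'⟩
  · rcases as with _ | ⟨c, as⟩
    · simp only [List.append_nil, List.nil_append, List.cons.injEq] at h₁ h'
      exact .inl ⟨h₁.symm, h'.1, h'.2⟩
    · simp only [List.cons_append, List.cons.injEq] at h'
      obtain ⟨rfl, rfl⟩ := h'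
      obtain ⟨g₁, c, g₂, h1, h2, h3, h4⟩ := cases_map_inl h₁
      exact .inr ⟨g₁, c, g₂, h1, h2, h3, by rw [h4]⟩
  · rcases bs with _ | ⟨c, bs⟩
    · simp at h'
      simp [h']
    · simp at h'

variable {w : Word S} {a : S × Bool} (Δ : Dia R w)

/-- Gluing a face along an initial segment `X` of the outer boundary. -/
def face (hR : Symmetrized R) (X Y : List Δ.D) (p : Δ.V)
    (hr : a :: wordInv (X.map Δ.lab) ∈ R) (hXY : Δ.outer = X ++ Y)
    (hpX : IsPath Δ.org Δ.e Δ.base X p) (hpY : IsPath Δ.org Δ.e p Y Δ.base) :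
    Dia R (a :: Y.map Δ.lab) :=
  have hA : Area R 1 (letter a * (val Δ.lab X)⁻¹) := by
    have := Area.of_rel hr
    rwa [mk_cons, mk_wordInv] at this
  have hΔ : Area R Δ.faces.length (1 * val Δ.lab X * val Δ.lab Y) := by
    simpa [hXY] using Δ.area
  letI := Δ.fintypeV
  letI := Δ.fintypeD
  { V := Δ.V
    D := Δ.D ⊕ Bool
    e := Sum.map Δ.e not
    lab := Sum.elim Δ.lab (fun b => if b then a else linv a)
    org := Sum.elim Δ.org (fun b => if b then Δ.base else p)
    base := Δ.base
    outer := .inr true :: Y.map .inl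
    faces := (X.map .inl ++ [.inr false]) :: Δ.faces.map (List.map .inl)
    e_e := by rintro (d | b) <;> simp [Δ.e_e]
    lab_e := by
      rintro (d | b)
      · simp [Δ.lab_e]
      · cases b <;> simp
    isPath_outer := by
      simp [isPath_inl, hpY]
    lab_outer := by simp
    face_mem := by
      simp only [List.mem_cons, List.mem_map, forall_eq_or_imp, forall_exists_index, and_imp,
        forall_apply_eq_imp_iff₂]
      refine ⟨?_, fun f hf => ?_⟩
      · have := hR.inv _ hr
        simpa using this
      · simpa using Δ.face_mem f hf
    face_path := by
      simp only [List.mem_cons, List.mem_map, forall_eq_or_imp, forall_exists_index, and_imp,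
        forall_apply_eq_imp_iff₂]
      refine ⟨⟨Δ.base, isPath_append.2 ⟨p, isPath_inl.2 hpX, ?_⟩⟩, fun f hf => ?_⟩
      · simp
      · obtain ⟨q, hq⟩ := Δ.face_path f hf
        exact ⟨q, isPath_inl.2 hq⟩
    nodup := by
      have := Δ.nodup
      rw [hXY] at this
      have h2 : (Sum.inr true :: Sum.inr false ::
          ((X ++ Y) ++ Δ.faces.flatten).map (Sum.inl (β := Bool))).Nodup := by
        simp only [List.nodup_cons, List.nodup_map_iff Sum.inl_injective, this]
        simp
      refine (List.Perm.nodup_iff ?_).2 h2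
      simp only [List.flatten_cons, List.map_append, List.cons_append, List.perm_cons,
        ← List.map_flatten]
      simp only [List.append_assoc, List.singleton_append]
      refine List.Perm.trans ?_ List.perm_middle
      refine (List.perm_append_comm_assoc _ _ _).trans ?_
      refine List.Perm.append_left _ List.perm_middle |>.trans ?_
      refine List.perm_middle.trans List.perm_middle.symm |>.trans ?_
      simp
    complete := by
      rintro (d | b)
      · have := Δ.complete d
        rw [hXY] at this
        simp at this ⊢
        tauto
      · cases b <;> simp
    surj := by
      intro v
      rcases Δ.surj v with h | ⟨d, h⟩
      · exact .inl h
      · exact .inr ⟨.inl d, h⟩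
    euler := by
      have := Δ.euler
      simp
      omega
    area := hA.replace hΔ (by simp) (by simp)
    split := by
      intro O₁ O₂ O₃ q h h₁ h₂
      rcases O₁ with _ | ⟨c, O₁⟩
      · obtain rfl : Δ.base = q := h₁
        rcases O₂ with _ | ⟨c, O₂⟩
        · simp only [List.nil_append] at h
          subst h
          exact ⟨0, _, Nat.zero_add _, Area.one 0, hA.replace hΔ (by simp) (by simp)⟩
        · simp only [List.nil_append, List.cons_append, List.cons.injEq] at h
          obtain ⟨rfl, h⟩ := h
          obtain ⟨Y₂, Y₃, rfl, rfl, rfl⟩ := List.map_eq_append_iff.1 h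
          obtain ⟨i, j, hij, hi, hj⟩ := Δ.split [] (X ++ Y₂) Y₃ Δ.base (by simp [hXY]) rfl
            (isPath_append.2 ⟨p, hpX, isPath_inl.1 h₂.2⟩)
          refine ⟨i + 1, j, ?_, ?_, ?_⟩
          · simp [← hij]; omega
          · rw [val_append, ← one_mul (val Δ.lab X)] at hi
            exact hA.replace hi (by simp) (by simp)
          · simpa using hj
      · simp only [List.cons_append, List.cons.injEq] at h
        obtain ⟨rfl, h⟩ := h
        obtain ⟨Y₁, Y', rfl, rfl, h'⟩ := List.map_eq_append_iff.1 h
        obtain ⟨Y₂, Y₃, rfl, rfl, rfl⟩ := List.map_eq_append_iff.1 h'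
        obtain ⟨i, j, hij, hi, hj⟩ := Δ.split (X ++ Y₁) Y₂ Y₃ q (by simp [hXY])
            (isPath_append.2 ⟨p, hpX, isPath_inl.1 h₁.2⟩) (isPath_inl.1 h₂)
        refine ⟨i, j + 1, ?_, ?_, ?_⟩
        · simp [← hij]; omega
        · simpa using hi
        · rw [val_append, ← one_mul (val Δ.lab X), mul_assoc] at hj
          rw [mul_assoc, ← mul_assoc] at hj
          exact hA.replace hj (by simp) (by simp [mul_assoc])
    merge_out := by
      intro O₁ o O₂ f₁ f₂ h hf
      rw [List.mem_cons, List.mem_map] at hf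
      simp only [List.length_cons, List.length_map, Nat.add_sub_cancel]
      rcases O₁ with _ | ⟨c, O₁⟩
      · simp only [List.nil_append, List.cons.injEq] at h
        obtain ⟨rfl, rfl⟩ := h
        rcases hf with hf | ⟨f, hf, hf'⟩
        · rcases cases_map_inl_concat hf with ⟨rfl, -, rfl⟩ | ⟨g₁, c, g₂, -, -, h, -⟩
          · simpa using hΔ
          · simp at h
        · obtain ⟨g₁, c, g₂, -, -, h, -⟩ := cases_map_inl hf'
          simp at h
      · simp only [List.cons_append, List.cons.injEq] at h
        obtain ⟨rfl, h⟩ := h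
        obtain ⟨Y₁, o, Y₂, rfl, rfl, rfl, rfl⟩ := cases_map_inl h
        rcases hf with hf | ⟨f, hf, hf'⟩
        · rcases cases_map_inl_concat hf with ⟨rfl, h, rfl⟩ | ⟨X₁, c, X₂, rfl, rfl, hc, rfl⟩
          · simp at h
          · obtain rfl : Δ.e o = c := Sum.inl_injective hc
            obtain ⟨q, h1, h2⟩ := isPath_append.1 hpX
            obtain ⟨q', h3, h4⟩ := isPath_append.1 hpY
            obtain ⟨i, j, hij, hi, hj⟩ := Δ.split (X₁ ++ [Δ.e o]) (X₂ ++ Y₁) (o :: Y₂) (Δ.org o)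
              (by simp [hXY]) (isPath_append.2 ⟨q, h1, h2.1, by simp [Δ.e_e]⟩)
              (isPath_append.2 ⟨p, by simpa [Δ.e_e] using h2.2, by rw [h4.1]; exact h3⟩)
            have := ((hj.conj (val Δ.lab X₂ * (letter a)⁻¹)).mul' hi).mono
              (m := Δ.faces.length) (by omega)
            convert this using 1
            simp [Δ.lab_e]
            group
        · obtain ⟨g₁, c, g₂, rfl, rfl, hc, rfl⟩ := cases_map_inl hf'
          obtain rfl : Δ.e o = c := Sum.inl_injective hc
          have h1 := Δ.merge_out (X ++ Y₁) o Y₂ g₁ g₂ (by simp [hXY]) hf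
          have h2 : 0 < Δ.faces.length := List.length_pos_of_mem hf
          rw [val_append, ← mul_assoc] at h1
          exact hA.replace h1 (by omega) (by simp [mul_assoc])
    merge_in := by
      intro d f₁ f₂ g₁ g₂ hf hg hne
      rw [List.mem_cons, List.mem_map] at hf hg
      simp only [List.length_cons, List.length_map]
      rcases hf with hf | ⟨f, hf, hf'⟩
      · rcases hg with hg | ⟨g, hg, hg'⟩
        · exact absurd (hf.trans hg.symm) hne
        · obtain ⟨g₁, c, g₂, rfl, rfl, hc, rfl⟩ := cases_map_inl hg'
          rcases cases_map_inl_concat hf with ⟨rfl, rfl, rfl⟩ | ⟨X₁, d, X₂, rfl, rfl, rfl, rfl⟩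
          · simp at hc
          · obtain rfl : Δ.e d = c := Sum.inl_injective hc
            have h1 := Δ.merge_out X₁ d (X₂ ++ Y) g₁ g₂ (by simp [hXY]) hg
            refine ⟨letter a * (val Δ.lab X₂)⁻¹, h1.conj_eq (val Δ.lab X₁) (by omega) ?_⟩
            simp
            group
      · obtain ⟨f₁, d, f₂, rfl, rfl, rfl, rfl⟩ := cases_map_inl hf'
        rcases hg with hg | ⟨g, hg, hg'⟩
        · rcases cases_map_inl_concat hg with ⟨rfl, h, rfl⟩ | ⟨X₁, c, X₂, rfl, rfl, hc, rfl⟩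
          · simp at h
          · obtain rfl : Δ.e d = c := Sum.inl_injective hc
            have h1 := Δ.merge_out X₁ (Δ.e d) (X₂ ++ Y) f₁ f₂ (by simp [hXY])
              (by simpa [Δ.e_e] using hf)
            refine ⟨val Δ.lab X₁, h1.conj_eq (val Δ.lab X₁) (by omega) ?_⟩
            simp
            group
        · obtain ⟨g₁, c, g₂, rfl, rfl, hc, rfl⟩ := cases_map_inl hg'
          obtain rfl : Δ.e d = c := Sum.inl_injective hc
          obtain ⟨u, hu⟩ := Δ.merge_in d f₁ f₂ g₁ g₂ hf hg (by
            intro h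
            exact hne (by simpa using congrArg (List.map Sum.inl) h))
          have h2 : 1 < Δ.faces.length := List.one_lt_length_of_mem_ne hf hg (by
            intro h
            exact hne (by simpa using congrArg (List.map Sum.inl) h))
          refine ⟨u, ?_⟩
          rw [hXY, val_append, ← mul_assoc] at hu
          exact hA.replace hu (by omega) (by simp [mul_assoc]) }
  
end Face

end Dia

end DiagramConstruction
end GSC

namespace GSC

section DiagramEdge

variable {S : Type} {R : Set (Word S)}

theorem cases_map {A B : Type} {l : List A} {f : A → B} {f₁ f₂ : List B} {d : B}
    (h : l.map f = f₁ ++ d :: f₂) :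
    ∃ g₁ c g₂, l = g₁ ++ c :: g₂ ∧ f₁ = g₁.map f ∧ d = f c ∧ f₂ = g₂.map f := by
  obtain ⟨g₁, g', rfl, rfl, h'⟩ := List.map_eq_append_iff.1 h
  obtain ⟨c, g₂, rfl, rfl, rfl⟩ := List.map_eq_cons_iff.1 h'
  exact ⟨_, _, _, rfl, rfl, rfl, rfl⟩

namespace Dia

variable {u v : Word S} (Δ : Dia R u) (Ε : Dia R v)

/-- The dart of the second diagram inside the joined diagram. -/
def emb₂ {D E : Type} (d : E) : D ⊕ (E ⊕ Bool) := .inr (.inl d)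

theorem emb₂_injective {D E : Type} : (emb₂ : E → D ⊕ (E ⊕ Bool)).Injective := by
  intro a b h
  simpa [emb₂] using h

@[simp] theorem val_map_emb₂ {D E : Type} (lab : E → S × Bool) (o : D → S × Bool)
    (o' : Bool → S × Bool) (l : List E) :
    val (Sum.elim o (Sum.elim lab o')) (l.map emb₂) = val lab l := by
  rw [val, List.map_map]
  rfl

/-- Joining two diagrams by an edge. -/
def edge (a : S × Bool) : Dia R (a :: (u ++ linv a :: v)) :=
  letI := Δ.fintypeV
  letI := Δ.fintypeD
  letI := Ε.fintypeV
  letI := Ε.fintypeD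
  have hp₁ : ∀ {p q l}, IsPath (Sum.elim (fun d => Sum.inl (Δ.org d)) (Sum.elim
      (fun d => Sum.inr (Ε.org d)) (fun b => if b then Sum.inr Ε.base else Sum.inl Δ.base)))
      (Sum.map Δ.e (Sum.map Ε.e not)) (Sum.inl p) (l.map Sum.inl) q ↔
      ∃ q', Sum.inl q' = q ∧ IsPath Δ.org Δ.e p l q' := by
    intro p q l
    apply isPath_map (org := Δ.org) (e := Δ.e) (hg := Sum.inl_injective) <;> intro d <;> rfl
  have hp₂ : ∀ {p q l}, IsPath (Sum.elim (fun d => Sum.inl (Δ.org d)) (Sum.elim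
      (fun d => Sum.inr (Ε.org d)) (fun b => if b then Sum.inr Ε.base else Sum.inl Δ.base)))
      (Sum.map Δ.e (Sum.map Ε.e not)) (Sum.inr p) (l.map emb₂) q ↔
      ∃ q', Sum.inr q' = q ∧ IsPath Ε.org Ε.e p l q' := by
    intro p q l
    apply isPath_map (org := Ε.org) (e := Ε.e) (hg := Sum.inr_injective) <;> intro d <;> rfl
  have hΔΕ : Area R (Δ.faces.length + Ε.faces.length)
      (letter a * val Δ.lab Δ.outer * (letter a)⁻¹ * val Ε.lab Ε.outer) :=
    (Δ.area.conj (letter a)).mul' Ε.area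
  { V := Δ.V ⊕ Ε.V
    D := Δ.D ⊕ (Ε.D ⊕ Bool)
    e := Sum.map Δ.e (Sum.map Ε.e not)
    lab := Sum.elim Δ.lab (Sum.elim Ε.lab (fun b => if b then a else linv a))
    org := Sum.elim (fun d => .inl (Δ.org d)) (Sum.elim (fun d => .inr (Ε.org d))
      (fun b => if b then .inr Ε.base else .inl Δ.base))
    base := .inr Ε.base
    outer := .inr (.inr true) :: (Δ.outer.map .inl ++ .inr (.inr false) :: Ε.outer.map emb₂)
    faces := Δ.faces.map (List.map .inl) ++ Ε.faces.map (List.map emb₂)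
    e_e := by rintro (d | d | b) <;> simp [Δ.e_e, Ε.e_e]
    lab_e := by
      rintro (d | d | b)
      · simp [Δ.lab_e]
      · simp [Ε.lab_e]
      · cases b <;> simp
    isPath_outer := by
      refine ⟨rfl, isPath_append.2 ⟨_, hp₁.2 ⟨_, rfl, Δ.isPath_outer⟩, rfl,
        hp₂.2 ⟨_, rfl, Ε.isPath_outer⟩⟩⟩
    lab_outer := by
      have h1 := Δ.lab_outer
      have h2 := Ε.lab_outer
      simp [← h1, ← h2, emb₂]
    face_mem := by
      intro f hf
      rcases List.mem_append.1 hf with hf | hf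
      · obtain ⟨f, hf', rfl⟩ := List.mem_map.1 hf
        simpa using Δ.face_mem f hf'
      · obtain ⟨f, hf', rfl⟩ := List.mem_map.1 hf
        rw [List.map_map]
        exact Ε.face_mem f hf'
    face_path := by
      intro f hf
      rcases List.mem_append.1 hf with hf | hf
      · obtain ⟨f, hf', rfl⟩ := List.mem_map.1 hf
        obtain ⟨q, hq⟩ := Δ.face_path f hf'
        exact ⟨_, hp₁.2 ⟨q, rfl, hq⟩⟩
      · obtain ⟨f, hf', rfl⟩ := List.mem_map.1 hf
        obtain ⟨q, hq⟩ := Ε.face_path f hf'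
        exact ⟨_, hp₂.2 ⟨q, rfl, hq⟩⟩
    nodup := by
      have h2 : (Sum.inr (.inr true) :: Sum.inr (.inr false) ::
          ((Δ.outer ++ Δ.faces.flatten).map .inl ++ (Ε.outer ++ Ε.faces.flatten).map emb₂)).Nodup := by
        simp only [List.nodup_cons, List.nodup_append (l₁ := List.map _ _),
          List.nodup_map_iff Sum.inl_injective, List.nodup_map_iff emb₂_injective, Δ.nodup, Ε.nodup]
        simp [emb₂]
      refine (List.Perm.nodup_iff ?_).2 h2
      simp only [List.flatten_append, List.map_append, List.cons_append, List.perm_cons,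
        ← List.map_flatten]
      simp only [List.append_assoc]
      refine List.perm_middle.trans (List.Perm.cons _ ?_)
      refine List.Perm.append_left _ ?_
      exact (List.perm_append_comm_assoc _ _ _)
    complete := by
      rintro (d | d | b)
      · have := Δ.complete d
        simp [emb₂] at this ⊢
        tauto
      · have := Ε.complete d
        simp [emb₂] at this ⊢
        tauto
      · cases b <;> simp
    surj := by
      rintro (x | x)
      · rcases Δ.surj x with rfl | ⟨d, rfl⟩
        · exact .inr ⟨.inr (.inr false), rfl⟩
        · exact .inr ⟨.inl d, rfl⟩
      · rcases Ε.surj x with rfl | ⟨d, rfl⟩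
        · exact .inl rfl
        · exact .inr ⟨.inr (.inl d), rfl⟩
    euler := by
      have h1 := Δ.euler
      have h2 := Ε.euler
      simp
      omega
    area := by simpa [mul_assoc] using hΔΕ
    split := by
      intro O₁ O₂ O₃ q h h₁ h₂
      rcases eq_or_ne O₂ [] with rfl | hO₂
      · refine ⟨0, _, Nat.zero_add _, Area.one 0, ?_⟩
        rw [List.nil_append] at h
        rw [← val_append, ← h]
        simpa [mul_assoc] using hΔΕ
      rcases O₁ with _ | ⟨c, O₁⟩
      · obtain rfl := h₁
        rcases O₂ with _ | ⟨c, O₂⟩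
        · exact absurd rfl hO₂
        · simp only [List.nil_append, List.cons_append, List.cons.injEq] at h
          obtain ⟨rfl, h⟩ := h
          rcases List.append_eq_append_iff.1 h with ⟨as, rfl, h'⟩ | ⟨bs, h', rfl⟩
          · obtain ⟨m, h3, h4⟩ := isPath_append.1 h₂.2
            obtain ⟨q', rfl, h3⟩ := hp₁.1 h3
            rcases as with _ | ⟨c, as⟩
            · simp at h4
            · simp only [List.cons_append, List.cons.injEq] at h'
              obtain ⟨rfl, h'⟩ := h'
              obtain ⟨Y₂, Y₃, hY, rfl, rfl⟩ := List.map_eq_append_iff.1 h'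
              obtain ⟨q'', h5, h6⟩ := hp₂.1 h4.2
              obtain rfl := Sum.inr_injective h5
              obtain ⟨i, j, hij, hi, hj⟩ := Ε.split [] Y₂ Y₃ _ hY rfl h6
              refine ⟨Δ.faces.length + i, j, ?_, ?_, ?_⟩
              · simp [← hij, add_assoc]
              · simpa [mul_assoc] using (Δ.area.conj (letter a)).mul' hi
              · simpa using hj
          · obtain ⟨Y₂, Y₃, hY, rfl, rfl⟩ := List.map_eq_append_iff.1 h'
            obtain ⟨q', h3, -⟩ := hp₁.1 h₂.2
            simp at h3
      · simp only [List.cons_append, List.cons.injEq] at h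
        obtain ⟨rfl, h⟩ := h
        rcases List.append_eq_append_iff.1 h with ⟨as, rfl, h'⟩ | ⟨bs, h', h''⟩
        · obtain ⟨m, h3, h4⟩ := isPath_append.1 h₁.2
          obtain ⟨q', rfl, h3⟩ := hp₁.1 h3
          rcases as with _ | ⟨c, as⟩
          · obtain rfl := h4
            rcases O₂ with _ | ⟨c, O₂⟩
            · exact absurd rfl hO₂
            · simp only [List.nil_append, List.cons_append, List.cons.injEq] at h'
              obtain ⟨rfl, h'⟩ := h'
              obtain ⟨Y₂, Y₃, hY, rfl, rfl⟩ := List.map_eq_append_iff.1 h'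
              obtain ⟨q'', h5, h6⟩ := hp₂.1 h₂.2
              simp at h5
          · simp only [List.cons_append, List.cons.injEq] at h'
            obtain ⟨rfl, h'⟩ := h'
            obtain ⟨Y₁, Y', hY, rfl, h''⟩ := List.map_eq_append_iff.1 h'
            obtain ⟨Y₂, Y₃, rfl, rfl, rfl⟩ := List.map_eq_append_iff.1 h''
            obtain ⟨q₁, rfl, h6⟩ := hp₂.1 h4.2
            obtain ⟨q₂, h7, h8⟩ := hp₂.1 h₂
            obtain rfl := Sum.inr_injective h7
            obtain ⟨i, j, hij, hi, hj⟩ := Ε.split _ _ _ _ hY h6 h8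
            refine ⟨i, Δ.faces.length + j, ?_, ?_, ?_⟩
            · simp [← hij]
              omega
            · simpa using hi
            · simpa [mul_assoc] using (Δ.area.conj (letter a)).mul' hj
        · obtain ⟨Y₁, Y', hY, rfl, rfl⟩ := List.map_eq_append_iff.1 h'
          obtain ⟨q₁, rfl, h6⟩ := hp₁.1 h₁.2
          have key : ∀ Y₂ Y₃, Y' = Y₂ ++ Y₃ → O₂ = Y₂.map .inl →
              O₃ = Y₃.map .inl ++ .inr (.inr false) :: Ε.outer.map emb₂ → ∃ i j,
              i + j = (Δ.faces.map (List.map Sum.inl) ++ Ε.faces.map (List.map emb₂)).length ∧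
              Area R i (val (Sum.elim Δ.lab (Sum.elim Ε.lab (fun b => if b then a else linv a))) O₂) ∧
              Area R j (val (Sum.elim Δ.lab (Sum.elim Ε.lab (fun b => if b then a else linv a)))
                (.inr (.inr true) :: Y₁.map .inl) *
                val (Sum.elim Δ.lab (Sum.elim Ε.lab (fun b => if b then a else linv a))) O₃) := by
            rintro Y₂ Y₃ rfl rfl rfl
            obtain ⟨q₂, h7, h8⟩ := hp₁.1 h₂
            obtain rfl := Sum.inl_injective h7
            obtain ⟨i, j, hij, hi, hj⟩ := Δ.split _ _ _ _ hY h6 h8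
            refine ⟨i, j + Ε.faces.length, ?_, ?_, ?_⟩
            · simp [← hij]
              omega
            · simpa using hi
            · simpa [mul_assoc] using (hj.conj (letter a)).mul' Ε.area
          rcases List.append_eq_append_iff.1 h'' with ⟨cs, h3, rfl⟩ | ⟨cs, rfl, h3⟩
          · obtain ⟨Y₂, Y₃, rfl, rfl, rfl⟩ := List.map_eq_append_iff.1 h3
            exact key Y₂ Y₃ rfl rfl rfl
          · rcases cs with _ | ⟨c, cs⟩
            · simp only [List.nil_append] at h3
              exact key Y' [] (by simp) (by simp) (by simp [h3])
            · simp only [List.cons_append, List.cons.injEq] at h3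
              obtain ⟨rfl, h3⟩ := h3
              obtain ⟨Y₂, Y₃, hY', rfl, rfl⟩ := List.map_eq_append_iff.1 h3
              obtain ⟨m, h4, h5⟩ := isPath_append.1 h₂
              obtain ⟨q₂, h7, h8⟩ := hp₂.1 h5.2
              simp at h7
    merge_out := by
      intro O₁ o O₂ f₁ f₂ h hf
      rw [List.mem_append, List.mem_map, List.mem_map] at hf
      simp only [List.length_append, List.length_map]
      rcases O₁ with _ | ⟨c, O₁⟩
      · simp only [List.nil_append, List.cons.injEq] at h
        obtain ⟨rfl, rfl⟩ := h
        rcases hf with ⟨f, hf, hf'⟩ | ⟨f, hf, hf'⟩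
        · obtain ⟨g₁, c, g₂, -, -, h, -⟩ := cases_map hf'
          simp at h
        · obtain ⟨g₁, c, g₂, -, -, h, -⟩ := cases_map hf'
          simp [emb₂] at h
      · simp only [List.cons_append, List.cons.injEq] at h
        obtain ⟨rfl, h⟩ := h
        rcases List.append_eq_append_iff.1 h with ⟨as, rfl, h'⟩ | ⟨bs, h', h''⟩
        · rcases as with _ | ⟨c, as⟩
          · simp only [List.nil_append, List.cons.injEq] at h'
            obtain ⟨rfl, rfl⟩ := h'
            rcases hf with ⟨f, hf, hf'⟩ | ⟨f, hf, hf'⟩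
            · obtain ⟨g₁, c, g₂, -, -, h, -⟩ := cases_map hf'
              simp at h
            · obtain ⟨g₁, c, g₂, -, -, h, -⟩ := cases_map hf'
              simp [emb₂] at h
          · simp only [List.cons_append, List.cons.injEq] at h'
            obtain ⟨rfl, h'⟩ := h'
            obtain ⟨Y₁, d, Y₂, hY, rfl, rfl, rfl⟩ := cases_map h'
            rcases hf with ⟨f, hf, hf'⟩ | ⟨f, hf, hf'⟩
            · obtain ⟨g₁, c, g₂, -, -, h, -⟩ := cases_map hf'
              simp [emb₂] at h
            · obtain ⟨g₁, c, g₂, rfl, rfl, hc, rfl⟩ := cases_map hf'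
              obtain rfl : Ε.e d = c := emb₂_injective hc
              have h1 := Ε.merge_out Y₁ d Y₂ g₁ g₂ hY hf
              have h2 : 0 < Ε.faces.length := List.length_pos_of_mem hf
              refine h1.insert (Δ.area.conj (letter a)) (by omega) |>.conj_eq 1 le_rfl ?_
              simp [mul_assoc]
        · obtain ⟨Y₁, Y', hY, rfl, rfl⟩ := List.map_eq_append_iff.1 h'
          rcases Y' with _ | ⟨d, Y₂⟩
          · simp only [List.map_nil, List.nil_append, List.cons.injEq] at h''
            obtain ⟨rfl, rfl⟩ := h''
            rcases hf with ⟨f, hf, hf'⟩ | ⟨f, hf, hf'⟩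
            · obtain ⟨g₁, c, g₂, -, -, h, -⟩ := cases_map hf'
              simp at h
            · obtain ⟨g₁, c, g₂, -, -, h, -⟩ := cases_map hf'
              simp [emb₂] at h
          · simp only [List.map_cons, List.cons_append, List.cons.injEq] at h''
            obtain ⟨rfl, rfl⟩ := h''
            rcases hf with ⟨f, hf, hf'⟩ | ⟨f, hf, hf'⟩
            · obtain ⟨g₁, c, g₂, rfl, rfl, hc, rfl⟩ := cases_map hf'
              obtain rfl : Δ.e d = c := Sum.inl_injective hc
              have h1 := Δ.merge_out Y₁ d Y₂ g₁ g₂ hY hf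
              have h2 : 0 < Δ.faces.length := List.length_pos_of_mem hf
              have h3 := h1.insert (Ε.area.conj (letter (linv a)))
                (k := Δ.faces.length + Ε.faces.length - 1) (by omega)
              refine h3.conj_eq 1 le_rfl ?_
              simp [mul_assoc]
            · obtain ⟨g₁, c, g₂, -, -, h, -⟩ := cases_map hf'
              simp [emb₂] at h
    merge_in := by
      intro d f₁ f₂ g₁ g₂ hf hg hne
      rw [List.mem_append, List.mem_map, List.mem_map] at hf hg
      simp only [List.length_append, List.length_map]
      rcases hf with ⟨f, hf, hf'⟩ | ⟨f, hf, hf'⟩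
      · obtain ⟨f₁, d, f₂, rfl, rfl, rfl, rfl⟩ := cases_map hf'
        rcases hg with ⟨g, hg, hg'⟩ | ⟨g, hg, hg'⟩
        · obtain ⟨g₁, c, g₂, rfl, rfl, hc, rfl⟩ := cases_map hg'
          obtain rfl : Δ.e d = c := Sum.inl_injective hc
          have hne' : f₁ ++ d :: f₂ ≠ g₁ ++ Δ.e d :: g₂ := by
            intro h
            exact hne (by simpa using congrArg (List.map Sum.inl) h)
          obtain ⟨u, hu⟩ := Δ.merge_in d f₁ f₂ g₁ g₂ hf hg hne'
          have h2 : 1 < Δ.faces.length := List.one_lt_length_of_mem_ne hf hg hne'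
          refine ⟨letter a * u, ((hu.conj (letter a)).mul' Ε.area).conj_eq 1 (by omega) ?_⟩
          simp [mul_assoc]
        · obtain ⟨g₁, c, g₂, -, -, h, -⟩ := cases_map hg'
          simp [emb₂] at h
      · obtain ⟨f₁, d, f₂, rfl, rfl, rfl, rfl⟩ := cases_map hf'
        rcases hg with ⟨g, hg, hg'⟩ | ⟨g, hg, hg'⟩
        · obtain ⟨g₁, c, g₂, -, -, h, -⟩ := cases_map hg'
          simp [emb₂] at h
        · obtain ⟨g₁, c, g₂, rfl, rfl, hc, rfl⟩ := cases_map hg'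
          obtain rfl : Ε.e d = c := emb₂_injective hc
          have hne' : f₁ ++ d :: f₂ ≠ g₁ ++ Ε.e d :: g₂ := by
            intro h
            exact hne (by simpa [emb₂] using congrArg (List.map emb₂) h)
          obtain ⟨u, hu⟩ := Ε.merge_in d f₁ f₂ g₁ g₂ hf hg hne'
          have h2 : 1 < Ε.faces.length := List.one_lt_length_of_mem_ne hf hg hne'
          have h3 := (hu.conj (letter a * val Δ.lab Δ.outer * (letter a)⁻¹)).mul'
            (Δ.area.conj (letter a))
          refine ⟨letter a * val Δ.lab Δ.outer * (letter a)⁻¹ * u, h3.conj_eq 1 (by omega) ?_⟩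
          simp [mul_assoc] }

end Dia

theorem Der.exists_dia (hR : Symmetrized R) : ∀ (n l : ℕ) (w : Word S), w.length = l → Der R n w →
    ∃ Δ : Dia R w, Δ.faces.length ≤ n := by
  intro n
  induction n using Nat.strong_induction_on with
  | _ n ihn =>
    intro l
    induction l using Nat.strong_induction_on with
    | _ l ihl =>
      intro w hl hw
      rcases w with _ | ⟨a, z⟩
      · exact ⟨Dia.nil R, by simp [Dia.nil]⟩
      rcases hw.peel hR [] a z rfl with ⟨u, v, i, j, hz, hu, hv, hij⟩ | ⟨s, m, hr, rfl, h⟩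
      · rw [List.append_nil] at hz
        subst hz
        have h1 : ∃ Δ : Dia R u, Δ.faces.length ≤ i := by
          rcases eq_or_lt_of_le (show i ≤ n by omega) with rfl | hi
          · exact ihl u.length (by simp at hl; omega) u rfl hu
          · exact ihn i hi _ u rfl hu
        have h2 : ∃ Δ : Dia R v, Δ.faces.length ≤ j := by
          rcases eq_or_lt_of_le (show j ≤ n by omega) with rfl | hj
          · exact ihl v.length (by simp at hl; omega) v rfl hv
          · exact ihn j hj _ v rfl hv
        obtain ⟨Δ, hΔ⟩ := h1
        obtain ⟨Ε, hΕ⟩ := h2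
        refine ⟨Δ.edge Ε a, ?_⟩
        simp [Dia.edge]
        omega
      · rw [List.append_nil] at h
        obtain ⟨Δ, hΔ⟩ := ihn m (by omega) _ _ rfl h
        have h1 := Δ.lab_outer
        obtain ⟨X, Y, hXY, hX, hY⟩ := List.map_eq_append_iff.1 h1
        obtain ⟨p, h2, h3⟩ := isPath_append.1 (hXY ▸ Δ.isPath_outer)
        have hr' : a :: wordInv (X.map Δ.lab) ∈ R := by simpa [hX] using hr
        have h4 : ∃ Δ' : Dia R (a :: Y.map Δ.lab), Δ'.faces.length ≤ m + 1 :=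
          ⟨Δ.face hR X Y p hr' hXY h2 h3, by simpa [Dia.face] using hΔ⟩
        rwa [hY] at h4

theorem Area.exists_dia (hR : Symmetrized R) {n : ℕ} {w : Word S} (h : Area R n (FreeGroup.mk w)) :
    ∃ Δ : Dia R w, Δ.faces.length ≤ n :=
  Der.exists_dia hR n _ w rfl (Der.of_area hR h w rfl)

end DiagramEdge
end GSC

namespace GSC

section Words

variable {S : Type}

theorem CyclicallyReduced.getElem_ne {w : Word S} (h : CyclicallyReduced w) {i : ℕ}
    (hi : i < w.length) :
    w[(i + 1) % w.length]'(Nat.mod_lt _ (by omega)) ≠ linv w[i] := by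
  have h1 := List.isChain_iff_getElem.1 h i (by simp; omega)
  rw [ne_linv_iff]
  rw [List.getElem_append_left hi] at h1
  rcases Nat.lt_or_ge (i + 1) w.length with h2 | h2
  · rw [List.getElem_append_left h2] at h1
    simpa only [Nat.mod_eq_of_lt h2] using h1
  · obtain h3 : i + 1 = w.length := by omega
    rw [List.getElem_append_right h2] at h1
    simpa only [h3, Nat.mod_self, Nat.sub_self] using h1

end Words

namespace Dia

variable {S : Type} {R : Set (Word S)} {w : Word S} (Δ : Dia R w)

/-- The boundary cycles of the faces, including the outer one. -/
def loops : List (List Δ.D) := Δ.outer :: Δ.faces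

theorem nodup_loops : Δ.loops.flatten.Nodup := by
  simpa [loops] using Δ.nodup

theorem exists_loop (d : Δ.D) : ∃ l ∈ Δ.loops, d ∈ l := by
  have := Δ.complete d
  simpa [loops] using this

theorem eq_of_mem_loops {l l' : List Δ.D} (hl : l ∈ Δ.loops) (hl' : l' ∈ Δ.loops) {d : Δ.D}
    (hd : d ∈ l) (hd' : d ∈ l') : l = l' := by
  by_contra hne
  have h := (List.nodup_flatten.1 Δ.nodup_loops).2
  have : Std.Symm (α := List Δ.D) List.Disjoint := ⟨fun _ _ h => h.symm⟩
  have := h.forall hl hl' hne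
  exact this hd hd'

theorem nodup_of_mem_loops {l : List Δ.D} (hl : l ∈ Δ.loops) : l.Nodup :=
  (List.nodup_flatten.1 Δ.nodup_loops).1 l hl

/-- The boundary cycle containing a dart. -/
noncomputable def loop (d : Δ.D) : List Δ.D := (Δ.exists_loop d).choose

theorem loop_mem (d : Δ.D) : Δ.loop d ∈ Δ.loops := (Δ.exists_loop d).choose_spec.1

theorem mem_loop (d : Δ.D) : d ∈ Δ.loop d := (Δ.exists_loop d).choose_spec.2

theorem loop_eq {l : List Δ.D} (hl : l ∈ Δ.loops) {d : Δ.D} (hd : d ∈ l) : Δ.loop d = l :=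
  Δ.eq_of_mem_loops (Δ.loop_mem d) hl (Δ.mem_loop d) hd

open Classical in
/-- The next dart along the boundary cycle. -/
noncomputable def next (d : Δ.D) : Δ.D := (Δ.loop d).next d (Δ.mem_loop d)

theorem next_mem_loop (d : Δ.D) : Δ.next d ∈ Δ.loop d := by
  classical
  exact List.next_mem _ _ _

theorem loop_next (d : Δ.D) : Δ.loop (Δ.next d) = Δ.loop d :=
  Δ.loop_eq (Δ.loop_mem d) (Δ.next_mem_loop d)

theorem loop_iter (k : ℕ) (d : Δ.D) : Δ.loop (Δ.next^[k] d) = Δ.loop d := by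
  induction k with
  | zero => rfl
  | succ k ih => rw [Function.iterate_succ_apply', loop_next, ih]

theorem next_getElem {l : List Δ.D} (hl : l ∈ Δ.loops) {i : ℕ} (hi : i < l.length) :
    Δ.next l[i] = l[(i + 1) % l.length]'(Nat.mod_lt _ (by omega)) := by
  classical
  have h := Δ.loop_eq hl (List.getElem_mem hi)
  have h2 := List.next_getElem l (Δ.nodup_of_mem_loops hl) i hi
  rw [← h2]
  unfold next
  congr 1

theorem iter_getElem {l : List Δ.D} (hl : l ∈ Δ.loops) {i : ℕ} (hi : i < l.length) (k : ℕ) :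
    Δ.next^[k] l[i] = l[(i + k) % l.length]'(Nat.mod_lt _ (by omega)) := by
  induction k with
  | zero => simp [Nat.mod_eq_of_lt hi]
  | succ k ih =>
    rw [Function.iterate_succ_apply', ih, Δ.next_getElem hl]
    congr 1
    rw [Nat.mod_add_mod, add_assoc]

theorem iter_length (d : Δ.D) : Δ.next^[(Δ.loop d).length] d = d := by
  obtain ⟨i, hi, h⟩ := List.getElem_of_mem (Δ.mem_loop d)
  conv_lhs => rw [← h]
  conv_rhs => rw [← h]
  have := Δ.iter_getElem (Δ.loop_mem d) hi (Δ.loop d).length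
  simp only [h] at this ⊢
  rw [this]
  simp [Nat.mod_eq_of_lt hi, h]

theorem iter_inj {d : Δ.D} {j k : ℕ} (hj : j < (Δ.loop d).length) (hk : k < (Δ.loop d).length)
    (h : Δ.next^[j] d = Δ.next^[k] d) : j = k := by
  obtain ⟨i, hi, hd⟩ := List.getElem_of_mem (Δ.mem_loop d)
  have h1 := Δ.iter_getElem (Δ.loop_mem d) hi j
  have h2 := Δ.iter_getElem (Δ.loop_mem d) hi k
  rw [hd] at h1 h2
  rw [h1, h2, (Δ.nodup_of_mem_loops (Δ.loop_mem d)).getElem_inj_iff] at h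
  have h3 : j % (Δ.loop d).length = k % (Δ.loop d).length := Nat.ModEq.add_left_cancel' i h
  rwa [Nat.mod_eq_of_lt hj, Nat.mod_eq_of_lt hk] at h3

theorem exists_iter {d d' : Δ.D} (h : Δ.loop d = Δ.loop d') :
    ∃ k < (Δ.loop d).length, Δ.next^[k] d = d' := by
  obtain ⟨i, hi, hd⟩ := List.getElem_of_mem (Δ.mem_loop d)
  obtain ⟨j, hj, hd'⟩ := List.getElem_of_mem (h ▸ Δ.mem_loop d')
  refine ⟨(j + ((Δ.loop d).length - i)) % (Δ.loop d).length, Nat.mod_lt _ (by omega), ?_⟩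
  have h1 := Δ.iter_getElem (Δ.loop_mem d) hi
    ((j + ((Δ.loop d).length - i)) % (Δ.loop d).length)
  rw [hd] at h1
  rw [h1, ← hd']
  congr 1
  rw [Nat.add_mod_mod, show i + (j + ((Δ.loop d).length - i)) = j + (Δ.loop d).length by omega]
  simp [Nat.mod_eq_of_lt hj]

theorem next_injective : Function.Injective Δ.next := by
  intro d d' h
  have h1 : Δ.loop d = Δ.loop d' := by rw [← Δ.loop_next d, h, Δ.loop_next]
  have h2 := Δ.iter_length d
  have h3 := Δ.iter_length d'
  have h4 : 0 < (Δ.loop d).length := List.length_pos_of_mem (Δ.mem_loop d)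
  obtain ⟨k, hk⟩ : ∃ k, (Δ.loop d).length = k + 1 := ⟨_, (Nat.sub_add_cancel h4).symm⟩
  rw [hk, Function.iterate_succ_apply] at h2
  rw [← h1, hk, Function.iterate_succ_apply] at h3
  rw [← h2, h, h3]

theorem org_next_of_isPath {V D : Type} {org : D → V} {e : D → D} {v : V} {l : List D}
    (h : IsPath org e v l v) {i : ℕ} (hi : i < l.length) :
    org (l[(i + 1) % l.length]'(Nat.mod_lt _ (by omega))) = org (e l[i]) := by
  have h1 : l = l.take i ++ l[i] :: l.drop (i + 1) := by simp
  have h2 := h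
  rw [h1] at h2
  obtain ⟨m, h3, h4, h5⟩ := isPath_append.1 h2
  rcases Nat.lt_or_ge (i + 1) l.length with h6 | h6
  · simp only [Nat.mod_eq_of_lt h6]
    rw [List.drop_eq_getElem_cons h6] at h5
    exact h5.1
  · obtain h7 : i + 1 = l.length := by omega
    rw [List.drop_eq_nil_of_le h6] at h5
    simp only [h7, Nat.mod_self]
    rw [h5]
    rcases l with _ | ⟨d, l⟩
    · simp at hi
    · exact h.1

theorem isPath_loop {l : List Δ.D} (hl : l ∈ Δ.loops) : ∃ v, IsPath Δ.org Δ.e v l v := by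
  rcases List.mem_cons.1 hl with rfl | hl
  · exact ⟨_, Δ.isPath_outer⟩
  · exact Δ.face_path l hl

theorem org_next (d : Δ.D) : Δ.org (Δ.next d) = Δ.org (Δ.e d) := by
  obtain ⟨i, hi, hd⟩ := List.getElem_of_mem (Δ.mem_loop d)
  obtain ⟨v, hv⟩ := Δ.isPath_loop (Δ.loop_mem d)
  have h1 := org_next_of_isPath hv hi
  have h2 := Δ.next_getElem (Δ.loop_mem d) hi
  rw [hd] at h1 h2
  rw [h2, h1]

theorem lab_next_ne (hR : ∀ r ∈ R, CyclicallyReduced r) (hw : CyclicallyReduced w) (d : Δ.D) :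
    Δ.lab (Δ.next d) ≠ linv (Δ.lab d) := by
  obtain ⟨i, hi, hd⟩ := List.getElem_of_mem (Δ.mem_loop d)
  have h1 : CyclicallyReduced ((Δ.loop d).map Δ.lab) := by
    rcases List.mem_cons.1 (Δ.loop_mem d) with h | h
    · rw [h, Δ.lab_outer]
      exact hw
    · exact hR _ (Δ.face_mem _ h)
  have h2 := h1.getElem_ne (i := i) (by simpa using hi)
  have h3 := Δ.next_getElem (Δ.loop_mem d) hi
  rw [hd] at h3
  rw [h3]
  simpa [hd] using h2

/-- The word of length `m` read along the boundary cycle from the dart `d`. -/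
noncomputable def read (d : Δ.D) (m : ℕ) : Word S :=
  (List.range m).map fun i => Δ.lab (Δ.next^[i] d)

@[simp] theorem length_read (d : Δ.D) (m : ℕ) : (Δ.read d m).length = m := by simp [read]

theorem read_add (d : Δ.D) (m k : ℕ) :
    Δ.read d (m + k) = Δ.read d m ++ Δ.read (Δ.next^[m] d) k := by
  simp only [read, List.range_add, List.map_append, List.map_map]
  congr 1
  refine List.map_congr_left fun i _ => ?_
  simp only [Function.comp]
  rw [add_comm, Function.iterate_add_apply]

theorem read_succ (d : Δ.D) (m : ℕ) : Δ.read d (m + 1) = Δ.lab d :: Δ.read (Δ.next d) m := by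
  rw [add_comm, read_add]
  simp [read]

theorem read_eq_rotate {l : List Δ.D} (hl : l ∈ Δ.loops) {i : ℕ} (hi : i < l.length) :
    Δ.read l[i] l.length = (l.rotate i).map Δ.lab := by
  apply List.ext_getElem
  · simp
  · intro k h1 h2
    simp [read, Δ.iter_getElem hl hi, List.getElem_rotate, add_comm]

theorem read_eq_append {l l₁ l₂ : List Δ.D} {d : Δ.D} (hl : l ∈ Δ.loops) (h : l = l₁ ++ d :: l₂) :
    Δ.read (Δ.next d) (l.length - 1) = (l₂ ++ l₁).map Δ.lab := by
  have h1 : l₁.length < l.length := by simp [h]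
  have h2 := Δ.read_eq_rotate hl h1
  have h3 : l[l₁.length] = d := by simp [h]
  have h4 : l.rotate l₁.length = d :: (l₂ ++ l₁) := by
    rw [h, List.rotate_append_length_eq]
    rfl
  rw [h3, h4, show l.length = l.length - 1 + 1 by omega, read_succ] at h2
  simpa using h2

theorem read_mem (hR : Symmetrized R) {d : Δ.D} {f : List Δ.D} (hf : f ∈ Δ.faces) (hd : d ∈ f) :
    Δ.read d f.length ∈ R := by
  obtain ⟨i, hi, rfl⟩ := List.getElem_of_mem hd
  rw [Δ.read_eq_rotate (List.mem_cons_of_mem _ hf) hi]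
  have := Δ.face_mem f hf
  rw [List.rotate_eq_drop_append_take hi.le, List.map_append]
  apply hR.rot
  simpa [← List.map_append] using this

theorem read_eq_wordInv {m : ℕ} {o d : Δ.D}
    (h : ∀ i < m, Δ.next^[i] o = Δ.e (Δ.next^[m - 1 - i] d)) :
    Δ.read o m = wordInv (Δ.read d m) := by
  apply List.ext_getElem
  · simp
  · intro k h1 h2
    simp only [length_read] at h1
    simp [read, wordInv, h k h1, Δ.lab_e, linv]

theorem area_merge_out {o : Δ.D} (ho : o ∈ Δ.outer) {f : List Δ.D} (hf : f ∈ Δ.faces)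
    (he : Δ.e o ∈ f) : Area R (Δ.faces.length - 1)
      (FreeGroup.mk (Δ.read (Δ.next (Δ.e o)) (f.length - 1)) *
        FreeGroup.mk (Δ.read (Δ.next o) (Δ.outer.length - 1))) := by
  obtain ⟨O₁, O₂, hO⟩ := List.append_of_mem ho
  obtain ⟨f₁, f₂, rfl⟩ := List.append_of_mem he
  have := Δ.merge_out O₁ o O₂ f₁ f₂ hO hf
  rw [Δ.read_eq_append (List.mem_cons_of_mem _ hf) rfl, Δ.read_eq_append List.mem_cons_self hO]
  simpa [val, mk_append, -FreeGroup.mul_mk, mul_assoc] using this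

theorem area_merge_in {d : Δ.D} {f g : List Δ.D} (hf : f ∈ Δ.faces) (hg : g ∈ Δ.faces)
    (hd : d ∈ f) (he : Δ.e d ∈ g) (hne : f ≠ g) : ∃ u, Area R (Δ.faces.length - 2)
      (u * (FreeGroup.mk (Δ.read (Δ.next d) (f.length - 1)) *
        FreeGroup.mk (Δ.read (Δ.next (Δ.e d)) (g.length - 1))) * u⁻¹ * FreeGroup.mk w) := by
  obtain ⟨f₁, f₂, rfl⟩ := List.append_of_mem hd
  obtain ⟨g₁, g₂, rfl⟩ := List.append_of_mem he
  obtain ⟨u, hu⟩ := Δ.merge_in d f₁ f₂ g₁ g₂ hf hg hne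
  refine ⟨u, ?_⟩
  rw [Δ.read_eq_append (List.mem_cons_of_mem _ hf) rfl,
    Δ.read_eq_append (List.mem_cons_of_mem _ hg) rfl]
  simpa [val, mk_append, -FreeGroup.mul_mk, mul_assoc, Δ.lab_outer] using hu

end Dia
end GSC

namespace GSC

section FaceCount

open Finset

variable {L : ℕ} {c x : ℕ → Prop} [DecidablePred c] [DecidablePred x]

theorem card_unexposed_le (h1 : ∀ k, ¬ c (k + 1) → (x k ↔ x (k + 1)))
    (h2 : ∀ k m, ¬ x k → 1 ≤ m → (∀ j, 1 ≤ j → j < m → ¬ c (k + j)) → 6 * m < L) (hL : c L) :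
    6 * #{k ∈ range L | ¬ x k} ≤ #{k ∈ range L | ¬ x k ∧ c (k + 1)} * (L - 1) := by
  have key : ∀ k < L, ¬ x k → ∃ t < L, k ≤ t ∧ c (t + 1) ∧ ¬ x t ∧ 6 * (t - k + 1) < L := by
    intro k hk hxk
    have hex : ∃ j, c (k + j + 1) := ⟨L - 1 - k, by rwa [show k + (L - 1 - k) + 1 = L by omega]⟩
    classical
    have hc := Nat.find_spec hex
    have hm := fun j hj => Nat.find_min hex (m := j) hj
    have hle : Nat.find hex ≤ L - 1 - k :=
      Nat.find_le (by rwa [show k + (L - 1 - k) + 1 = L by omega])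
    generalize Nat.find hex = j₀ at hc hm hle
    refine ⟨k + j₀, by omega, by omega, hc, ?_, ?_⟩
    · have : ∀ j ≤ j₀, ¬ x (k + j) := by
        intro j
        induction j with
        | zero => simpa
        | succ j ih => exact fun hj => (h1 _ (hm j (by omega))).not.1 (ih (by omega))
      exact this _ le_rfl
    · refine h2 k _ hxk (by omega) fun j hj hj' => ?_
      have := hm (j - 1) (by omega)
      rwa [show k + (j - 1) + 1 = k + j by omega] at this
  choose! t ht using key
  have hcard : #{k ∈ range L | ¬ x k} ≤
      #({k ∈ range L | ¬ x k ∧ c (k + 1)} ×ˢ range ((L - 1) / 6)) := by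
    refine card_le_card_of_injOn (fun k => (t k, t k - k)) ?_ ?_
    · intro k hk
      simp only [coe_filter, mem_range, Set.mem_ofPred_eq] at hk
      obtain ⟨h3, h4, h5, h6, h7⟩ := ht k hk.1 hk.2
      simp only [coe_product, coe_filter, mem_range, coe_range, Set.mem_prod, Set.mem_ofPred_eq,
        Set.mem_Iio]
      exact ⟨⟨h3, h6, h5⟩, by omega⟩
    · intro k hk k' hk' h
      simp only [coe_filter, mem_range, Set.mem_ofPred_eq] at hk hk'
      have h3 := ht k hk.1 hk.2
      have h4 := ht k' hk'.1 hk'.2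
      simp only [Prod.mk.injEq] at h
      omega
  rw [card_product, card_range] at hcard
  have : 6 * ((L - 1) / 6) ≤ L - 1 := Nat.mul_div_le _ _
  nlinarith

theorem exists_exposed_arc (h1 : ∀ k, ¬ c (k + 1) → (x k ↔ x (k + 1)))
    (h2 : ∀ k m, ¬ x k → 1 ≤ m → (∀ j, 1 ≤ j → j < m → ¬ c (k + j)) → 6 * m < L)
    (hx : x 0) (hxL : x L) (hL : 0 < L) (hx' : ¬ x (L - 1))
    (h : #{k ∈ range L | c (k + 1)} + #{k ∈ range L | x k ∧ c (k + 1)} ≤ 5) :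
    ∃ m, 1 ≤ m ∧ m < L ∧ (∀ j < m, x j) ∧
      (2 + (6 - (#{k ∈ range L | c (k + 1)} + #{k ∈ range L | x k ∧ c (k + 1)}))) * L < 6 * m := by
  have hcL : c L := by
    by_contra hc
    have := h1 (L - 1)
    rw [show L - 1 + 1 = L by omega] at this
    tauto
  have hU := card_unexposed_le h1 h2 hcL
  have hsplit : #{k ∈ range L | c (k + 1)} =
      #{k ∈ range L | x k ∧ c (k + 1)} + #{k ∈ range L | ¬ x k ∧ c (k + 1)} := by
    rw [← card_filter_add_card_filter_not (s := {k ∈ range L | c (k + 1)}) x, filter_filter,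
      filter_filter]
    simp only [and_comm]
  have hex : ∃ k, ¬ x k := ⟨_, hx'⟩
  classical
  have hm := Nat.find_spec hex
  have hm' := fun j hj => not_not.1 (Nat.find_min hex (m := j) hj)
  have hmL : Nat.find hex ≤ L - 1 := Nat.find_le hx'
  generalize Nat.find hex = m at hm hm' hmL
  have hm0 : m ≠ 0 := by rintro rfl; exact hm hx
  have hstep : ∀ k, x k → ¬ x (k + 1) → c (k + 1) := fun k h h' => by
    by_contra hc; exact h' ((h1 k hc).1 h)
  have hstep' : ∀ k, ¬ x k → x (k + 1) → c (k + 1) := fun k h h' => by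
    by_contra hc; exact h ((h1 k hc).2 h')
  have hX : m - 1 ∈ ({k ∈ range L | x k ∧ c (k + 1)} : Finset ℕ) := by
    simp only [mem_filter, mem_range]
    refine ⟨by omega, hm' _ (by omega), hstep _ (hm' _ (by omega)) ?_⟩
    rwa [show m - 1 + 1 = m by omega]
  have hI : L - 1 ∈ ({k ∈ range L | ¬ x k ∧ c (k + 1)} : Finset ℕ) := by
    simp only [mem_filter, mem_range]
    exact ⟨by omega, hx', by rwa [show L - 1 + 1 = L by omega]⟩
  have hrest : ∀ k, m ≤ k → k < L → ¬ x k := by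
    by_contra! hcon
    obtain ⟨k₀, hk₀⟩ := hcon
    have hex : ∃ j, x (m + j) := ⟨k₀ - m, by rw [show m + (k₀ - m) = k₀ by omega]; exact hk₀.2.2⟩
    have hk := Nat.find_spec hex
    have hk' := fun j hj => Nat.find_min hex (m := j) hj
    have hkL : Nat.find hex ≤ k₀ - m :=
      Nat.find_le (by rw [show m + (k₀ - m) = k₀ by omega]; exact hk₀.2.2)
    generalize Nat.find hex = k at hk hk' hkL
    have hk0 : k ≠ 0 := by rintro rfl; exact hm hk
    have hex : ∃ j, ¬ x (m + k + j) :=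
      ⟨L - 1 - (m + k), by rwa [show m + k + (L - 1 - (m + k)) = L - 1 by omega]⟩
    have hl := Nat.find_spec hex
    have hl' := fun j hj => not_not.1 (Nat.find_min hex (m := j) hj)
    have hlL : Nat.find hex ≤ L - 1 - (m + k) :=
      Nat.find_le (by rwa [show m + k + (L - 1 - (m + k)) = L - 1 by omega])
    generalize Nat.find hex = l at hl hl' hlL
    have hl0 : l ≠ 0 := by rintro rfl; exact hl hk
    have hX' : m + k + l - 1 ∈ ({k ∈ range L | x k ∧ c (k + 1)} : Finset ℕ) := by
      have h3 := hl' (l - 1) (by omega)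
      rw [show m + k + (l - 1) = m + k + l - 1 by omega] at h3
      simp only [mem_filter, mem_range]
      refine ⟨by omega, h3, hstep _ h3 ?_⟩
      rwa [show m + k + l - 1 + 1 = m + k + l by omega]
    have hI' : m + k - 1 ∈ ({k ∈ range L | ¬ x k ∧ c (k + 1)} : Finset ℕ) := by
      have h3 := hk' (k - 1) (by omega)
      rw [show m + (k - 1) = m + k - 1 by omega] at h3
      simp only [mem_filter, mem_range]
      refine ⟨by omega, h3, hstep' _ h3 ?_⟩
      rwa [show m + k - 1 + 1 = m + k by omega]
    have h3 : 1 < #{k ∈ range L | x k ∧ c (k + 1)} :=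
      one_lt_card.2 ⟨_, hX, _, hX', by omega⟩
    have hne : m + k ≠ L := by
      rintro h
      rw [show m + k + l - 1 = L - 1 + l by omega] at hX'
      simp only [mem_filter, mem_range] at hX'
      omega
    have h4 : 1 < #{k ∈ range L | ¬ x k ∧ c (k + 1)} :=
      one_lt_card.2 ⟨_, hI, _, hI', by omega⟩
    omega
  refine ⟨m, by omega, by omega, hm', ?_⟩
  have hUcard : #{k ∈ range L | ¬ x k} = L - m := by
    rw [show ({k ∈ range L | ¬ x k} : Finset ℕ) = Ico m L by
      ext k
      simp only [mem_filter, mem_range, mem_Ico]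
      constructor
      · rintro ⟨h3, h4⟩
        exact ⟨by by_contra! h5; exact h4 (hm' _ h5), h3⟩
      · exact fun h3 => ⟨h3.2, hrest _ h3.1 h3.2⟩]
    simp
  have hX1 : 0 < #{k ∈ range L | x k ∧ c (k + 1)} := card_pos.2 ⟨_, hX⟩
  have hI1 : 0 < #{k ∈ range L | ¬ x k ∧ c (k + 1)} := card_pos.2 ⟨_, hI⟩
  rw [hUcard] at hU
  rw [hsplit] at h ⊢
  generalize #{k ∈ range L | x k ∧ c (k + 1)} = X at *
  generalize #{k ∈ range L | ¬ x k ∧ c (k + 1)} = I at *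
  obtain ⟨hI3, hX2⟩ : I ≤ 3 ∧ X ≤ 2 := by omega
  interval_cases I <;> interval_cases X <;> omega

end FaceCount
end GSC

namespace GSC

variable {S : Type} {R : Set (Word S)} {w : Word S}

/-- A symmetrized set of cyclically reduced words in which pieces are shorter than a sixth of the
relators containing them. -/
structure SmallCancellation (R : Set (Word S)) : Prop extends Symmetrized R where
  cyc : ∀ r ∈ R, CyclicallyReduced r
  small : ∀ r ∈ R, ∀ r' ∈ R, r ≠ r' → ∀ p, p <+: r → p <+: r' → 6 * p.length < r.length

namespace Dia

/-- A minimal diagram whose boundary is a simple closed curve with a nonempty cyclically reduced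
label. -/
structure Taut (Δ : Dia R w) : Prop where
  cyc : CyclicallyReduced w
  ne_nil : w ≠ []
  min : ∀ k, Area R k (FreeGroup.mk w) → Δ.faces.length ≤ k
  inj : ∀ o ∈ Δ.outer, ∀ o' ∈ Δ.outer, Δ.org o = Δ.org o' → o = o'

variable (Δ : Dia R w)

attribute [instance] fintypeV fintypeD

open Classical in
/-- The degree of a vertex. -/
noncomputable def deg (v : Δ.V) : ℕ := (Finset.univ.filter fun d => Δ.org d = v).card

/-- A dart is a corner if its origin has degree at least three. -/
def Corner (d : Δ.D) : Prop := 3 ≤ Δ.deg (Δ.org d)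

variable {Δ}

theorem e_next_ne (hR : SmallCancellation R) (hΔ : Δ.Taut) (d : Δ.D) : Δ.e (Δ.next d) ≠ d := by
  intro h
  have h1 := Δ.lab_next_ne hR.cyc hΔ.cyc d
  rw [← h, Δ.lab_e, linv_linv, h] at h1
  exact h1 rfl

theorem two_le_deg_org (hR : SmallCancellation R) (hΔ : Δ.Taut) (d : Δ.D) :
    2 ≤ Δ.deg (Δ.org d) := by
  classical
  refine Finset.one_lt_card.2 ⟨d, by simp, Δ.next (Δ.e d), ?_, ?_⟩
  · simp [Δ.org_next, Δ.e_e]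
  · intro h
    apply e_next_ne hR hΔ (Δ.e d)
    rw [← h]

theorem two_le_deg (hR : SmallCancellation R) (hΔ : Δ.Taut) (v : Δ.V) : 2 ≤ Δ.deg v := by
  rcases Δ.surj v with rfl | ⟨d, rfl⟩
  · have h1 := Δ.isPath_outer
    have h2 := Δ.lab_outer
    rcases h : Δ.outer with _ | ⟨d, l⟩
    · rw [h] at h2
      exact absurd h2.symm hΔ.ne_nil
    · rw [h] at h1
      rw [← h1.1]
      exact two_le_deg_org hR hΔ d
  · exact two_le_deg_org hR hΔ d

theorem e_eq_next_e_next (hR : SmallCancellation R) (hΔ : Δ.Taut) {d : Δ.D}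
    (h : ¬ Δ.Corner (Δ.next d)) : Δ.e d = Δ.next (Δ.e (Δ.next d)) := by
  classical
  by_contra hne
  apply h
  refine Finset.two_lt_card.2 ⟨Δ.next d, by simp, Δ.e d, ?_, _, ?_, ?_, ?_, hne⟩
  · simp [Δ.org_next]
  · simp [Δ.org_next, Δ.e_e]
  · intro h1
    apply e_next_ne hR hΔ d
    rw [h1, Δ.e_e]
  · intro h1
    exact e_next_ne hR hΔ d (Δ.next_injective h1).symm

theorem card_corner_add_le (hR : SmallCancellation R) (hΔ : Δ.Taut) [DecidablePred Δ.Corner] :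
    (Finset.univ.filter Δ.Corner).card + 6 ≤ 6 * Δ.faces.length := by
  classical
  have h1 : Fintype.card Δ.D = ∑ v, Δ.deg v := by
    rw [← Finset.card_univ]
    exact Finset.card_eq_sum_card_fiberwise (by simp)
  have h2 : (Finset.univ.filter Δ.Corner).card = ∑ v, if 3 ≤ Δ.deg v then Δ.deg v else 0 := by
    rw [Finset.card_eq_sum_card_fiberwise (f := Δ.org) (t := Finset.univ) (by simp)]
    refine Finset.sum_congr rfl fun v _ => ?_
    rw [Finset.filter_filter]
    split_ifs with h
    · rw [deg]
      congr 1
      ext d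
      simp only [Finset.mem_filter, Finset.mem_univ, true_and, and_iff_right_iff_imp]
      rintro rfl
      exact h
    · rw [Finset.card_eq_zero, Finset.filter_eq_empty_iff]
      rintro d - ⟨h3, rfl⟩
      exact h h3
  have h3 : ∑ v : Δ.V, (6 + if 3 ≤ Δ.deg v then Δ.deg v else 0) ≤ ∑ v, 3 * Δ.deg v := by
    refine Finset.sum_le_sum fun v _ => ?_
    have := two_le_deg hR hΔ v
    split_ifs <;> omega
  rw [Finset.sum_add_distrib, ← h2, ← Finset.mul_sum, ← h1] at h3
  simp only [Finset.sum_const, Finset.card_univ, smul_eq_mul] at h3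
  have := Δ.euler
  omega

theorem countP_eq_card {D : Type} [Fintype D] {l : List D} (hl : l.Nodup) (p : D → Prop)
    [DecidablePred p] [DecidablePred fun d => d ∈ l] :
    l.countP (fun d => decide (p d)) = (Finset.univ.filter fun d => d ∈ l ∧ p d).card := by
  classical
  rw [List.countP_eq_length_filter, ← List.toFinset_card_of_nodup (hl.filter _)]
  congr 1
  ext d
  simp

open Classical in
/-- The number of corners of a face plus the number of its exposed edges ending at a corner. -/
noncomputable def weight (Δ : Dia R w) (f : List Δ.D) : ℕ :=
  f.countP (fun d => decide (Δ.Corner (Δ.next d))) +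
    f.countP (fun d => decide (Δ.e d ∈ Δ.outer ∧ Δ.Corner (Δ.next d)))

theorem loop_perm {d : Δ.D} {l : List Δ.D} (hl : l ∈ Δ.loops) (hd : d ∈ l) :
    ((List.range l.length).map fun k => Δ.next^[k] d).Perm l := by
  have h1 := Δ.loop_eq hl hd
  rw [List.perm_ext_iff_of_nodup]
  · intro a
    simp only [List.mem_map, List.mem_range]
    constructor
    · rintro ⟨k, hk, rfl⟩
      have := Δ.mem_loop (Δ.next^[k] d)
      rwa [Δ.loop_iter, h1] at this
    · intro ha
      have := Δ.exists_iter (h1.trans (Δ.loop_eq hl ha).symm)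
      rwa [h1] at this
  · rw [List.nodup_map_iff_inj_on List.nodup_range]
    intro j hj k hk h
    subst h1
    exact Δ.iter_inj (List.mem_range.1 hj) (List.mem_range.1 hk) h
  · exact Δ.nodup_of_mem_loops hl

theorem countP_loop {d : Δ.D} {l : List Δ.D} (hl : l ∈ Δ.loops) (hd : d ∈ l) (p : Δ.D → Prop)
    [DecidablePred p] : l.countP (fun d => decide (p d)) =
      (Finset.filter (fun k => p (Δ.next^[k] d)) (Finset.range l.length)).card := by
  rw [← (loop_perm hl hd).countP_eq, List.countP_map, ← Nat.count_eq_card_filter_range]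
  rfl

theorem countP_next {l : List Δ.D} (hl : l ∈ Δ.loops) (p : Δ.D → Prop) [DecidablePred p] :
    l.countP (fun d => decide (p (Δ.next d))) = l.countP (fun d => decide (p d)) := by
  rcases l with _ | ⟨d, l⟩
  · rfl
  · have h2 : Δ.next d ∈ d :: l := by
      rw [← Δ.loop_eq hl List.mem_cons_self]; exact Δ.next_mem_loop d
    rw [countP_loop hl List.mem_cons_self (fun d => p (Δ.next d)), countP_loop hl h2]
    simp only [← Function.iterate_succ_apply, Function.iterate_succ_apply']

theorem sum_weight_le (hR : SmallCancellation R) (hΔ : Δ.Taut) :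
    (Δ.faces.map Δ.weight).sum + 6 ≤ 6 * Δ.faces.length := by
  classical
  refine le_trans ?_ (card_corner_add_le hR hΔ)
  have h1 : ∀ F : List (List Δ.D), (∀ f ∈ F, f ∈ Δ.faces) → (F.map Δ.weight).sum =
      F.flatten.countP (fun d => decide (Δ.Corner d)) +
      F.flatten.countP (fun d => decide (Δ.e d ∈ Δ.outer ∧ Δ.Corner (Δ.next d))) := by
    intro F hF
    induction F with
    | nil => rfl
    | cons f F ih =>
      rw [List.map_cons, List.sum_cons, ih fun g hg => hF g (List.mem_cons_of_mem _ hg), weight,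
        countP_next (List.mem_cons_of_mem _ (hF f List.mem_cons_self))]
      simp only [List.flatten_cons, List.countP_append]
      omega
  rw [h1 _ fun _ h => h]
  have hn := Δ.nodup
  rw [List.nodup_append'] at hn
  rw [countP_eq_card hn.2.1, countP_eq_card hn.2.1]
  have h2 : (Finset.univ.filter fun d => d ∈ Δ.faces.flatten ∧
      Δ.e d ∈ Δ.outer ∧ Δ.Corner (Δ.next d)).card ≤
      (Finset.univ.filter fun d => d ∈ Δ.outer ∧ Δ.Corner d).card := by
    refine Finset.card_le_card_of_injOn Δ.e ?_ ?_
    · intro d hd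
      simp only [Finset.coe_filter, Finset.mem_univ, true_and, Set.mem_ofPred_eq] at hd ⊢
      refine ⟨hd.2.1, ?_⟩
      have := hd.2.2
      rwa [Corner, Δ.org_next] at this
    · intro d _ d' _ h
      rw [← Δ.e_e d, h, Δ.e_e]
  have h3 : (Finset.univ.filter Δ.Corner).card =
      (Finset.univ.filter fun d => d ∈ Δ.faces.flatten ∧ Δ.Corner d).card +
      (Finset.univ.filter fun d => d ∈ Δ.outer ∧ Δ.Corner d).card := by
    rw [← Finset.card_union_of_disjoint]
    · congr 1
      ext d
      have := Δ.complete d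
      simp only [List.mem_append] at this
      simp only [Finset.mem_filter, Finset.mem_univ, true_and, Finset.mem_union]
      tauto
    · rw [Finset.disjoint_left]
      intro d hd hd'
      simp only [Finset.mem_filter, Finset.mem_univ, true_and] at hd hd'
      exact hn.2.2 hd'.1 hd.1
  omega

theorem six_le_sum (hR : SmallCancellation R) (hΔ : Δ.Taut) :
    6 ≤ (Δ.faces.map fun f => 6 - Δ.weight f).sum := by
  have h := sum_weight_le hR hΔ
  have : ∀ F : List (List Δ.D),
      6 * F.length ≤ (F.map Δ.weight).sum + (F.map fun f => 6 - Δ.weight f).sum := by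
    intro F
    induction F with
    | nil => simp
    | cons f F ih => simp only [List.length_cons, List.map_cons, List.sum_cons]; omega
  have := this Δ.faces
  omega

end Dia
end GSC

namespace GSC

variable {S : Type} {R : Set (Word S)} {w : Word S}

namespace Dia

variable {Δ : Dia R w}

theorem mem_faces_of_not_mem_outer {d : Δ.D} (h : d ∉ Δ.outer) : ∃ f ∈ Δ.faces, d ∈ f := by
  have := Δ.complete d
  rw [List.mem_append, List.mem_flatten] at this
  tauto

theorem iter_mem {f : List Δ.D} (hf : f ∈ Δ.loops) {d : Δ.D} (hd : d ∈ f) (k : ℕ) :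
    Δ.next^[k] d ∈ f := by
  have := Δ.mem_loop (Δ.next^[k] d)
  rwa [Δ.loop_iter, Δ.loop_eq hf hd] at this

theorem mem_of_iter_mem {f : List Δ.D} (hf : f ∈ Δ.loops) {d : Δ.D} {k : ℕ}
    (hd : Δ.next^[k] d ∈ f) : d ∈ f := by
  have := Δ.loop_eq hf hd
  rw [Δ.loop_iter] at this
  rw [← this]
  exact Δ.mem_loop d

theorem iter_faces_length {f : List Δ.D} (hf : f ∈ Δ.loops) {d : Δ.D} (hd : d ∈ f) :
    Δ.next^[f.length] d = d := by
  have := Δ.iter_length d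
  rwa [Δ.loop_eq hf hd] at this

/-- Two relators read from opposite sides of a common edge of a minimal diagram are distinct. -/
theorem read_ne_of_adjacent (hR : SmallCancellation R) (hΔ : Δ.Taut) {d : Δ.D} {f g : List Δ.D}
    (hf : f ∈ Δ.faces) (hg : g ∈ Δ.faces) (hd : d ∈ f) (he : Δ.e d ∈ g) :
    Δ.read d f.length ≠ wordInv (Δ.read (Δ.next (Δ.e d)) g.length) := by
  intro h
  have hfl : 0 < f.length := List.length_pos_of_mem hd
  have hgl : 0 < g.length := List.length_pos_of_mem he
  by_cases hfg : f = g
  · subst hfg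
    have hl := List.mem_cons_of_mem Δ.outer hf
    obtain ⟨k, hk, hk'⟩ := Δ.exists_iter ((Δ.loop_eq hl hd).trans (Δ.loop_eq hl he).symm)
    rw [Δ.loop_eq hl hd] at hk
    have key : ∀ i ≤ k, Δ.lab (Δ.next^[i] d) = linv (Δ.lab (Δ.next^[k - i] d)) := by
      intro i hi
      have h1 : ∀ j (hj : j < f.length), (Δ.read d f.length)[j]'(by simpa) =
          linv ((Δ.read (Δ.next (Δ.e d)) f.length)[f.length - 1 - j]'(by simp; omega)) := by
        intro j hj
        simp only [h]
        simp [wordInv, linv]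
      have h2 := h1 i (by omega)
      simp only [read, List.getElem_map, List.getElem_range] at h2
      rw [h2, ← hk', ← Function.iterate_succ_apply' Δ.next, ← Function.iterate_add_apply,
        show f.length - 1 - i + (k + 1) = k - i + f.length by omega,
        Function.iterate_add_apply, iter_faces_length hl hd]
    rcases Nat.even_or_odd' k with ⟨i, rfl | rfl⟩
    · have := key i (by omega)
      rw [show 2 * i - i = i by omega] at this
      exact linv_ne _ this.symm
    · have := key (i + 1) (by omega)
      rw [show 2 * i + 1 - (i + 1) = i by omega, Function.iterate_succ_apply'] at this
      exact Δ.lab_next_ne hR.cyc hΔ.cyc _ this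
  · obtain ⟨u, hu⟩ := Δ.area_merge_in hf hg hd he hfg
    have h1 : Δ.read (Δ.next d) (f.length - 1) =
        wordInv (Δ.read (Δ.next (Δ.e d)) (g.length - 1)) := by
      rw [show f.length = f.length - 1 + 1 by omega, read_succ,
        show g.length = g.length - 1 + 1 by omega, read_add, wordInv_append] at h
      have h2 : Δ.read (Δ.next^[g.length - 1] (Δ.next (Δ.e d))) 1 = [Δ.lab (Δ.e d)] := by
        rw [← Function.iterate_succ_apply, Nat.succ_eq_add_one, Nat.sub_add_cancel hgl,
          iter_faces_length (List.mem_cons_of_mem _ hg) he]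
        rfl
      rw [h2] at h
      simp only [wordInv_cons, wordInv_nil, List.nil_append, List.singleton_append,
        List.cons.injEq] at h
      exact h.2
    rw [h1, mk_wordInv, inv_mul_cancel, mul_one, mul_inv_cancel, one_mul] at hu
    have h2 := hΔ.min _ hu
    have := List.length_pos_of_mem hf
    omega

theorem iter_e {d : Δ.D} {m : ℕ}
    (h : ∀ j, j + 1 < m → Δ.e (Δ.next^[j] d) = Δ.next (Δ.e (Δ.next^[j + 1] d))) :
    ∀ i < m, Δ.next^[i] (Δ.e (Δ.next^[m - 1] d)) = Δ.e (Δ.next^[m - 1 - i] d) := by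
  intro i
  induction i with
  | zero => simp
  | succ i ih =>
    intro hi
    rw [Function.iterate_succ_apply', ih (by omega), h (m - 1 - (i + 1)) (by omega),
      show m - 1 - (i + 1) + 1 = m - 1 - i by omega]

theorem arc_small (hR : SmallCancellation R) (hΔ : Δ.Taut) {d : Δ.D} {f : List Δ.D}
    (hf : f ∈ Δ.faces) (hd : d ∈ f) (he : Δ.e d ∉ Δ.outer) {m : ℕ}
    (hc : ∀ j, 1 ≤ j → j < m → ¬ Δ.Corner (Δ.next^[j] d)) : 6 * m < f.length := by
  obtain ⟨g, hg, heg⟩ := mem_faces_of_not_mem_outer he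
  have hfl : 0 < f.length := List.length_pos_of_mem hd
  have hgl : 0 < g.length := List.length_pos_of_mem heg
  have hl := List.mem_cons_of_mem Δ.outer hf
  have hl' := List.mem_cons_of_mem Δ.outer hg
  suffices 6 * m < f.length ∧ 6 * m < g.length from this.1
  induction m with
  | zero => omega
  | succ m ih =>
    specialize ih fun j hj hj' => hc j hj (by omega)
    have h1 := iter_e (d := d) (m := m + 1) fun j hj => by
      have := e_eq_next_e_next hR hΔ (d := Δ.next^[j] d)
      rw [← Function.iterate_succ_apply' Δ.next] at this
      exact this (hc (j + 1) (by omega) (by omega))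
    have h2 := Δ.read_eq_wordInv h1
    rw [Nat.add_sub_cancel] at h1 h2
    set o := Δ.e (Δ.next^[m] d) with ho
    have h3 : Δ.next^[m] o = Δ.e d := by simpa using h1 m (by omega)
    have hog : o ∈ g := mem_of_iter_mem hl' (h3 ▸ heg)
    have h4 := Δ.read_mem hR.toSymmetrized hf hd
    have h5 : Δ.next (Δ.e d) ∈ g := iter_mem hl' heg 1
    have h6 := hR.inv _ (Δ.read_mem hR.toSymmetrized hg h5)
    have h7 := read_ne_of_adjacent hR hΔ hf hg hd heg
    have h8 : Δ.read d (m + 1) <+: Δ.read d f.length := by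
      rw [show f.length = (m + 1) + (f.length - (m + 1)) by omega, Δ.read_add d (m + 1)]
      exact List.prefix_append _ _
    have h9 : Δ.read d (m + 1) <+: wordInv (Δ.read (Δ.next (Δ.e d)) g.length) := by
      rw [show g.length = (g.length - (m + 1)) + (m + 1) by omega,
        Δ.read_add _ (g.length - (m + 1)), ← h3, ← Function.iterate_succ_apply' Δ.next, ← Function.iterate_add_apply,
        show g.length - (m + 1) + m.succ = g.length by omega, iter_faces_length hl' hog, h2,
        wordInv_append, wordInv_wordInv]
      exact List.prefix_append _ _
    have h10 := hR.small _ h4 _ h6 h7 _ h8 h9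
    have h11 := hR.small _ h6 _ h4 h7.symm _ h9 h8
    simp only [length_read, length_wordInv] at h10 h11
    exact ⟨h10, h11⟩

theorem exists_exposed (hR : SmallCancellation R) (hΔ : Δ.Taut) {f : List Δ.D}
    (hf : f ∈ Δ.faces) (hwt : Δ.weight f ≤ 5) : (∀ d ∈ f, Δ.e d ∈ Δ.outer) ∨
      ∃ d ∈ f, ∃ m, 1 ≤ m ∧ m < f.length ∧ (∀ j < m, Δ.e (Δ.next^[j] d) ∈ Δ.outer) ∧
        (2 + (6 - Δ.weight f)) * f.length < 6 * m := by
  classical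
  have hl := List.mem_cons_of_mem Δ.outer hf
  have h1 : ∀ d : Δ.D, ∀ k, ¬ Δ.Corner (Δ.next^[k + 1] d) →
      (Δ.e (Δ.next^[k] d) ∈ Δ.outer ↔ Δ.e (Δ.next^[k + 1] d) ∈ Δ.outer) := by
    intro d k hc
    rw [Function.iterate_succ_apply'] at hc ⊢
    rw [e_eq_next_e_next hR hΔ hc]
    exact ⟨fun h => mem_of_iter_mem List.mem_cons_self (k := 1) h,
      fun h => iter_mem List.mem_cons_self h 1⟩
  have h2 : ∀ d ∈ f, ∀ k m, Δ.e (Δ.next^[k] d) ∉ Δ.outer → 1 ≤ m →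
      (∀ j, 1 ≤ j → j < m → ¬ Δ.Corner (Δ.next^[k + j] d)) → 6 * m < f.length := by
    intro d hd k m he _ hc
    refine arc_small hR hΔ hf (iter_mem hl hd k) he fun j hj hj' => ?_
    rw [← Function.iterate_add_apply, add_comm]
    exact hc j hj hj'
  have hW : ∀ d ∈ f, Δ.weight f =
      (Finset.filter (fun k => Δ.Corner (Δ.next^[k + 1] d)) (Finset.range f.length)).card +
      (Finset.filter (fun k => Δ.e (Δ.next^[k] d) ∈ Δ.outer ∧ Δ.Corner (Δ.next^[k + 1] d))
        (Finset.range f.length)).card := by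
    intro d hd
    rw [weight, countP_loop hl hd fun d => Δ.Corner (Δ.next d),
      countP_loop hl hd fun d => Δ.e d ∈ Δ.outer ∧ Δ.Corner (Δ.next d)]
    simp only [Function.iterate_succ_apply']
  by_contra! hcon
  obtain ⟨⟨d₀, hd₀, he₀⟩, hcon⟩ := hcon
  have hfl : 0 < f.length := List.length_pos_of_mem hd₀
  by_cases hex : ∃ k, Δ.e (Δ.next^[k] d₀) ∈ Δ.outer
  · have hk := Nat.find_spec hex
    have hk' := fun j hj => Nat.find_min hex (m := j) hj
    generalize Nat.find hex = k at hk hk'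
    have hk0 : k ≠ 0 := by rintro rfl; exact he₀ hk
    have hdf := iter_mem hl hd₀ k
    have hL : Δ.next^[f.length - 1] (Δ.next^[k] d₀) = Δ.next^[k - 1] d₀ := by
      rw [← Function.iterate_add_apply,
        show f.length - 1 + k = (k - 1) + f.length by omega, Function.iterate_add_apply,
        iter_faces_length hl hd₀]
    obtain ⟨m, hm1, hm2, hm3, hm4⟩ := exists_exposed_arc
      (c := fun j => Δ.Corner (Δ.next^[j] (Δ.next^[k] d₀)))
      (x := fun j => Δ.e (Δ.next^[j] (Δ.next^[k] d₀)) ∈ Δ.outer) (h1 _) (h2 _ hdf) hk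
      (by rwa [iter_faces_length hl hdf]) hfl (by rw [hL]; exact hk' _ (by omega))
      (by rw [← hW _ hdf]; exact hwt)
    rw [← hW _ hdf] at hm4
    have := hcon _ hdf m hm1 hm2 hm3
    omega
  · push Not at hex
    by_cases hc : ∃ k, Δ.Corner (Δ.next^[k] d₀)
    · obtain ⟨k, hk⟩ := hc
      have hdf := iter_mem hl hd₀ k
      have hx : ∀ j, Δ.e (Δ.next^[j] (Δ.next^[k] d₀)) ∉ Δ.outer := by
        intro j
        rw [← Function.iterate_add_apply]
        exact hex _
      have h3 := card_unexposed_le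
        (c := fun j => Δ.Corner (Δ.next^[j] (Δ.next^[k] d₀)))
        (x := fun j => Δ.e (Δ.next^[j] (Δ.next^[k] d₀)) ∈ Δ.outer) (h1 _) (h2 _ hdf) (by rwa [iter_faces_length hl hdf])
      have h4 := hW _ hdf
      simp only [hx, not_false_eq_true, true_and, Finset.filter_true, Finset.card_range,
        false_and, Finset.filter_false, Finset.card_empty, add_zero] at h3 h4
      rw [← h4] at h3
      have h5 : Δ.weight f * (f.length - 1) ≤ 5 * (f.length - 1) := Nat.mul_le_mul_right _ hwt
      omega
    · push Not at hc
      have := h2 d₀ hd₀ 0 f.length (hex 0) hfl fun j _ _ => hc _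
      omega

/-- A run of exposed darts of a face is opposite to a run of outer darts. -/
theorem exists_outer_run (hR : SmallCancellation R) (hΔ : Δ.Taut) {d : Δ.D} {f : List Δ.D}
    (hf : f ∈ Δ.faces) (hd : d ∈ f) {m : ℕ} (hm : 1 ≤ m) (hm' : m ≤ f.length)
    (hx : ∀ j < m, Δ.e (Δ.next^[j] d) ∈ Δ.outer) :
    ∃ o ∈ Δ.outer, ∃ X Y Z, X.length = m ∧ (X ++ Y).length = f.length ∧ X ++ Y ∈ R ∧
      Δ.read o Δ.outer.length = X ++ Z ∧ (∀ i < m, Δ.e (Δ.next^[i] o) ∈ f) ∧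
      (m = f.length → Z = []) ∧
      Area R (Δ.faces.length - 1) ((FreeGroup.mk Y)⁻¹ * FreeGroup.mk Z) := by
  have hl := List.mem_cons_of_mem Δ.outer hf
  have hlo : Δ.outer ∈ Δ.loops := List.mem_cons_self
  have h0 : ∀ j, Δ.e (Δ.next^[j] d) ∈ Δ.outer → Δ.e (Δ.next^[j + 1] d) ∈ Δ.outer →
      Δ.e (Δ.next^[j] d) = Δ.next (Δ.e (Δ.next^[j + 1] d)) := by
    intro j h h'
    apply hΔ.inj _ h _ (iter_mem hlo h' 1)
    rw [Function.iterate_one, Δ.org_next, Δ.e_e, Function.iterate_succ_apply', Δ.org_next]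
  have h1 := iter_e (d := d) (m := m) fun j hj => h0 j (hx j (by omega)) (hx _ hj)
  have ho := hx (m - 1) (by omega)
  have h2 := Δ.read_eq_wordInv h1
  set o := Δ.e (Δ.next^[m - 1] d) with ho'
  have hmN : m ≤ Δ.outer.length := by
    by_contra! h
    have h3 := h1 _ h
    rw [iter_faces_length hlo ho, ho'] at h3
    have h4 := congrArg Δ.e h3
    rw [Δ.e_e, Δ.e_e] at h4
    have hfd := Δ.loop_eq hl hd
    have := Δ.iter_inj (by rw [hfd]; omega) (by rw [hfd]; omega) h4
    have := List.length_pos_of_mem ho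
    omega
  have hmf : Δ.next^[m] d ∈ f := iter_mem hl hd m
  refine ⟨o, ho, Δ.read o m, wordInv (Δ.read (Δ.next^[m] d) (f.length - m)),
    Δ.read (Δ.next^[m] o) (Δ.outer.length - m), by simp, by simp; omega, ?_, ?_, ?_, ?_, ?_⟩
  · rw [h2, ← wordInv_append]
    apply hR.inv
    have h3 := Δ.read_mem hR.toSymmetrized hf hmf
    rw [show f.length = f.length - m + m by omega, read_add, ← Function.iterate_add_apply,
      show f.length - m + m = f.length by omega, iter_faces_length hl hd] at h3
    exact h3
  · rw [← read_add]
    congr 1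
    omega
  · intro i hi
    rw [h1 i hi, Δ.e_e]
    exact iter_mem hl hd _
  · intro hmL
    have h3 : Δ.next^[m] o = o := by
      have h4 := h0 (m - 1) ho (by
        rw [Nat.sub_add_cancel hm, hmL, iter_faces_length hl hd]; exact hx 0 (by omega))
      rw [Nat.sub_add_cancel hm, hmL, iter_faces_length hl hd, ← hmL, ← ho'] at h4
      have h5 := h1 (m - 1) (by omega)
      rw [Nat.sub_self, Function.iterate_zero_apply] at h5
      rw [show m = (m - 1) + 1 by omega, Function.iterate_succ_apply', h5, ← h4]
    rw [← List.length_eq_zero_iff, length_read]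
    by_contra hne
    have hol := Δ.loop_eq hlo ho
    have := Δ.iter_inj (d := o) (j := m) (k := 0) (by rw [hol]; omega) (by rw [hol]; omega) h3
    omega
  · have hm0 : Δ.e o = Δ.next^[m - 1] d := by rw [ho', Δ.e_e]
    have h3 := Δ.area_merge_out ho hf (by rw [hm0]; exact iter_mem hl hd _)
    rw [hm0, ← Function.iterate_succ_apply' Δ.next, show (m - 1).succ = m by omega,
      show f.length - 1 = f.length - m + (m - 1) by omega, read_add,
      ← Function.iterate_add_apply, show f.length - m + m = f.length by omega,
      iter_faces_length hl hd, show Δ.outer.length - 1 = m - 1 + (Δ.outer.length - m) by omega,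
      read_add, ← Function.iterate_succ_apply, show (m - 1).succ = m by omega,
      mk_append, mk_append] at h3
    have h4 : Δ.read (Δ.next o) (m - 1) = wordInv (Δ.read d (m - 1)) := by
      rw [show m = (m - 1) + 1 by omega, read_succ, read_add, wordInv_append] at h2
      have : Δ.read (Δ.next^[m - 1] d) 1 = [linv (Δ.lab o)] := by
        rw [ho', Δ.lab_e, linv_linv]; rfl
      rw [this] at h2
      simpa using h2
    rw [h4, mk_wordInv] at h3
    rw [mk_wordInv, inv_inv]
    convert h3 using 1
    group

end Dia
end GSC

namespace GSC

variable {S : Type} {R : Set (Word S)} {w : Word S}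

namespace Dia

variable {Δ : Dia R w}

theorem inj_of_split (h : ∀ O₁ O₂ O₃, w = O₁ ++ (O₂ ++ O₃) → O₂ ≠ [] → O₃ ≠ [] →
      ∀ i j, i + j = Δ.faces.length → Area R i (FreeGroup.mk O₂) →
      ¬ Area R j (FreeGroup.mk (O₁ ++ O₃))) :
    ∀ o ∈ Δ.outer, ∀ o' ∈ Δ.outer, Δ.org o = Δ.org o' → o = o' := by
  have key : ∀ i j (hi : i < Δ.outer.length) (hj : j < Δ.outer.length), i < j →
      Δ.org Δ.outer[i] ≠ Δ.org Δ.outer[j] := by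
    intro i j hi hj hij heq
    set O₁ := Δ.outer.take i with hO₁
    set O₂ := (Δ.outer.drop i).take (j - i) with hO₂
    set O₃ := Δ.outer.drop j with hO₃
    have h1 : Δ.outer = O₁ ++ (O₂ ++ O₃) := by
      have : O₃ = (Δ.outer.drop i).drop (j - i) := by
        rw [List.drop_drop, hO₃]; congr 1; omega
      rw [this, hO₂, List.take_append_drop, hO₁, List.take_append_drop]
    have h2 : ∃ l, O₂ = Δ.outer[i] :: l := by
      rw [hO₂, List.drop_eq_getElem_cons hi, show j - i = (j - i - 1) + 1 by omega]
      exact ⟨_, rfl⟩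
    have h3 : ∃ l, O₃ = Δ.outer[j] :: l := ⟨_, List.drop_eq_getElem_cons hj⟩
    have h4 := Δ.isPath_outer
    rw [h1] at h4
    obtain ⟨u, hu, h5⟩ := isPath_append.1 h4
    obtain ⟨v, hv, h6⟩ := isPath_append.1 h5
    obtain ⟨l, hl⟩ := h2
    obtain ⟨l', hl'⟩ := h3
    have h7 : u = v := by
      rw [hl] at hv
      rw [hl'] at h6
      rw [← hv.1, ← h6.1, heq]
    subst h7
    obtain ⟨m, k, hmk, hm, hk⟩ := Δ.split O₁ O₂ O₃ u h1 hu hv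
    refine h (O₁.map Δ.lab) (O₂.map Δ.lab) (O₃.map Δ.lab) ?_ (by simp [hl]) (by simp [hl']) m k hmk
      hm ?_
    · rw [← List.map_append, ← List.map_append, ← h1, Δ.lab_outer]
    · rwa [mk_append]
  intro o ho o' ho' heq
  obtain ⟨i, hi, rfl⟩ := List.getElem_of_mem ho
  obtain ⟨j, hj, rfl⟩ := List.getElem_of_mem ho'
  rcases lt_trichotomy i j with hij | rfl | hij
  · exact absurd heq (key i j hi hj hij)
  · rfl
  · exact absurd heq.symm (key j i hj hi hij)

open Classical in
/-- The weight of a dart induced by weights on the positions of the outer boundary. -/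
noncomputable def dartWeight (Δ : Dia R w) (t : ℕ → ℕ) (d : Δ.D) : ℕ :=
  if Δ.e d ∈ Δ.outer then t (Δ.outer.idxOf (Δ.e d)) else 0

theorem dartWeight_e_getElem (t : ℕ → ℕ) {i : ℕ} (hi : i < Δ.outer.length) :
    Δ.dartWeight t (Δ.e Δ.outer[i]) = t i := by
  classical
  rw [dartWeight, Δ.e_e, if_pos (List.getElem_mem hi),
    (Δ.nodup_of_mem_loops List.mem_cons_self).idxOf_getElem]

theorem sum_dartWeight_le (t : ℕ → ℕ) :
    (Δ.faces.map fun f => (f.map (Δ.dartWeight t)).sum).sum ≤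
      ∑ i ∈ Finset.range Δ.outer.length, t i := by
  classical
  have hn := Δ.nodup
  rw [List.nodup_append'] at hn
  have h1 : (Δ.faces.map fun f => (f.map (Δ.dartWeight t)).sum).sum =
      (Δ.faces.flatten.map (Δ.dartWeight t)).sum := by
    rw [List.map_flatten, List.sum_flatten, List.map_map]
    rfl
  have h2 : ∑ d, Δ.dartWeight t d = ∑ d, Δ.dartWeight t (Δ.e d) :=
    (Equiv.sum_comp ⟨Δ.e, Δ.e, Δ.e_e, Δ.e_e⟩ (Δ.dartWeight t)).symm
  have h3 : ∑ d, Δ.dartWeight t (Δ.e d) = ∑ d ∈ Δ.outer.toFinset, Δ.dartWeight t (Δ.e d) := by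
    symm
    apply Finset.sum_subset (Finset.subset_univ _)
    intro d _ hd
    rw [dartWeight, Δ.e_e, if_neg (by simpa using hd)]
  rw [h1, ← List.sum_toFinset _ hn.2.1]
  calc _ ≤ ∑ d, Δ.dartWeight t d := Finset.sum_le_sum_of_subset (Finset.subset_univ _)
    _ = (Δ.outer.map fun d => Δ.dartWeight t (Δ.e d)).sum := by
      rw [h2, h3, List.sum_toFinset _ hn.1]
    _ = ∑ i ∈ Finset.range Δ.outer.length, t i := by
      have : (Δ.outer.map fun d => Δ.dartWeight t (Δ.e d)) =
          (List.range Δ.outer.length).map t := by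
        apply List.ext_getElem
        · simp
        · intro i hi _
          rw [List.length_map] at hi
          simp [dartWeight_e_getElem t hi]
      rw [this]
      rfl

theorem sum_le_dartWeight (t : ℕ → ℕ) {f : List Δ.D} (hf : f ∈ Δ.faces) {b m : ℕ}
    (hb : b < Δ.outer.length) (hm : m ≤ Δ.outer.length)
    (h : ∀ i < m, Δ.e (Δ.next^[i] Δ.outer[b]) ∈ f) :
    ∑ i ∈ Finset.range m, t ((b + i) % Δ.outer.length) ≤ (f.map (Δ.dartWeight t)).sum := by
  classical
  have hlo : Δ.outer ∈ Δ.loops := List.mem_cons_self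
  have h1 : ∀ i, t ((b + i) % Δ.outer.length) =
      Δ.dartWeight t (Δ.e (Δ.next^[i] Δ.outer[b])) := by
    intro i
    rw [Δ.iter_getElem hlo hb, dartWeight_e_getElem]
  rw [← List.sum_toFinset _ (Δ.nodup_of_mem_loops (List.mem_cons_of_mem _ hf))]
  simp only [h1]
  rw [← Finset.sum_image (f := Δ.dartWeight t) (g := fun i => Δ.e (Δ.next^[i] Δ.outer[b]))]
  · apply Finset.sum_le_sum_of_subset
    intro d hd
    obtain ⟨i, hi, rfl⟩ := Finset.mem_image.1 hd
    exact List.mem_toFinset.2 (h i (Finset.mem_range.1 hi))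
  · intro i hi j hj hij
    have h2 := congrArg Δ.e hij
    simp only [Δ.e_e] at h2
    have h3 := Δ.loop_eq hlo (List.getElem_mem hb)
    simp only [Finset.coe_range, Set.mem_Iio] at hi hj
    exact Δ.iter_inj (by rw [h3]; omega) (by rw [h3]; omega) h2

end Dia

/-- Greendlinger's lemma: under small cancellation, the label of a minimal simple boundary is a
relator up to rotation, or contains a long part of a relator. Given weights on the boundary of
total at most five, the weight of that part is bounded by its relative length. -/
theorem SmallCancellation.exists_arc (hR : SmallCancellation R) (hw : CyclicallyReduced w)
    (hne : w ≠ []) {n : ℕ} (hn : Area R n (FreeGroup.mk w))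
    (hmin : ∀ k, Area R k (FreeGroup.mk w) → n ≤ k)
    (hsplit : ∀ O₁ O₂ O₃, w = O₁ ++ (O₂ ++ O₃) → O₂ ≠ [] → O₃ ≠ [] →
      ∀ i j, i + j = n → Area R i (FreeGroup.mk O₂) → ¬ Area R j (FreeGroup.mk (O₁ ++ O₃)))
    (t : ℕ → ℕ) (ht : ∑ i ∈ Finset.range w.length, t i ≤ 5) :
    (∃ k, w.rotate k ∈ R) ∨ 1 ≤ n ∧ ∃ b < w.length, ∃ X Y Z κ, w.rotate b = X ++ Z ∧ X ++ Y ∈ R ∧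
      (2 + κ) * (X ++ Y).length < 6 * X.length ∧
      Area R (n - 1) ((FreeGroup.mk Y)⁻¹ * FreeGroup.mk Z) ∧
      ∑ i ∈ Finset.range X.length, t ((b + i) % w.length) < κ := by
  obtain ⟨Δ, hΔ⟩ := hn.exists_dia hR.toSymmetrized
  have hnΔ : n = Δ.faces.length := le_antisymm
    (hmin _ (by simpa [val, Δ.lab_outer] using Δ.area)) hΔ
  subst hnΔ
  have hT : Δ.Taut := ⟨hw, hne, hmin, Dia.inj_of_split hsplit⟩
  have hlen : Δ.outer.length = w.length := by
    simpa using congrArg List.length Δ.lab_outer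
  have hsum : ∃ f ∈ Δ.faces, (f.map (Δ.dartWeight t)).sum < 6 - Δ.weight f := by
    by_contra! hcon
    have h1 := List.sum_le_sum hcon
    have h2 := Dia.six_le_sum hR hT
    have h3 := Dia.sum_dartWeight_le (Δ := Δ) t
    rw [hlen] at h3
    omega
  have hrot : ∀ b (hb : b < Δ.outer.length),
      Δ.read Δ.outer[b] Δ.outer.length = w.rotate b := by
    intro b hb
    rw [Δ.read_eq_rotate List.mem_cons_self, List.map_rotate, Δ.lab_outer]
  obtain ⟨f, hf, hfs⟩ := hsum
  rcases Dia.exists_exposed hR hT hf (by omega) with hx | ⟨d, hd, m, hm1, hm2, hx, hm3⟩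
  · left
    obtain ⟨d, hd⟩ : ∃ d, d ∈ f := by
      apply List.exists_mem_of_ne_nil
      rintro rfl
      exact hR.ne_nil _ (Δ.face_mem _ hf) rfl
    obtain ⟨o, ho, X, Y, Z, hX, hXY, hr, hread, -, hZ, -⟩ := Dia.exists_outer_run hR hT hf hd
      (List.length_pos_of_mem hd) le_rfl
      (fun j _ => hx _ (Dia.iter_mem (List.mem_cons_of_mem _ hf) hd j))
    have hY : Y = [] := by
      rw [← List.length_eq_zero_iff]
      rw [List.length_append] at hXY
      omega
    obtain ⟨b, hb, rfl⟩ := List.getElem_of_mem ho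
    rw [hrot, hZ rfl, List.append_nil] at hread
    rw [hY, List.append_nil, ← hread] at hr
    exact ⟨b, hr⟩
  · right
    obtain ⟨o, ho, X, Y, Z, hX, hXY, hr, hread, hXf, -, hA⟩ :=
      Dia.exists_outer_run hR hT hf hd hm1 hm2.le hx
    obtain ⟨b, hb, rfl⟩ := List.getElem_of_mem ho
    rw [hrot] at hread
    refine ⟨List.length_pos_of_mem hf, b, by omega, X, Y, Z, _, hread, hr, ?_, hA, lt_of_le_of_lt ?_ hfs⟩
    · rwa [hXY, hX]
    · rw [← hlen, hX]
      apply Dia.sum_le_dartWeight t hf hb _ hXf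
      have := congrArg List.length hread
      simp at this
      omega

end GSC

namespace GSC

variable {S : Type} {R : Set (Word S)}

theorem Symmetrized.of_rotate (hR : Symmetrized R) {w : Word S} {k : ℕ} (h : w.rotate k ∈ R) :
    w ∈ R := by
  rw [← List.rotate_mod] at h
  rcases w with _ | ⟨a, w⟩
  · simpa using h
  · rw [List.rotate_eq_drop_append_take (Nat.mod_lt _ (by simp)).le] at h
    simpa using hR.rot _ _ h

theorem Reduced.subword {u p : Word S} (hp : Reduced p) (h : u <:+: p) : Reduced u := by
  obtain ⟨x, y, rfl⟩ := h
  exact List.IsChain.right_of_append (List.IsChain.left_of_append hp)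

theorem CyclicallyReduced.reduced {w : Word S} (h : CyclicallyReduced w) : Reduced w :=
  Reduced.subword h (List.prefix_append w w).isInfix

theorem isInfix_wordInv {u p : Word S} (h : u <:+: p) : wordInv u <:+: wordInv p := by
  obtain ⟨x, y, rfl⟩ := h
  exact ⟨wordInv y, wordInv x, by simp⟩

theorem Reduced.wordInv {p : Word S} (h : Reduced p) : Reduced (wordInv p) := by
  unfold Reduced at h ⊢
  rw [GSC.wordInv, List.Chain', List.isChain_reverse, List.isChain_map]
  refine List.IsChain.imp ?_ h
  rintro ⟨a, x⟩ ⟨b, y⟩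
  simp only [eq_comm, Bool.not_inj_iff]
  tauto

/-- A reduced word containing no more than half of a relator. -/
def Irr (R : Set (Word S)) (p : Word S) : Prop :=
  Reduced p ∧ ∀ u, u <:+: p → ∀ r ∈ R, u <+: r → 2 * u.length ≤ r.length

theorem Irr.subword {u p : Word S} (hp : Irr R p) (h : u <:+: p) : Irr R u :=
  ⟨hp.1.subword h, fun v hv => hp.2 v (hv.trans h)⟩

theorem Irr.of_mem {p x u y : Word S} (hR : Symmetrized R) (hp : Irr R p) (hu : u <:+: p)
    (h : x ++ (u ++ y) ∈ R) : 2 * u.length ≤ x.length + u.length + y.length := by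
  have := hR.rot _ _ h
  rw [List.append_assoc] at this
  have := hp.2 u hu _ this (List.prefix_append _ _)
  simp only [List.length_append] at this
  omega

theorem Irr.wordInv {p : Word S} (hR : Symmetrized R) (hp : Irr R p) : Irr R (wordInv p) := by
  refine ⟨hp.1.wordInv, ?_⟩
  rintro u hu r hr ⟨y, rfl⟩
  have h1 := isInfix_wordInv hu
  rw [wordInv_wordInv] at h1
  have h2 := hR.inv _ hr
  rw [wordInv_append, ← List.append_nil (GSC.wordInv u)] at h2
  have := hp.of_mem hR h1 h2
  simp only [length_wordInv, List.length_nil, List.length_append] at this ⊢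
  omega

theorem Irr.nil : Irr R [] :=
  ⟨List.isChain_nil, fun u hu r _ _ => by simp [List.infix_nil.1 hu]⟩

/-- The word `c` is empty or is a short side of a relator `s c⁻¹`, and replacing `s` by `c` between
`P` and `q` decreases the area. -/
def Short (R : Set (Word S)) (P c q : Word S) : Prop :=
  c = [] ∨ ∃ s, s ++ wordInv c ∈ R ∧ 6 * c.length < s.length + c.length ∧
    ∀ n, Area R n (FreeGroup.mk P * FreeGroup.mk s * FreeGroup.mk q) →
      1 ≤ n ∧ Area R (n - 1) (FreeGroup.mk P * FreeGroup.mk c * FreeGroup.mk q)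

theorem mem_of_short (hR : Symmetrized R) {s c₁ u c₂ : Word S}
    (h : s ++ wordInv (c₁ ++ (u ++ c₂)) ∈ R) : u ++ (c₂ ++ (wordInv s ++ c₁)) ∈ R := by
  have h1 := hR.inv _ h
  rw [wordInv_append, wordInv_wordInv, List.append_assoc] at h1
  simpa using hR.rot _ _ h1

theorem Short.irr (hR : SmallCancellation R) {P c q : Word S} (h : Short R P c q) : Irr R c := by
  rcases h with rfl | ⟨s, hs, h6, -⟩
  · exact Irr.nil
  · constructor
    · have := (hR.cyc _ hs).reduced.subword (List.suffix_append s _).isInfix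
      simpa using this.wordInv
    · rintro u ⟨c₁, c₂, rfl⟩ r hr hur
      rw [List.append_assoc] at hs
      have h1 := mem_of_short hR.toSymmetrized hs
      by_cases heq : u ++ (c₂ ++ (wordInv s ++ c₁)) = r
      · rw [← heq]
        simp only [List.length_append, length_wordInv] at h6 ⊢
        omega
      · have := hR.small _ hr _ h1 (Ne.symm heq) u hur (List.prefix_append _ _)
        omega

/-- The length comparison for triples of total length less than `N`. -/
def Bound (R : Set (Word S)) (N : ℕ) : Prop :=
  ∀ P c q : Word S, P.length + c.length + q.length < N → Irr R P → Irr R q →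
    (∃ n, Area R n (FreeGroup.mk P * FreeGroup.mk c * FreeGroup.mk q)) → Short R P c q →
    P.length ≤ 3 * c.length + 3 * q.length

theorem Bound.eq_nil {N : ℕ} (hB : Bound R N) {z : Word S} (hz : Irr R z) (hN : z.length < N)
    {n : ℕ} (hn : Area R n (FreeGroup.mk z)) : z = [] := by
  have := hB z [] [] (by simpa) hz Irr.nil ⟨n, by simpa [← FreeGroup.one_eq_mk] using hn⟩ (.inl rfl)
  simpa using this

end GSC

namespace GSC

variable {S : Type} {R : Set (Word S)}

theorem Short.transfer {P c q P' c' q' : Word S} (j : ℕ) (h : Short R P c q)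
    (hc : c = [] → c' = []) (hle : c'.length ≤ c.length)
    (hs : ∀ s, s ++ wordInv c ∈ R → ∃ s', s' ++ wordInv c' ∈ R ∧
      s'.length + c'.length = s.length + c.length ∧
      ∀ m, Area R m (FreeGroup.mk P' * FreeGroup.mk s' * FreeGroup.mk q') →
        Area R (m + j) (FreeGroup.mk P * FreeGroup.mk s * FreeGroup.mk q))
    (hb : ∀ m, 1 ≤ m + j → Area R (m + j - 1) (FreeGroup.mk P * FreeGroup.mk c * FreeGroup.mk q) →
      1 ≤ m ∧ Area R (m - 1) (FreeGroup.mk P' * FreeGroup.mk c' * FreeGroup.mk q')) :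
    Short R P' c' q' := by
  rcases h with h | ⟨s, h1, h2, h3⟩
  · exact .inl (hc h)
  · obtain ⟨s', h4, h5, h6⟩ := hs s h1
    refine .inr ⟨s', h4, by omega, fun m hm => ?_⟩
    obtain ⟨h7, h8⟩ := h3 _ (h6 m hm)
    exact hb m h7 h8

theorem exists_cancel {x y : Word S} (hx : Reduced x) (hy : Reduced y) (h : ¬ Reduced (x ++ y)) :
    ∃ a x' y', x = x' ++ [a] ∧ y = linv a :: y' := by
  unfold Reduced List.Chain' at *
  rw [List.isChain_append] at h
  push Not at h
  obtain ⟨a, ha, b, hb, hab⟩ := h hx hy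
  obtain ⟨x', rfl⟩ := List.getLast?_eq_some_iff.1 ha
  obtain ⟨y', rfl⟩ := List.head?_eq_some_iff.1 hb
  refine ⟨a, x', y', rfl, ?_⟩
  by_contra hne
  have : b ≠ linv a := fun h => hne (by rw [h])
  rw [ne_linv_iff] at this
  tauto

/-- The overlap of a subword with a product of three words. -/
theorem exists_overlap {A X B P c q : Word S} (h : A ++ (X ++ B) = P ++ (c ++ q)) :
    ∃ X₁ X₂ X₃, X = X₁ ++ (X₂ ++ X₃) ∧ X₁ <:+: P ∧ X₃ <:+: q ∧
      X₁.length = min X.length (P.length - A.length) ∧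
      X₂.length = min (X.length - (P.length - A.length)) (c.length - (A.length - P.length)) ∧
      (X₂ = [] ∨ ∃ c₁ c₂, c = c₁ ++ (X₂ ++ c₂) ∧ A ++ X₁ = P ++ c₁ ∧ X₃ ++ B = c₂ ++ q) := by
  have hX : X = ((P ++ (c ++ q)).drop A.length).take X.length := by rw [← h]; simp
  have hl := congrArg List.length h
  simp only [List.length_append] at hl
  simp only [List.drop_append, List.take_append, List.length_drop] at hX
  set X₁ := (P.drop A.length).take X.length with hX₁
  set X₂ := (c.drop (A.length - P.length)).take (X.length - (P.length - A.length)) with hX₂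
  have h1 : X₁.length = min X.length (P.length - A.length) := by simp [hX₁]
  have h2 : X₂.length = min (X.length - (P.length - A.length))
    (c.length - (A.length - P.length)) := by simp [hX₂]
  set X₃ := List.take (X.length - (P.length - A.length) - (c.length - (A.length - P.length)))
    (q.drop (A.length - P.length - c.length)) with hX₃
  refine ⟨X₁, X₂, X₃, hX, ?_, ?_, h1, h2, ?_⟩
  · exact (List.take_prefix _ _).isInfix.trans (List.drop_suffix _ _).isInfix
  · exact (List.take_prefix _ _).isInfix.trans (List.drop_suffix _ _).isInfix
  · by_cases h0 : X₂ = []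
    · exact .inl h0
    · right
      have h0' := List.length_pos_iff.2 h0
      have hc : c = c.take (A.length - P.length) ++ (X₂ ++ (c.drop (A.length - P.length)).drop
          (X.length - (P.length - A.length))) := by
        rw [hX₂, List.take_append_drop, List.take_append_drop]
      refine ⟨_, _, hc, ?_⟩
      generalize hc₁ : c.take (A.length - P.length) = c₁ at hc ⊢
      generalize (c.drop (A.length - P.length)).drop (X.length - (P.length - A.length)) = c₂ at hc ⊢
      have hl₁ : c₁.length = min (A.length - P.length) c.length := by simp [← hc₁]
      rw [hX] at h
      rw [hc] at h
      have h' : (A ++ X₁) ++ (X₂ ++ (X₃ ++ B)) = (P ++ c₁) ++ (X₂ ++ (c₂ ++ q)) := by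
        simpa using h
      obtain ⟨e1, e2⟩ := List.append_inj h' (by simp only [List.length_append]; omega)
      exact ⟨e1, List.append_cancel_left e2⟩

end GSC

namespace GSC

variable {S : Type} {R : Set (Word S)}

theorem Bound.of_not_reduced (hR : SmallCancellation R) {P c q : Word S}
    (hB : Bound R (P.length + c.length + q.length)) (hP : Irr R P) (hq : Irr R q) {n : ℕ}
    (hn : Area R n (FreeGroup.mk P * FreeGroup.mk c * FreeGroup.mk q)) (hc : Short R P c q)
    (hr : ¬ CyclicallyReduced (P ++ (c ++ q))) :
    P.length ≤ 3 * c.length + 3 * q.length := by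
  have hS := hR.toSymmetrized
  by_cases h1 : Reduced (c ++ q)
  swap
  · obtain ⟨a, c, q, rfl, rfl⟩ := exists_cancel (hc.irr hR).1 hq.1 h1
    have := hB P c q (by simp; omega) hP (hq.subword (List.suffix_cons _ _).isInfix)
      ⟨n, by
        convert hn using 1
        rw [mk_append, mk_cons (linv a), mk_linv]; group⟩
      (hc.transfer 0 (by simp) (by simp) (by
        intro s hs
        refine ⟨s ++ [linv a], by simpa using hs, by simp; omega, fun m hm => ?_⟩
        rw [Nat.add_zero]
        convert hm using 1
        rw [mk_append, mk_cons (linv a), mk_linv]; group) (by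
        intro m hm h
        refine ⟨hm, ?_⟩
        rw [Nat.add_zero] at h
        convert h using 1
        rw [mk_append, mk_cons (linv a), mk_linv]; group))
    simp only [List.length_append, List.length_cons, List.length_nil]
    omega
  by_cases h2 : Reduced (P ++ (c ++ q))
  swap
  · obtain ⟨a, P, y, rfl, hy⟩ := exists_cancel hP.1 h1 h2
    rcases c with _ | ⟨b, c⟩
    · simp only [List.nil_append] at hy
      subst hy
      have := hB P [] y (by simp; omega) (hP.subword (List.prefix_append _ _).isInfix)
        (hq.subword (List.suffix_cons _ _).isInfix)
        ⟨n, by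
          convert hn using 1
          rw [mk_append, mk_cons (linv a), mk_linv, ← FreeGroup.one_eq_mk]; group⟩ (.inl rfl)
      simp only [List.length_append, List.length_cons, List.length_nil] at this ⊢
      omega
    · simp only [List.cons_append, List.cons.injEq] at hy
      obtain ⟨rfl, rfl⟩ := hy
      have := hB P c q (by simp; omega) (hP.subword (List.prefix_append _ _).isInfix) hq
        ⟨n, by
          convert hn using 1
          rw [mk_append, mk_cons (linv a), mk_linv]; group⟩
        (hc.transfer 0 (by simp) (by simp) (by
          intro s hs
          have hs' := hS.rot (s ++ wordInv c) [a] (by simpa using hs)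
          refine ⟨a :: s, by simpa using hs', by simp; omega, fun m hm => ?_⟩
          rw [Nat.add_zero]
          convert hm using 1
          rw [mk_append, mk_cons a s]; group) (by
          intro m hm h
          refine ⟨hm, ?_⟩
          rw [Nat.add_zero] at h
          convert h using 1
          rw [mk_append, mk_cons (linv a), mk_linv]; group))
      simp only [List.length_append, List.length_cons, List.length_nil]
      omega
  obtain ⟨a, x, y, hx, hy⟩ := exists_cancel h2 h2 hr
  rcases P with _ | ⟨b, P⟩
  · simp
  simp only [List.cons_append, List.cons.injEq] at hy
  obtain ⟨rfl, rfl⟩ := hy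
  have hP' := hP.subword (List.suffix_cons (linv a) P).isInfix
  rcases q.eq_nil_or_concat' with rfl | ⟨q, b, rfl⟩
  · rcases c.eq_nil_or_concat' with rfl | ⟨c, b, rfl⟩
    · exfalso
      simp only [List.append_nil] at hx
      rcases P.eq_nil_or_concat' with rfl | ⟨P, b, rfl⟩
      · have := congrArg List.getLast? hx
        simp [linv_ne] at this
      · rw [← List.cons_append] at hx
        obtain ⟨-, hb⟩ := List.append_inj' hx rfl
        simp only [List.cons.injEq, and_true] at hb
        subst hb
        have h0 : P = [] := by
          apply hB.eq_nil (hP'.subword (List.prefix_append _ _).isInfix) (by simp) (n := n)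
          rw [← Area.conj_iff (FreeGroup.mk [b])⁻¹]
          convert hn using 1
          rw [mk_cons (linv b), mk_linv, mk_append, ← FreeGroup.one_eq_mk]
          simp [mul_assoc, -FreeGroup.mul_mk]
        subst h0
        have := hP.1
        simp [Reduced, List.Chain', linv] at this
    · rw [List.append_nil, ← List.append_assoc] at hx
      obtain rfl : b = a := by simpa using (List.append_inj' hx rfl).2
      rename' b => a
      have := hB P c [] (by simp; omega) hP' Irr.nil
        ⟨n, by
          rw [← Area.conj_iff (FreeGroup.mk [a])⁻¹]
          convert hn using 1
          rw [mk_append, mk_cons (linv a), mk_linv, ← FreeGroup.one_eq_mk]; group⟩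
        (hc.transfer 0 (by simp) (by simp) (by
          intro s hs
          refine ⟨s ++ [linv a], by simpa using hs, by simp; omega, fun m hm => ?_⟩
          rw [Nat.add_zero]
          rw [← Area.conj_iff (FreeGroup.mk [a])]
          convert hm using 1
          rw [mk_append, mk_cons (linv a) P, mk_linv, ← FreeGroup.one_eq_mk]; group) (by
          intro m hm h
          refine ⟨hm, ?_⟩
          rw [Nat.add_zero] at h
          rw [← Area.conj_iff (FreeGroup.mk [a])⁻¹]
          convert h using 1
          rw [mk_append, mk_cons (linv a), mk_linv, ← FreeGroup.one_eq_mk]; group))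
      simp only [List.length_append, List.length_cons, List.length_nil] at this ⊢
      omega
  · rw [← List.append_assoc, ← List.append_assoc] at hx
    obtain rfl : b = a := by simpa using (List.append_inj' hx rfl).2
    rename' b => a
    have := hB P c q (by simp; omega) hP' (hq.subword (List.prefix_append _ _).isInfix)
      ⟨n, by
        rw [← Area.conj_iff (FreeGroup.mk [a])⁻¹]
        convert hn using 1
        rw [mk_append, mk_cons (linv a), mk_linv]; group⟩
      (hc.transfer 0 id le_rfl (by
        intro s hs
        refine ⟨s, hs, rfl, fun m hm => ?_⟩
        rw [Nat.add_zero]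
        rw [← Area.conj_iff (FreeGroup.mk [a])]
        convert hm using 1
        rw [mk_append, mk_cons (linv a) P, mk_linv]; group) (by
        intro m hm h
        refine ⟨hm, ?_⟩
        rw [Nat.add_zero] at h
        rw [← Area.conj_iff (FreeGroup.mk [a])⁻¹]
        convert h using 1
        rw [mk_append, mk_cons (linv a), mk_linv]; group))
    simp only [List.length_append, List.length_cons, List.length_nil]
    omega

theorem Bound.of_split (hR : SmallCancellation R) {P c q : Word S}
    (hB : Bound R (P.length + c.length + q.length)) (hP : Irr R P) (hq : Irr R q) {n : ℕ}
    (hmin : ∀ k, Area R k (FreeGroup.mk P * FreeGroup.mk c * FreeGroup.mk q) → n ≤ k)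
    (hc : Short R P c q) {O₁ O₂ O₃ : Word S} (h : P ++ (c ++ q) = O₁ ++ (O₂ ++ O₃))
    (h2 : O₂ ≠ []) (h3 : O₃ ≠ []) {i j : ℕ} (hij : i + j = n) (hi : Area R i (FreeGroup.mk O₂))
    (hj : Area R j (FreeGroup.mk (O₁ ++ O₃))) :
    P.length ≤ 3 * c.length + 3 * q.length := by
  have hS := hR.toSymmetrized
  have hl := congrArg List.length h
  simp only [List.length_append] at hl
  have l2 := List.length_pos_iff.2 h2
  have l3 := List.length_pos_iff.2 h3
  have key : ¬ Irr R O₂ := fun hO => h2 (hB.eq_nil hO (by omega) hi)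
  rcases List.append_eq_append_iff.1 h.symm with ⟨as, rfl, h'⟩ | ⟨bs, rfl, h'⟩
  · rcases List.append_eq_append_iff.1 h' with ⟨x, rfl, -⟩ | ⟨bs, rfl, h''⟩
    · exact absurd (hP.subword (by simp [List.infix_append'])) key
    · rcases List.append_eq_append_iff.1 h''.symm with ⟨y, rfl, rfl⟩ | ⟨y, rfl, rfl⟩
      · simp only [List.length_append] at hB hl l2 l3 ⊢
        have hi' : Area R i (FreeGroup.mk as * FreeGroup.mk bs * FreeGroup.mk []) := by
          rw [← mk_append, ← mk_append, List.append_nil]; exact hi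
        have hj' : Area R j (FreeGroup.mk O₁ * FreeGroup.mk y * FreeGroup.mk q) := by
          rw [← mk_append, ← mk_append, List.append_assoc]; exact hj
        have b1 := hB as bs [] (by simp; omega) (hP.subword (List.suffix_append _ _).isInfix) Irr.nil
          ⟨i, hi'⟩
          (hc.transfer j (by simp +contextual) (by simp) (by
            intro s hs
            refine ⟨s ++ wordInv y, by simpa using hs, by simp; omega, fun m hm => ?_⟩
            have := Area.insert (x := FreeGroup.mk O₁) (y := FreeGroup.mk y * FreeGroup.mk q)
              (by rwa [← mul_assoc]) hm (k := m + j) (by omega)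
            convert this using 1
            simp only [mk_append s, mk_append O₁, mk_wordInv, ← FreeGroup.one_eq_mk]
            group) (by
            intro m hm h
            have := hmin _ h
            exact ⟨by omega, hi'.mono (by omega)⟩))
        have b2 := hB O₁ y q (by omega) (hP.subword (List.prefix_append _ _).isInfix) hq ⟨j, hj'⟩
          (hc.transfer i (by simp +contextual) (by simp) (by
            intro s hs
            refine ⟨wordInv bs ++ s, ?_, by simp; omega, fun m hm => ?_⟩
            · have := hS.rot (s ++ wordInv y) (wordInv bs) (by simpa using hs)
              simpa using this
            have := Area.insert (x := FreeGroup.mk O₁)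
              (y := FreeGroup.mk (wordInv bs ++ s) * FreeGroup.mk q)
              (by rwa [← mul_assoc]) hi' (k := m + i) (by omega)
            convert this using 1
            simp only [mk_append _ s, mk_append O₁, mk_wordInv, ← FreeGroup.one_eq_mk]
            group) (by
            intro m hm h
            have := hmin _ h
            exact ⟨by omega, hj'.mono (by omega)⟩))
        simp only [List.length_nil] at b1
        omega
      · simp only [List.length_append] at hB hl l2 l3 ⊢
        have hi' : Area R i (FreeGroup.mk as * FreeGroup.mk c * FreeGroup.mk y) := by
          rw [← mk_append, ← mk_append, List.append_assoc]; exact hi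
        have hj' : Area R j (FreeGroup.mk O₁ * FreeGroup.mk [] * FreeGroup.mk O₃) := by
          rw [← mk_append, ← mk_append, List.append_nil]; exact hj
        have b1 := hB as c y (by omega) (hP.subword (List.suffix_append _ _).isInfix)
          (hq.subword (List.prefix_append _ _).isInfix) ⟨i, hi'⟩
          (hc.transfer j id le_rfl (by
            intro s hs
            refine ⟨s, hs, rfl, fun m hm => ?_⟩
            have := Area.insert (x := FreeGroup.mk O₁) (y := FreeGroup.mk [] * FreeGroup.mk O₃)
              (by rwa [← mul_assoc]) hm (k := m + j) (by omega)
            convert this using 1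
            simp only [mk_append O₁, mk_append y, ← FreeGroup.one_eq_mk]
            group) (by
            intro m hm h
            have := hmin _ h
            exact ⟨by omega, hi'.mono (by omega)⟩))
        have b2 := hB O₁ [] O₃ (by simp; omega) (hP.subword (List.prefix_append _ _).isInfix)
          (hq.subword (List.suffix_append _ _).isInfix) ⟨j, hj'⟩ (.inl rfl)
        simp only [List.length_nil] at b2
        omega
  · rcases List.append_eq_append_iff.1 h'.symm with ⟨x, rfl, hx⟩ | ⟨y, rfl, rfl⟩
    · rcases List.append_eq_append_iff.1 hx with ⟨z, rfl, -⟩ | ⟨z, rfl, rfl⟩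
      · exact absurd ((hc.irr hR).subword (by simp [List.infix_append'])) key
      · simp only [List.length_append] at hB hl l2 l3 ⊢
        have hj' : Area R j (FreeGroup.mk P * FreeGroup.mk bs * FreeGroup.mk O₃) := by
          rw [← mk_append, ← mk_append]; exact hj
        have b2 := hB P bs O₃ (by omega) hP (hq.subword (List.suffix_append _ _).isInfix) ⟨j, hj'⟩
          (hc.transfer i (by simp +contextual) (by simp) (by
            intro s hs
            refine ⟨s ++ wordInv x, by simpa using hs, by simp; omega, fun m hm => ?_⟩
            have := Area.insert hm hi (k := m + i) (by omega)
            convert this using 1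
            simp only [mk_append s, mk_append z, mk_append x, mk_wordInv]
            group) (by
            intro m hm h
            have := hmin _ h
            exact ⟨by omega, hj'.mono (by omega)⟩))
        omega
    · exact absurd (hq.subword ⟨y, O₃, by simp⟩) key

end GSC

namespace GSC

variable {S : Type} {R : Set (Word S)}

theorem exists_of_rotate {w X Z : Word S} {b : ℕ} (h : w.rotate b = X ++ Z)
    (hb : b + X.length ≤ w.length) : ∃ A B, A.length = b ∧ w = A ++ (X ++ B) ∧ Z = B ++ A := by
  rw [List.rotate_eq_drop_append_take (by omega)] at h
  rcases List.append_eq_append_iff.1 h with ⟨y, rfl, h'⟩ | ⟨B, h1, rfl⟩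
  · have : y = [] := by
      have := hb
      simp only [List.length_append, List.length_drop] at this
      exact List.eq_nil_of_length_eq_zero (by omega)
    subst this
    exact ⟨w.take b, [], by simp; omega, by simp, by simpa using h'.symm⟩
  · exact ⟨w.take b, B, by simp; omega, by rw [← h1, List.take_append_drop], rfl⟩

theorem Short.overlap_lt (hR : SmallCancellation R) {P c q : Word S} (hc : Short R P c q) {n : ℕ}
    (hmin : ∀ k, Area R k (FreeGroup.mk P * FreeGroup.mk c * FreeGroup.mk q) → n ≤ k)
    {A B Y X₁ X₂ X₃ : Word S} (hr : X₁ ++ (X₂ ++ X₃) ++ Y ∈ R) (hn : 1 ≤ n)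
    (hY : Area R (n - 1) ((FreeGroup.mk Y)⁻¹ * FreeGroup.mk (B ++ A)))
    (h : X₂ = [] ∨ ∃ c₁ c₂, c = c₁ ++ (X₂ ++ c₂) ∧ A ++ X₁ = P ++ c₁ ∧ X₃ ++ B = c₂ ++ q) :
    6 * X₂.length < (X₁ ++ (X₂ ++ X₃) ++ Y).length := by
  by_cases h0 : X₂ = []
  · have := List.length_pos_iff.2 (hR.ne_nil _ hr)
    simpa [h0] using this
  obtain ⟨c₁, c₂, rfl, h1, h2⟩ := h.resolve_left h0
  rcases hc with hc | ⟨s, hs, -, hA⟩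
  · simp [h0] at hc
  have e1 := mem_of_short hR.toSymmetrized hs
  have e2 := hR.rot X₁ (X₂ ++ (X₃ ++ Y)) (by simpa using hr)
  rw [List.append_assoc, List.append_assoc] at e2
  by_cases heq : X₂ ++ (X₃ ++ (Y ++ X₁)) = X₂ ++ (c₂ ++ (wordInv s ++ c₁))
  · exfalso
    have h3 := congrArg FreeGroup.mk (List.append_cancel_left heq)
    replace h1 := congrArg FreeGroup.mk h1
    replace h2 := congrArg FreeGroup.mk h2
    simp only [mk_append, mk_wordInv] at h1 h2 h3 hY
    have h4 : FreeGroup.mk P = FreeGroup.mk A * FreeGroup.mk X₁ * (FreeGroup.mk c₁)⁻¹ :=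
      eq_mul_inv_of_mul_eq h1.symm
    have h5 : FreeGroup.mk q = (FreeGroup.mk c₂)⁻¹ * (FreeGroup.mk X₃ * FreeGroup.mk B) :=
      eq_inv_mul_of_mul_eq h2.symm
    have h6 : FreeGroup.mk s = FreeGroup.mk c₁ *
        (FreeGroup.mk X₃ * (FreeGroup.mk Y * FreeGroup.mk X₁))⁻¹ * FreeGroup.mk c₂ := by
      rw [h3]; group
    obtain ⟨h7, h8⟩ := hA (n - 1) (by
      rw [← Area.conj_iff (FreeGroup.mk A)⁻¹, h4, h5, h6]
      convert hY using 1
      group)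
    have := hmin _ h8
    omega
  · have := hR.small _ e2 _ e1 heq X₂ (List.prefix_append _ _) (List.prefix_append _ _)
    simp only [List.length_append] at this ⊢
    omega

theorem Bound.of_arc (hR : SmallCancellation R) {P c q : Word S} (hP : Irr R P) (hq : Irr R q)
    (hB : Bound R (P.length + c.length + q.length)) (h0 : P ≠ []) {n : ℕ}
    (hmin : ∀ k, Area R k (FreeGroup.mk P * FreeGroup.mk c * FreeGroup.mk q) → n ≤ k)
    (hc : Short R P c q) {A B X Y : Word S} (hw : A ++ (X ++ B) = P ++ (c ++ q))
    {κ : ℕ} (hr : X ++ Y ∈ R) (hκ : (2 + κ) * (X ++ Y).length < 6 * X.length) (hn : 1 ≤ n)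
    (hY : Area R (n - 1) ((FreeGroup.mk Y)⁻¹ * FreeGroup.mk (B ++ A))) (h1 : 1 ≤ κ)
    (h2 : A.length ≤ P.length → P.length < A.length + X.length → 2 ≤ κ)
    (h3 : A.length ≤ P.length + c.length → P.length + c.length < A.length + X.length → 2 ≤ κ)
    (h4 : A.length ≤ P.length → P.length + c.length < A.length + X.length → 3 ≤ κ) :
    P.length ≤ 3 * c.length + 3 * q.length := by
  have hS := hR.toSymmetrized
  have hl := congrArg List.length hw
  obtain ⟨X₁, X₂, X₃, rfl, o1, o3, l1, l2, o2⟩ := exists_overlap hw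
  have b1 := hP.of_mem hS o1 (x := []) (y := X₂ ++ (X₃ ++ Y)) (by simpa using hr)
  have b3 := hq.of_mem hS o3 (x := X₁ ++ X₂) (y := Y) (by simpa using hr)
  have b2 := hc.overlap_lt hR hmin hr hn hY o2
  have hκ' : ∀ j, j ≤ κ → (2 + j) * (X₁ ++ (X₂ ++ X₃) ++ Y).length <
      6 * (X₁ ++ (X₂ ++ X₃)).length := fun j hj =>
    lt_of_le_of_lt (Nat.mul_le_mul_right _ (by omega)) hκ
  have k1 := hκ' 1 h1
  have k2 := fun h h' => hκ' 2 (h2 h h')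
  have k3 := fun h h' => hκ' 2 (h3 h h')
  have k4 := fun h h' => hκ' 3 (h4 h h')
  clear hκ' hκ h1 h2 h3 h4
  simp only [List.length_append, List.length_nil] at *
  have hcross : A.length ≤ P.length ∧
      P.length + c.length < A.length + (X₁.length + (X₂.length + X₃.length)) := by
    clear hmin hc hY hr hw o1 o2 o3 hP hq hB hS hR
    omega
  have k5 := k4 hcross.1 hcross.2
  have hw' : A ++ X₁ ++ (X₂ ++ (X₃ ++ B)) = P ++ (c ++ q) := by simpa using hw
  obtain ⟨rfl, hw₂⟩ := List.append_inj hw' (by simp only [List.length_append]; omega)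
  obtain ⟨rfl, rfl⟩ := List.append_inj hw₂ (by simp at hcross l1 l2 ⊢; omega)
  simp only [List.length_append] at *
  have := hB A (wordInv Y) B (by simp; omega) (hP.subword (List.prefix_append _ _).isInfix)
    (hq.subword (List.suffix_append _ _).isInfix)
    ⟨n - 1, by
      rw [← Area.conj_iff (FreeGroup.mk A)⁻¹]
      convert hY using 1
      simp only [mk_append, mk_wordInv]
      group⟩ (by
      refine .inr ⟨X₁ ++ (X₂ ++ X₃), by simpa using hr, by simp; omega, fun m hm => ?_⟩
      have : n ≤ m := hmin m (by
        convert hm using 1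
        simp only [mk_append]
        group)
      refine ⟨by omega, Area.mono ?_ (Nat.sub_le_sub_right this 1)⟩
      rw [← Area.conj_iff (FreeGroup.mk A)⁻¹]
      convert hY using 1
      simp only [mk_append, mk_wordInv]
      group)
  simp only [length_wordInv] at this
  omega

theorem SmallCancellation.bound (hR : SmallCancellation R) (N : ℕ) : Bound R N := by
  induction N with
  | zero => intro P c q h; omega
  | succ N ih =>
    intro P c q hN hP hq hn hc
    have hS := hR.toSymmetrized
    have hB : Bound R (P.length + c.length + q.length) := fun P' c' q' h' => ih P' c' q' (by omega)
    by_cases h0 : P = []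
    · simp [h0]
    classical
    obtain ⟨hn', hmin⟩ : Area R (Nat.find hn) _ ∧ ∀ k, Area R k _ → Nat.find hn ≤ k :=
      ⟨Nat.find_spec hn, fun k hk => Nat.find_min' hn hk⟩
    generalize Nat.find hn = n at hn' hmin
    by_cases hr : CyclicallyReduced (P ++ (c ++ q))
    swap
    · exact hB.of_not_reduced hR hP hq hn' hc hr
    by_contra hcon
    have hmk : FreeGroup.mk (P ++ (c ++ q)) = FreeGroup.mk P * FreeGroup.mk c * FreeGroup.mk q := by
      rw [mk_append, mk_append, mul_assoc]
    let t : ℕ → ℕ := fun i => (if i = 0 then 3 else 0) + (if i = P.length then 1 else 0) +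
      (if i = P.length + c.length then 1 else 0)
    rcases hR.exists_arc hr (by simp [h0]) (hmk ▸ hn') (hmk ▸ hmin)
      (fun O₁ O₂ O₃ h h2 h3 i j hij hi hj =>
        hcon (hB.of_split hR hP hq hmin hc h h2 h3 hij hi hj)) t (by
        simp only [t, Finset.sum_add_distrib, Finset.sum_ite_eq']
        split_ifs <;> omega) with ⟨k, hk⟩ | ⟨hn1, b, hb, X, Y, Z, κ, hX, hr', hκ, hY, ht⟩
    · have hw := hS.of_rotate hk
      have := hP.of_mem hS (x := []) List.infix_rfl hw
      simp only [List.length_append, List.length_nil] at this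
      omega
    · simp only [t, Finset.sum_add_distrib] at ht
      have hsum : ∀ v j, b ≤ j → j < b + X.length →
          v ≤ ∑ i ∈ Finset.range X.length,
            if (b + i) % (P ++ (c ++ q)).length = j % (P ++ (c ++ q)).length then v else 0 := by
        intro v j hj hj'
        refine le_trans ?_ (Finset.single_le_sum (fun _ _ => Nat.zero_le _)
          (Finset.mem_range.2 (show j - b < X.length by omega)))
        rw [Nat.add_sub_cancel' hj]
        simp
      have hκ4 : κ ≤ 3 := by
        by_contra h
        have := Nat.mul_le_mul_right (X ++ Y).length (show 6 ≤ 2 + κ by omega)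
        simp only [List.length_append] at this hκ
        omega
      have hbX : b + X.length ≤ (P ++ (c ++ q)).length := by
        by_contra h
        have := hsum 3 (P ++ (c ++ q)).length hb.le (by omega)
        rw [Nat.mod_self] at this
        omega
      obtain ⟨A, B, rfl, hw, rfl⟩ := exists_of_rotate hX hbX
      replace hsum : ∀ j, A.length ≤ j → j < A.length + X.length →
          1 ≤ ∑ i ∈ Finset.range X.length,
            if (A.length + i) % (P ++ (c ++ q)).length = j then 1 else 0 := by
        intro j hj hj'
        have := hsum 1 j hj hj'
        rwa [Nat.mod_eq_of_lt (a := j) (by omega)] at this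
      refine hcon (hB.of_arc hR hP hq h0 hmin hc hw.symm hr' hκ hn1 hY (by omega) ?_ ?_ ?_)
      · intro g g'
        have := hsum _ g g'
        omega
      · intro g g'
        have := hsum _ g g'
        omega
      · intro g g'
        have := hsum P.length g (by omega)
        have := hsum _ (by omega) g'
        omega

end GSC

namespace GSC

variable {S : Type} {R : Set (Word S)}

theorem exists_inv_pair {p : Word S} (h : ¬ Reduced p) : ∃ x a y, p = x ++ (a :: linv a :: y) := by
  induction p with
  | nil => exact absurd List.isChain_nil h
  | cons a p ih =>
    by_cases hp : Reduced p
    · obtain ⟨b, x, y, h1, rfl⟩ := exists_cancel (x := [a]) (List.isChain_singleton a) hp h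
      obtain ⟨rfl, rfl⟩ : x = [] ∧ a = b := by
        rcases x with _ | ⟨d, x⟩ <;> simp at h1
        exact ⟨rfl, h1⟩
      exact ⟨[], a, y, rfl⟩
    · obtain ⟨x, b, y, rfl⟩ := ih hp
      exact ⟨a :: x, b, y, rfl⟩

theorem Reduced.ne_linv {p : Word S} (h : Reduced p) {x y : Word S} {a b : S × Bool}
    (hp : p = x ++ (a :: b :: y)) : b ≠ linv a := by
  have h1 : Reduced [a, b] := h.subword ⟨x, y, by simp [hp]⟩
  rw [ne_linv_iff]
  exact (List.isChain_pair (R := fun a b : S × Bool => a.1 ≠ b.1 ∨ a.2 = b.2)).1 h1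

/-- The `N`-th power of a word. -/
def wpow (w : Word S) (N : ℕ) : Word S := (List.replicate N w).flatten

@[simp] theorem wpow_zero (w : Word S) : wpow w 0 = [] := rfl

theorem wpow_succ (w : Word S) (N : ℕ) : wpow w (N + 1) = w ++ wpow w N := by
  simp [wpow, List.replicate_succ]

@[simp] theorem length_wpow (w : Word S) (N : ℕ) : (wpow w N).length = N * w.length := by
  induction N with
  | zero => simp
  | succ N ih => rw [wpow_succ, List.length_append, ih]; ring

theorem mk_wpow (w : Word S) (N : ℕ) : FreeGroup.mk (wpow w N) = FreeGroup.mk w ^ N := by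
  induction N with
  | zero => rfl
  | succ N ih => rw [wpow_succ, mk_append, ih, pow_succ']

theorem wpow_append_self (w : Word S) (N : ℕ) : w ++ wpow w N = wpow w N ++ w := by
  induction N with
  | zero => simp
  | succ N ih => rw [wpow_succ, List.append_assoc, ← ih]

theorem wpow_rotate (x y : Word S) (N : ℕ) : x ++ wpow (y ++ x) N = wpow (x ++ y) N ++ x := by
  induction N with
  | zero => simp
  | succ N ih => rw [wpow_succ, wpow_succ, List.append_assoc, List.append_assoc, ih]; simp

theorem wpow_comm {u v : Word S} (h : u ++ v = v ++ u) : wpow u v.length = wpow v u.length := by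
  have key : ∀ w : Word S, ∀ N, FreeMonoid.toList (FreeMonoid.ofList w ^ N) = wpow w N := by
    intro w N
    induction N with
    | zero => rfl
    | succ N ih => rw [pow_succ', FreeMonoid.toList_mul, ih, wpow_succ]; rfl
  have hc : Commute (FreeMonoid.ofList u) (FreeMonoid.ofList v) := h
  have := congrArg FreeMonoid.toList (hc.pow_pow v.length u.length).eq
  rw [FreeMonoid.toList_mul, FreeMonoid.toList_mul, key, key] at this
  exact (List.append_inj this (by simp [mul_comm])).1

theorem CyclicallyReduced.wpow {w : Word S} (h : CyclicallyReduced w) (N : ℕ) :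
    Reduced (wpow w N) := by
  induction N with
  | zero => exact List.isChain_nil
  | succ N ih =>
    by_contra hcon
    rw [wpow_succ] at hcon
    obtain ⟨a, x, y, rfl, h2⟩ := exists_cancel h.reduced ih hcon
    rcases N with _ | N
    · simp at h2
    · rw [wpow_succ] at h2
      obtain ⟨z, hz⟩ : ∃ z, x ++ [a] = linv a :: z := by
        rcases x with _ | ⟨b, x⟩
        · exact (linv_ne a (List.cons.inj h2).1.symm).elim
        · simp only [List.cons_append, List.cons.injEq] at h2 ⊢
          exact ⟨_, h2.1, rfl⟩
      refine Reduced.ne_linv h (x := x) (a := a) (b := linv a) (y := z) ?_ rfl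
      nth_rw 2 [hz]
      simp

section Quotient

variable {G : Type*} [Group G] {φ : FreeGroup S →* G}

theorem Irr.of_minimal {p : Word S} (hφ : ∀ r ∈ R, φ (FreeGroup.mk r) = 1)
    (h : ∀ q, φ (FreeGroup.mk q) = φ (FreeGroup.mk p) → p.length ≤ q.length) : Irr R p := by
  constructor
  · by_contra hr
    obtain ⟨x, a, y, rfl⟩ := exists_inv_pair hr
    have := h (x ++ y) (by
      congr 1
      rw [mk_append, mk_append, mk_cons a, mk_cons (linv a), mk_linv]
      group)
    simp at this
  · rintro u ⟨x, y, rfl⟩ r hr ⟨z, rfl⟩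
    have h1 := hφ _ hr
    rw [mk_append, map_mul] at h1
    have := h (x ++ (GSC.wordInv z ++ y)) (by
      simp only [mk_append, mk_wordInv, map_mul, map_inv, eq_inv_of_mul_eq_one_left h1]
      group)
    simp only [List.length_append, length_wordInv] at this ⊢
    omega

theorem SmallCancellation.length_le (hR : SmallCancellation R)
    (hφ : ∀ g, φ g = 1 ↔ ∃ n, Area R n g) {p q : Word S} (hp : Irr R p)
    (h : φ (FreeGroup.mk p) = φ (FreeGroup.mk q)) : p.length ≤ 3 * q.length := by
  classical
  have hex : ∃ n, ∃ q' : Word S, q'.length = n ∧ φ (FreeGroup.mk q') = φ (FreeGroup.mk q) :=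
    ⟨_, q, rfl, rfl⟩
  obtain ⟨q', hl, hq'⟩ := Nat.find_spec hex
  have hmin : ∀ z, φ (FreeGroup.mk z) = φ (FreeGroup.mk q') → q'.length ≤ z.length := fun z hz =>
    hl ▸ Nat.find_min' hex ⟨z, rfl, hz.trans hq'⟩
  have := hR.bound _ (wordInv p) [] q' (Nat.lt_succ_self _) (hp.wordInv hR.toSymmetrized)
    (Irr.of_minimal (fun r hr => (hφ _).2 ⟨1, .of_rel hr⟩) hmin)
    ((hφ _).1 (by simp [mk_wordInv, ← FreeGroup.one_eq_mk, h, hq', -FreeGroup.mul_mk,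
      -FreeGroup.inv_mk])) (.inl rfl)
  have h2 := hmin q hq'.symm
  simp only [length_wordInv, List.length_nil] at this
  omega

theorem SmallCancellation.le_of_irr_wpow (hR : SmallCancellation R)
    (hφ : ∀ g, φ g = 1 ↔ ∃ n, Area R n g) (hs : Function.Surjective φ) {x : G} {v : Word S} {k : ℕ}
    (hv : IsConj (x ^ k) (φ (FreeGroup.mk v))) (hirr : ∀ N, Irr R (wpow v N)) {n : ℕ} {q : Word S}
    (hq : φ (FreeGroup.mk q) = x ^ n) : n * v.length ≤ 3 * (k * q.length) := by
  obtain ⟨g, hg⟩ := isConj_iff.1 hv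
  obtain ⟨⟨h⟩, rfl⟩ := hs g
  change φ (FreeGroup.mk h) * x ^ k * (φ (FreeGroup.mk h))⁻¹ = _ at hg
  by_contra! hlt
  have key : ∀ N, n * N * v.length ≤ 3 * (2 * h.length + k * N * q.length) := by
    intro N
    have := hR.length_le hφ (hirr (n * N)) (q := h ++ (wpow q (k * N) ++ wordInv h)) (by
      rw [mk_wpow, mk_append, mk_append, mk_wpow, mk_wordInv]
      simp only [map_mul, map_pow, map_inv, hq, ← hg, conj_pow]
      rw [← pow_mul, ← pow_mul, mul_assoc]
      congr 3
      ring)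
    simp only [length_wpow, List.length_append, length_wordInv] at this
    linarith
  have := key (6 * h.length + 1)
  nlinarith

/-- `Minl φ x w`: the word `w` has minimal length among those representing conjugates of `x`. -/
def Minl (φ : FreeGroup S →* G) (x : G) (w : Word S) : Prop :=
  IsConj x (φ (FreeGroup.mk w)) ∧ ∀ w', IsConj x (φ (FreeGroup.mk w')) → w.length ≤ w'.length

variable {x : G} {w : Word S}

theorem Minl.le (h : Minl φ x w) {w' : Word S} (u : FreeGroup S)
    (hw : φ (FreeGroup.mk w') = φ u * φ (FreeGroup.mk w) * (φ u)⁻¹) : w.length ≤ w'.length :=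
  h.2 w' (h.1.trans (isConj_iff.2 ⟨φ u, hw.symm⟩))

theorem Minl.rot {a b : Word S} (h : Minl φ x (a ++ b)) : Minl φ x (b ++ a) := by
  constructor
  · refine h.1.trans (isConj_iff.2 ⟨φ (FreeGroup.mk b), ?_⟩)
    simp only [mk_append, map_mul]
    group
  · intro w' hw'
    have := h.2 w' hw'
    simp only [List.length_append] at this ⊢
    omega

theorem Minl.cyclicallyReduced (h : Minl φ x w) : CyclicallyReduced w := by
  have hred : Reduced w :=
    (Irr.of_minimal (R := ∅) (φ := φ) (by simp) fun q hq => h.le 1 (by simp [hq])).1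
  by_contra hcon
  obtain ⟨a, y, z, rfl, h2⟩ := exists_cancel hred hred hcon
  rcases y with _ | ⟨b, y⟩
  · exact (linv_ne a (List.cons.inj h2).1.symm).elim
  · simp only [List.cons_append, List.cons.injEq] at h2
    obtain ⟨rfl, rfl⟩ := h2
    have := h.le (w' := y) (FreeGroup.mk [a]) (by
      rw [List.cons_append, mk_cons (linv a), mk_append, mk_linv]
      simp only [map_mul, map_inv]
      group)
    simp at this

theorem Minl.ne_nil (h : Minl φ x w) (hx : ¬ IsOfFinOrder x) : w ≠ [] := by
  rintro rfl
  have : x = 1 := by simpa [← FreeGroup.one_eq_mk] using h.1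
  exact hx (this ▸ IsOfFinOrder.one)

theorem exists_minl (hs : Function.Surjective φ) (x : G) : ∃ w, Minl φ x w := by
  classical
  have hex : ∃ n, ∃ w : Word S, w.length = n ∧ IsConj x (φ (FreeGroup.mk w)) := by
    obtain ⟨⟨w⟩, rfl⟩ := hs x
    exact ⟨_, w, rfl, IsConj.refl _⟩
  obtain ⟨w, hl, hw⟩ := Nat.find_spec hex
  exact ⟨w, hw, fun w' hw' => hl ▸ Nat.find_min' hex ⟨w', rfl, hw'⟩⟩

end Quotient

end GSC

namespace GSC

variable {S : Type} {R : Set (Word S)}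

theorem infix_append_cases {y p z : Word S} (h : y <:+: p ++ z) :
    y <:+: p ∨ y <:+: z ∨ ∃ y₁ y₂, y = y₁ ++ y₂ ∧ y₁ ≠ [] ∧ y₂ ≠ [] ∧ y₁ <:+ p ∧ y₂ <+: z := by
  obtain ⟨A, B, h⟩ := h
  rw [List.append_assoc] at h
  rcases List.append_eq_append_iff.1 h with ⟨as, rfl, h'⟩ | ⟨bs, rfl, rfl⟩
  · rcases List.append_eq_append_iff.1 h' with ⟨x, rfl, -⟩ | ⟨bs, rfl, rfl⟩
    · exact .inl ⟨A, x, by simp⟩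
    · by_cases h1 : as = []
      · subst h1
        exact .inr (.inl (List.prefix_append _ _).isInfix)
      by_cases h2 : bs = []
      · subst h2
        exact .inl (by simpa using (List.suffix_append A as).isInfix)
      exact .inr (.inr ⟨as, bs, rfl, h1, h2, List.suffix_append _ _, List.prefix_append _ _⟩)
  · exact .inr (.inl ⟨bs, B, by simp⟩)

theorem infix_wpow_cases {p q y : Word S} {N : ℕ} (hy : y ≠ []) (h : y <:+: wpow (p ++ q) N) :
    y <:+: p ∨ y <:+: q ∨ ∃ y₁ y₂, y = y₁ ++ y₂ ∧ y₁ ≠ [] ∧ y₂ ≠ [] ∧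
      ((y₁ <:+ p ∧ (y₂ <+: q ∨ q <+: y₂)) ∨ (y₁ <:+ q ∧ (y₂ <+: p ∨ p <+: y₂))) := by
  induction N with
  | zero => exact absurd (List.infix_nil.1 h) hy
  | succ N ih =>
    rw [wpow_succ, List.append_assoc] at h
    rcases infix_append_cases h with h | h | ⟨y₁, y₂, h1, h2, h3, h4, h5⟩
    · exact .inl h
    · rcases infix_append_cases h with h | h | ⟨y₁, y₂, h1, h2, h3, h4, h5⟩
      · exact .inr (.inl h)
      · exact ih h
      · refine .inr (.inr ⟨y₁, y₂, h1, h2, h3, .inr ⟨h4, ?_⟩⟩)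
        rcases N with _ | N
        · exact absurd (List.prefix_nil.1 h5) h3
        · rw [wpow_succ, List.append_assoc] at h5
          exact List.prefix_or_prefix_of_prefix h5 (List.prefix_append _ _)
    · exact .inr (.inr ⟨y₁, y₂, h1, h2, h3, .inl ⟨h4,
        List.prefix_or_prefix_of_prefix h5 (List.prefix_append _ _)⟩⟩)

/-- The words `t` and `q` are nonempty and start with different letters. -/
def HeadNe (t q : Word S) : Prop := ∃ a t' b q', t = a :: t' ∧ q = b :: q' ∧ a ≠ b

/-- The words `t` and `q` are nonempty and end with different letters. -/
def LastNe (t q : Word S) : Prop := ∃ a t' b q', t = t' ++ [a] ∧ q = q' ++ [b] ∧ a ≠ b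

theorem SmallCancellation.piece_right (hR : SmallCancellation R) {p₁ u t y z : Word S}
    (h1 : p₁ ++ u ++ t ∈ R) (h2 : u ++ (y ++ z) ∈ R) (h : HeadNe t y) :
    6 * u.length < (p₁ ++ u ++ t).length ∧ 6 * u.length < (u ++ (y ++ z)).length := by
  obtain ⟨a, t, b, y, rfl, rfl, hab⟩ := h
  have h1' := hR.rot p₁ (u ++ a :: t) (by simpa using h1)
  rw [List.append_assoc] at h1'
  have hne : u ++ (a :: t ++ p₁) ≠ u ++ (b :: y ++ z) := fun h => hab (by simp at h; exact h.1)
  have k1 := hR.small _ h1' _ h2 hne u (List.prefix_append _ _) (List.prefix_append _ _)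
  have k2 := hR.small _ h2 _ h1' hne.symm u (List.prefix_append _ _) (List.prefix_append _ _)
  simp only [List.length_append, List.length_cons] at k1 k2 ⊢
  omega

theorem SmallCancellation.piece_left (hR : SmallCancellation R) {u t y z : Word S}
    (h1 : u ++ t ∈ R) (h2 : y ++ (u ++ z) ∈ R) (h : LastNe t y) :
    6 * u.length < (u ++ t).length ∧ 6 * u.length < (y ++ (u ++ z)).length := by
  obtain ⟨a, t, b, y, rfl, rfl, hab⟩ := h
  have h2' := hR.rot (y ++ [b]) (u ++ z) h2
  rw [List.append_assoc] at h2'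
  have hne : u ++ (t ++ [a]) ≠ u ++ (z ++ (y ++ [b])) := by
    intro h
    rw [← List.append_assoc, ← List.append_assoc, ← List.append_assoc] at h
    exact hab (by simpa using (List.append_inj' h rfl).2)
  have k1 := hR.small _ h1 _ h2' hne u (List.prefix_append _ _) (List.prefix_append _ _)
  have k2 := hR.small _ h2' _ h1 hne.symm u (List.prefix_append _ _) (List.prefix_append _ _)
  simp only [List.length_append, List.length_cons] at k1 k2 ⊢
  omega

theorem HeadNe.of_prefix {t q y : Word S} (h : HeadNe t q) (hy : y ≠ []) (hyq : y <+: q) :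
    HeadNe t y := by
  obtain ⟨a, t, b, q, rfl, rfl, hab⟩ := h
  rcases y with _ | ⟨d, y⟩
  · exact absurd rfl hy
  · exact ⟨a, t, d, y, rfl, rfl, by rwa [(List.cons_prefix_cons.1 hyq).1]⟩

theorem LastNe.of_suffix {t q y : Word S} (h : LastNe t q) (hy : y ≠ []) (hyq : y <:+ q) :
    LastNe t y := by
  obtain ⟨a, t, b, q, rfl, rfl, hab⟩ := h
  obtain ⟨x, hx⟩ := hyq
  rcases y.eq_nil_or_concat' with rfl | ⟨y, d, rfl⟩
  · exact absurd rfl hy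
  · rw [← List.append_assoc] at hx
    obtain rfl : d = b := by simpa using (List.append_inj' hx rfl).2
    exact ⟨a, t, d, y, rfl, rfl, hab⟩

theorem SmallCancellation.two_mul_length_le_of_infix (hR : SmallCancellation R) {p t y z : Word S}
    (hp : p ++ t ∈ R) (hp2 : 2 * p.length ≤ (p ++ t).length) (hy : y <:+: p) (hr : y ++ z ∈ R) :
    2 * y.length ≤ (y ++ z).length := by
  obtain ⟨a, b, rfl⟩ := hy
  have h := hR.rot a (y ++ (b ++ t)) (by simpa using hp)
  rw [List.append_assoc] at h
  by_cases heq : y ++ z = y ++ (b ++ t ++ a)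
  · rw [heq]
    simp only [List.length_append] at hp2 ⊢
    omega
  · have := hR.small _ hr _ h heq y (List.prefix_append _ _) (List.prefix_append _ _)
    omega

theorem SmallCancellation.two_mul_length_le_of_cross (hR : SmallCancellation R)
    {p t q t' y₁ y₂ z : Word S} (hp : p ++ t ∈ R) (hq : q ++ t' ∈ R)
    (hq6 : (q ++ t').length ≤ 6 * q.length) (h1 : HeadNe t q) (h2 : LastNe t' p) (hy₁ : y₁ ≠ [])
    (hy₂ : y₂ ≠ []) (hyp : y₁ <:+ p) (hyq : y₂ <+: q ∨ q <+: y₂) (hr : y₁ ++ y₂ ++ z ∈ R) :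
    2 * (y₁ ++ y₂).length ≤ (y₁ ++ y₂ ++ z).length := by
  have h2' := h2.of_suffix hy₁ hyp
  rcases hyq with hyq | ⟨y, rfl⟩
  · obtain ⟨p₁, rfl⟩ := hyp
    have k1 := hR.piece_right hp (by simpa using hr) (h1.of_prefix hy₂ hyq)
    obtain ⟨q₁, rfl⟩ := hyq
    have k2 := hR.piece_left (u := y₂) (t := q₁ ++ t') (by simpa using hq) (by simpa using hr) (by
      obtain ⟨a, t', b, y, rfl, rfl, hab⟩ := h2'
      exact ⟨a, q₁ ++ t', b, y, by simp, rfl, hab⟩)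
    simp only [List.length_append] at *
    omega
  · have k2 := hR.piece_left (z := y ++ z) hq (by simpa using hr) h2'
    omega

theorem SmallCancellation.irr_wpow (hR : SmallCancellation R) {p t q t' : Word S}
    (hp : p ++ t ∈ R) (hq : q ++ t' ∈ R) (hp6 : (p ++ t).length ≤ 6 * p.length)
    (hq6 : (q ++ t').length ≤ 6 * q.length) (hp2 : 2 * p.length ≤ (p ++ t).length)
    (hq2 : 2 * q.length ≤ (q ++ t').length) (h1 : HeadNe t q) (h2 : LastNe t q)
    (h3 : HeadNe t' p) (h4 : LastNe t' p) (hc : CyclicallyReduced (p ++ q)) (N : ℕ) :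
    Irr R (wpow (p ++ q) N) := by
  refine ⟨hc.wpow N, ?_⟩
  rintro y hy r hr ⟨z, rfl⟩
  by_cases h0 : y = []
  · simp [h0]
  rcases infix_wpow_cases h0 hy with h | h | ⟨y₁, y₂, rfl, hy₁, hy₂, ⟨h, h'⟩ | ⟨h, h'⟩⟩
  · exact hR.two_mul_length_le_of_infix hp hp2 h hr
  · exact hR.two_mul_length_le_of_infix hq hq2 h hr
  · exact hR.two_mul_length_le_of_cross hp hq hq6 h1 h4 hy₁ hy₂ h h' hr
  · exact hR.two_mul_length_le_of_cross hq hp hp6 h3 h2 hy₁ hy₂ h h' hr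

end GSC

namespace GSC

variable {S : Type} {R : Set (Word S)} {G : Type*} [Group G] {φ : FreeGroup S →* G} {x : G}
  {w : Word S}

theorem prefix_of_prefix_wpow {c w : Word S} {N : ℕ} (h : c <+: wpow w N)
    (hl : c.length ≤ w.length) : c <+: w := by
  rcases N with _ | N
  · rw [List.prefix_nil.1 h]
    exact List.nil_prefix
  · rw [wpow_succ] at h
    exact List.prefix_of_prefix_length_le h (List.prefix_append _ _) hl

theorem Minl.exists_prefix (h : Minl φ x w) (hx : ¬ IsOfFinOrder x) {A y : Word S} {N : ℕ}
    (hy : A ++ y <+: wpow w N) : ∃ w', Minl φ x w' ∧ y <+: wpow w' N := by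
  induction A generalizing w with
  | nil => exact ⟨w, h, hy⟩
  | cons a A ih =>
    rcases w with _ | ⟨b, w⟩
    · exact absurd rfl (h.ne_nil hx)
    rcases N with _ | N
    · simp at hy
    obtain ⟨B, hB⟩ := hy
    obtain rfl : a = b := by
      rw [wpow_succ] at hB
      exact (List.cons.inj hB).1
    refine ih (w := w ++ [a]) (Minl.rot (a := [a]) h) ⟨B ++ [a], ?_⟩
    have := wpow_rotate [a] w (N + 1)
    rw [List.singleton_append, List.singleton_append, ← hB] at this
    simp only [List.cons_append, List.cons.injEq, true_and] at this
    rw [this]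
    simp

theorem Minl.exists_overlap (hR : SmallCancellation R) (hφ : ∀ r ∈ R, φ (FreeGroup.mk r) = 1)
    (hx : ¬ IsOfFinOrder x) (h : Minl φ x w) {u z : Word S} {N : ℕ} (hu : u <+: wpow w N)
    (hr : u ++ z ∈ R) (hz : z.length < u.length) :
    ∃ c, u = w ++ c ∧ c <+: w ∧ c ≠ [] ∧ 6 * c.length < (u ++ z).length := by
  have hlt : w.length < u.length := by
    by_contra! hle
    obtain ⟨y, rfl⟩ := prefix_of_prefix_wpow hu hle
    have h1 := hφ _ hr
    rw [mk_append, map_mul] at h1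
    have := h.le (w' := wordInv z ++ y) 1 (by
      rw [mk_append, mk_append, mk_wordInv, map_mul, map_mul, map_inv,
        eq_inv_of_mul_eq_one_left h1, map_one, one_mul, inv_one, mul_one])
    simp only [List.length_append, length_wordInv] at this
    omega
  obtain ⟨N, rfl⟩ : ∃ M, N = M + 1 := Nat.exists_eq_succ_of_ne_zero (by
    rintro rfl
    simp [List.prefix_nil.1 hu] at hlt)
  have hu' := hu
  rw [wpow_succ] at hu
  obtain ⟨c, rfl⟩ := List.prefix_of_prefix_length_le (List.prefix_append _ _) hu hlt.le
  rw [List.prefix_append_right_inj] at hu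
  have hcu : c <+: w ++ c := by
    refine List.prefix_of_prefix_length_le (hu.trans ?_) hu' (by simp)
    rw [wpow_succ, wpow_append_self]
    exact List.prefix_append _ _
  rw [List.append_assoc] at hr
  have h6 : 6 * c.length < (w ++ c ++ z).length := by
    by_cases heq : w ++ (c ++ z) = c ++ z ++ w
    · exfalso
      have h1 := congrArg (φ ∘ FreeGroup.mk) (wpow_comm heq)
      have h2 := hφ _ hr
      simp only [Function.comp_apply, mk_wpow, map_pow] at h1
      rw [mk_append, map_mul] at h2
      rw [eq_inv_of_mul_eq_one_right h2, inv_pow, eq_inv_iff_mul_eq_one, ← pow_add] at h1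
      have h3 : IsOfFinOrder (φ (FreeGroup.mk w)) := isOfFinOrder_iff_pow_eq_one.2
        ⟨_, Nat.add_pos_right _ (List.length_pos_iff.2 (h.ne_nil hx)), h1⟩
      obtain ⟨g, hg⟩ := isConj_iff.1 h.1
      rw [← hg, isOfFinOrder_iff_pow_eq_one] at h3
      obtain ⟨n, hn, h3⟩ := h3
      refine hx (isOfFinOrder_iff_pow_eq_one.2 ⟨n, hn, ?_⟩)
      rwa [conj_pow, conj_eq_one_iff] at h3
    · have h1 := hR.rot _ _ hr
      have := hR.small _ hr _ h1 heq c (hcu.trans (by simp))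
        (by rw [List.append_assoc]; exact List.prefix_append _ _)
      rwa [List.append_assoc]
  refine ⟨c, rfl, prefix_of_prefix_wpow hu ?_, ?_, h6⟩
  · simp only [List.length_append] at h6 hz
    omega
  · rintro rfl
    simp at hlt

theorem Reduced.headNe {p X c a Z : Word S} (h : Reduced p) (hp : p = X ++ (c ++ (a ++ Z)))
    (hc : c ≠ []) (ha : a ≠ []) (Y : Word S) : HeadNe (GSC.wordInv c ++ Y) a := by
  obtain ⟨c, d, rfl⟩ := c.eq_nil_or_concat'.resolve_left hc
  rcases a with _ | ⟨b, a⟩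
  · exact absurd rfl ha
  · have := h.ne_linv (x := X ++ c) (a := d) (b := b) (y := a ++ Z) (by simp [hp])
    exact ⟨linv d, GSC.wordInv c ++ Y, b, a, by simp, rfl, this.symm⟩

theorem Reduced.lastNe {p X a c Z : Word S} (h : Reduced p) (hp : p = X ++ (a ++ (c ++ Z)))
    (hc : c ≠ []) (ha : a ≠ []) (Y : Word S) : LastNe (Y ++ GSC.wordInv c) a := by
  obtain ⟨a, b, rfl⟩ := a.eq_nil_or_concat'.resolve_left ha
  rcases c with _ | ⟨d, c⟩
  · exact absurd rfl hc
  · have := h.ne_linv (x := X ++ a) (a := b) (b := d) (y := c ++ Z) (by simp [hp])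
    exact ⟨linv d, Y ++ GSC.wordInv c, b, a, by simp, rfl, fun h => this (linv_eq_iff.1 h)⟩

theorem Minl.exists_square (hR : SmallCancellation R) (hφ : ∀ r ∈ R, φ (FreeGroup.mk r) = 1)
    (hx : ¬ IsOfFinOrder x) (h : Minl φ x w) {u s : Word S} {N : ℕ} (hu : u <+: wpow w N)
    (hr : u ++ s ∈ R) (hz : s.length < u.length)
    (hmax : ∀ w' u' s' M, Minl φ x w' → u' <+: wpow w' M → u' ++ s' ∈ R → s'.length < u'.length →
      u'.length ≤ u.length) :
    ∃ v, IsConj (x ^ 2) (φ (FreeGroup.mk v)) ∧ 2 ≤ v.length ∧ ∀ M, Irr R (wpow v M) := by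
  obtain ⟨c, rfl, ⟨a, rfl⟩, hc, h6⟩ := h.exists_overlap hR hφ hx hu hr hz
  have hrel := hφ _ hr
  simp only [mk_append, map_mul] at hrel
  have has : a.length ≤ s.length := by
    have := h.le (w' := wordInv (c ++ s)) 1 (by
      rw [mk_wordInv, mk_append, mk_append, map_inv, map_mul, map_mul,
        eq_comm, map_one, one_mul, inv_one, mul_one, eq_inv_iff_mul_eq_one, ← hrel]
      group)
    simp only [List.length_append, length_wordInv] at this
    omega
  simp only [List.length_append] at hz h6
  have ha0 : a ≠ [] := by
    rintro rfl
    simp only [List.length_nil] at h6 hz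
    omega
  have hs0 : s ≠ [] := by
    rintro rfl
    exact ha0 (List.eq_nil_of_length_eq_zero (by simpa using has))
  have hal := List.length_pos_iff.2 ha0
  have hrr : CyclicallyReduced (c ++ (a ++ (c ++ s))) := hR.cyc _ (by simpa using hr)
  have hred := hrr.reduced
  have hhead : ∀ b a' s', a = b :: a' → s ≠ b :: s' := by
    rintro b a' s' rfl rfl
    have := hmax (c ++ b :: a') (c ++ b :: a' ++ c ++ [b]) s' 3 h
      ⟨a' ++ (c ++ b :: a'), by simp [wpow_succ]⟩ (by simpa using hr) (by simp at hz ⊢; omega)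
    simp at this
  have hlast : ∀ b a' s', a = a' ++ [b] → s ≠ s' ++ [b] := by
    rintro b a' s' rfl rfl
    have := hmax ([b] ++ (c ++ a')) ([b] ++ (c ++ (a' ++ [b] ++ c))) s' 2
      (Minl.rot (by simpa using h)) ⟨a', by simp [wpow_succ]⟩
      (by simpa using hR.rot (c ++ (a' ++ [b]) ++ c ++ s') [b] (by simpa using hr))
      (by simp at hz ⊢; omega)
    simp at this
  have hra : Reduced a := hred.subword ⟨c, c ++ s, by simp⟩
  have hrs : Reduced s := hred.subword ⟨c ++ (a ++ c), [], by simp⟩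
  have hcyc : CyclicallyReduced (wordInv s ++ a) := by
    have hv : Reduced (wordInv s ++ a) := by
      by_contra hcon
      obtain ⟨b, s', a', h1, h2⟩ := exists_cancel hrs.wordInv hra hcon
      refine hhead _ _ (wordInv s') h2 ?_
      rw [← wordInv_wordInv s, h1]
      simp
    by_contra hcon
    obtain ⟨b, y, z, h1, h2⟩ := exists_cancel hv hv hcon
    obtain ⟨a', b', ha'⟩ := a.eq_nil_or_concat'.resolve_left ha0
    obtain ⟨s', d, hs'⟩ := s.eq_nil_or_concat'.resolve_left hs0
    rw [ha', ← List.append_assoc] at h1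
    have hb := (List.append_inj' h1 rfl).2
    rw [hs'] at h2
    simp only [wordInv_append, wordInv_cons, wordInv_nil, List.nil_append, List.cons_append,
      List.cons.injEq, linv_inj, and_true] at h2 hb
    exact hlast b' a' s' ha' (by rw [hs', h2.1, hb])
  refine ⟨wordInv s ++ a, ?_, by simp; omega, hR.irr_wpow (t := wordInv c ++ (wordInv a ++ wordInv c))
    (t' := c ++ (s ++ c)) ?_ ?_ ?_ ?_ ?_ ?_ ?_ ?_ ?_ ?_ hcyc⟩
  · obtain ⟨g, hg⟩ := isConj_iff.1 h.1
    refine isConj_iff.2 ⟨g, ?_⟩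
    rw [← conj_pow, hg, mk_append, mk_append, mk_wordInv, map_mul, map_mul, map_inv,
      ← eq_inv_of_mul_eq_one_left hrel, pow_two]
    simp only [mul_assoc]
  · simpa using hR.inv _ hr
  · simpa using hR.rot c (a ++ (c ++ s)) (by simpa using hr)
  · simp only [List.length_append, length_wordInv]; omega
  · simp only [List.length_append]; omega
  · simp only [List.length_append, length_wordInv]; omega
  · simp only [List.length_append]; omega
  · exact hred.headNe (X := []) (Z := c ++ s) rfl hc ha0 _
  · rw [← List.append_assoc]
    exact hred.lastNe (X := c) (Z := s) rfl hc ha0 _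
  · have h1 : Reduced (wordInv (s ++ c)) :=
      Reduced.wordInv (hrr.subword ⟨c ++ (a ++ c), a ++ (c ++ s), by simp⟩)
    simpa using h1.headNe (X := []) (c := wordInv c) (a := wordInv s) (Z := []) (by simp)
      (by simpa using hc) (by simpa using hs0) (s ++ c)
  · have h1 : Reduced (wordInv (c ++ s)) :=
      Reduced.wordInv (hred.subword ⟨c ++ a, [], by simp⟩)
    simpa using h1.lastNe (X := []) (c := wordInv c) (a := wordInv s) (Z := []) (by simp)
      (by simpa using hc) (by simpa using hs0) (c ++ s)

end GSC

namespace GSC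

section

variable {S : Type} {R : Set (Word S)} {G : Type*} [Group G] {φ : FreeGroup S →* G} {x : G}

theorem SmallCancellation.exists_irr_wpow (hR : SmallCancellation R)
    (hφ : ∀ r ∈ R, φ (FreeGroup.mk r) = 1) (hs : Function.Surjective φ) (hx : ¬ IsOfFinOrder x) :
    ∃ k v, IsConj (x ^ k) (φ (FreeGroup.mk v)) ∧ 0 < k ∧ k ≤ v.length ∧ ∀ N, Irr R (wpow v N) := by
  obtain ⟨w, hw⟩ := exists_minl hs x
  by_cases hirr : ∀ N, Irr R (wpow w N)
  · exact ⟨1, w, by simpa using hw.1, one_pos, List.length_pos_iff.2 (hw.ne_nil hx), hirr⟩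
  push Not at hirr
  obtain ⟨N, hN⟩ := hirr
  let Q : Set ℕ := {m | ∃ w u z N, Minl φ x w ∧ u <+: wpow w N ∧ u ++ z ∈ R ∧
    z.length < u.length ∧ u.length = m}
  have hne : Q.Nonempty := by
    have hred : Reduced (wpow w N) := hw.cyclicallyReduced.wpow N
    simp only [Irr, hred, true_and] at hN
    push Not at hN
    obtain ⟨y, ⟨A, B, hAB⟩, _, hr, ⟨z, rfl⟩, hlt⟩ := hN
    obtain ⟨w', hw', hy⟩ := hw.exists_prefix hx (A := A) (y := y) (N := N) ⟨B, hAB⟩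
    refine ⟨_, w', y, z, N, hw', hy, hr, ?_, rfl⟩
    simp only [List.length_append] at hlt
    omega
  have hbdd : BddAbove Q := by
    refine ⟨2 * w.length, ?_⟩
    rintro _ ⟨w', u, z, M, hw', hu, hr, hz, rfl⟩
    obtain ⟨c, rfl, hc, -⟩ := hw'.exists_overlap hR hφ hx hu hr hz
    have h1 := hw'.2 w hw.1
    have h2 := hc.length_le
    simp only [List.length_append]
    omega
  obtain ⟨w', u, z, M, hw', hu, hr, hz, hm⟩ := Nat.sSup_mem hne hbdd
  obtain ⟨v, hv, hl, hirr⟩ := hw'.exists_square hR hφ hx hu hr hz fun w₁ u₁ z₁ M₁ h₁ h₂ h₃ h₄ =>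
    hm ▸ le_csSup hbdd ⟨w₁, u₁, z₁, M₁, h₁, h₂, h₃, h₄, rfl⟩
  exact ⟨2, v, hv, two_pos, hl, hirr⟩

theorem SmallCancellation.le_three_mul_length (hR : SmallCancellation R)
    (hφ : ∀ g, φ g = 1 ↔ ∃ n, Area R n g) (hs : Function.Surjective φ) (hx : ¬ IsOfFinOrder x)
    {n : ℕ} {q : Word S} (hq : φ (FreeGroup.mk q) = x ^ n) : n ≤ 3 * q.length := by
  obtain ⟨k, v, hv, hk, hl, hirr⟩ :=
    hR.exists_irr_wpow (fun r hr => (hφ _).2 ⟨1, Area.of_rel hr⟩) hs hx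
  have h1 := hR.le_of_irr_wpow hφ hs hv hirr hq
  refine Nat.le_of_mul_le_mul_left ?_ hk
  calc k * n ≤ n * v.length := by rw [mul_comm]; exact Nat.mul_le_mul_left n hl
    _ ≤ 3 * (k * q.length) := h1
    _ = k * (3 * q.length) := by ring

end

section

variable {S : Type}

theorem wordVal_eq_mk (w : Word S) : wordVal w = FreeGroup.mk w := by
  induction w with
  | nil => simp [wordVal, FreeGroup.one_eq_mk]
  | cons a w ih =>
    rw [← List.singleton_append, mk_append, ← ih]
    obtain ⟨a, _ | _⟩ := a <;> simp [wordVal, FreeGroup.of, FreeGroup.invRev]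

variable (P : C6Presentation S)

theorem C6Presentation.smallCancellation : SmallCancellation {r ∈ P.rels | r ≠ []} where
  inv r hr := ⟨P.inv_mem r hr.1, by simpa using hr.2⟩
  rot u v h := by
    refine ⟨?_, fun h' => h.2 ?_⟩
    · simpa using P.rotate_mem _ h.1 u.length
    · rw [List.append_eq_nil_iff] at h' ⊢
      exact h'.symm
  ne_nil r hr := hr.2
  cyc r hr := P.cyclically_reduced r hr.1
  small r hr r' hr' hne p hp hp' :=
    P.small_cancellation r hr.1 p hp ⟨r, hr.1, r', hr'.1, hne, hp, hp'⟩

theorem C6Presentation.mk_eq_one_iff (g : FreeGroup S) :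
    PresentedGroup.mk (wordVal '' P.rels) g = 1 ↔ ∃ n, Area {r ∈ P.rels | r ≠ []} n g := by
  rw [PresentedGroup.mk_eq_one_iff]
  constructor
  · intro h
    induction h using Subgroup.closure_induction with
    | mem x hx =>
      obtain ⟨_, ⟨r, hr, rfl⟩, hx⟩ := Group.mem_conjugatesOfSet_iff.1 hx
      obtain ⟨u, rfl⟩ := isConj_iff.1 hx
      by_cases h : r = []
      · exact ⟨0, by simpa [h, wordVal] using Area.one 0⟩
      · rw [wordVal_eq_mk]
        exact ⟨1, (Area.of_rel (R := {r ∈ P.rels | r ≠ []}) ⟨hr, h⟩).conj u⟩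
    | one => exact ⟨0, Area.one 0⟩
    | mul x y _ _ hx hy =>
      obtain ⟨m, hx⟩ := hx
      obtain ⟨n, hy⟩ := hy
      exact ⟨_, hx.mul' hy⟩
    | inv x _ hx =>
      obtain ⟨m, hx⟩ := hx
      exact ⟨m, hx.inv P.smallCancellation.toSymmetrized⟩
  · rintro ⟨n, h⟩
    induction h with
    | one n => exact one_mem _
    | mul u hr h ih =>
      refine mul_mem (Subgroup.normalClosure_normal.conj_mem _ (Subgroup.subset_normalClosure ?_) u) ih
      exact ⟨_, hr.1, wordVal_eq_mk _⟩

theorem C6Presentation.exists_word (g : P.Grp) :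
    ∃ q : Word S, q.length = wordLength P.gens g ∧
      PresentedGroup.mk (wordVal '' P.rels) (FreeGroup.mk q) = g := by
  have hletter (a : S × Bool) :
      PresentedGroup.mk (wordVal '' P.rels) (FreeGroup.mk [a]) ∈ P.gens ∨
        (PresentedGroup.mk (wordVal '' P.rels) (FreeGroup.mk [a]))⁻¹ ∈ P.gens := by
    obtain ⟨a, _ | _⟩ := a
    · exact Or.inr ⟨a, by rw [← map_inv]; rfl⟩
    · exact Or.inl ⟨a, rfl⟩
  have hne : {n : ℕ | ∃ l : List P.Grp, l.length = n ∧ (∀ x ∈ l, x ∈ P.gens ∨ x⁻¹ ∈ P.gens) ∧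
      l.prod = g}.Nonempty := by
    obtain ⟨⟨q⟩, rfl⟩ := PresentedGroup.mk_surjective _ g
    refine ⟨_, q.map fun a => PresentedGroup.mk (wordVal '' P.rels) (FreeGroup.mk [a]), rfl, ?_, ?_⟩
    · intro x hx
      obtain ⟨a, -, rfl⟩ := List.mem_map.1 hx
      exact hletter a
    · change _ = PresentedGroup.mk (wordVal '' P.rels) (FreeGroup.mk q)
      induction q with
      | nil => simp [← FreeGroup.one_eq_mk]
      | cons a q ih => rw [List.map_cons, List.prod_cons, ih, ← map_mul, ← mk_append]; rfl
  obtain ⟨l, hl, hgen, rfl⟩ := Nat.sInf_mem hne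
  change l.length = wordLength P.gens l.prod at hl
  rw [← hl]
  clear hl hne
  induction l with
  | nil => exact ⟨[], rfl, by simp [← FreeGroup.one_eq_mk]⟩
  | cons y l ih =>
    obtain ⟨q, hq, hprod⟩ := ih fun x hx => hgen x (List.mem_cons_of_mem _ hx)
    obtain ⟨a, ha⟩ : ∃ a : S × Bool,
        PresentedGroup.mk (wordVal '' P.rels) (FreeGroup.mk [a]) = y := by
      obtain ⟨a, ha⟩ | ⟨a, ha⟩ := hgen y List.mem_cons_self
      · exact ⟨(a, true), ha⟩
      · refine ⟨(a, false), ?_⟩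
        rw [← inv_inj, ← ha, ← map_inv]
        rfl
    refine ⟨a :: q, by simp [hq], ?_⟩
    rw [← List.singleton_append, mk_append, map_mul, ha, hprod, List.prod_cons]

theorem C6Presentation.le_three_mul_wordLength {x : P.Grp} (hx : ¬ IsOfFinOrder x) (n : ℕ) :
    n ≤ 3 * wordLength P.gens (x ^ n) := by
  obtain ⟨q, hq, hqx⟩ := P.exists_word (x ^ n)
  rw [← hq]
  exact P.smallCancellation.le_three_mul_length P.mk_eq_one_iff
    (PresentedGroup.mk_surjective _) hx hqx

end

/-- In a classical C'(1/6) group over a finite alphabet, every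
infinite-order element `x` satisfies `|xⁿ|_S ≥ n/3` for all `n ≥ 1`; hence its
translation length is at least `1/3`. -/
theorem statement8 {S : Type} [Finite S] (P : C6Presentation S) (x : P.Grp)
    (hx : ¬ IsOfFinOrder x) :
    (∀ n : ℕ, 1 ≤ n → (n : ℝ) / 3 ≤ (wordLength P.gens (x ^ n) : ℝ)) ∧
    ∀ t : ℝ, Filter.Tendsto
        (fun n : ℕ => (wordLength P.gens (x ^ n) : ℝ) / (n : ℝ))
        Filter.atTop (nhds t) →
      1 / 3 ≤ t := by
  have key : ∀ n : ℕ, (n : ℝ) / 3 ≤ (wordLength P.gens (x ^ n) : ℝ) := by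
    intro n
    have h : (n : ℝ) ≤ 3 * (wordLength P.gens (x ^ n) : ℝ) :=
      mod_cast P.le_three_mul_wordLength hx n
    linarith
  refine ⟨fun n _ => key n, fun t ht => ge_of_tendsto ht ?_⟩
  filter_upwards [Filter.eventually_ge_atTop 1] with n hn
  have hn : (0 : ℝ) < n := by exact_mod_cast hn
  rw [le_div_iff₀ hn]
  linarith [key n]

end GSC
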